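/- arXiv:2412.20900 — 2 statements merged into one kernel-verified Lean document; each statement's English description precedes it below -/
import Mathlib

section
/- Let X be a real Banach space. Then X is isomorphic to a Hilbert space if and only if for every closed subspace Z of X there exist a constant C ≥ 0 and a bounded linear Lipschitz-extension operator from Z to X with bound C. -/
open scoped NNReal

universe u

variable (X : Type u) [NormedAddCommGroup X] [NormedSpace ℝ X]

/-- `f` is a real inner product on `X`: symmetric, bilinear, positive definite. -/
def IsRealInner (f : X → X → ℝ) : Prop :=
  (∀ x y, f x y = f y x) ∧
  (∀ (a : ℝ) (x y : X), f (a • x) y = a * f x y) ∧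
  (∀ x y z : X, f (x + y) z = f x z + f y z) ∧
  (∀ x : X, x ≠ 0 → 0 < f x x)

/-- `X` is isomorphic to a Hilbert space: there is a real inner product on `X` whose
induced norm is equivalent to the given norm. -/
def IsomorphicToHilbert : Prop :=
  ∃ f : X → X → ℝ, IsRealInner X f ∧
    ∃ a b : ℝ, 0 < a ∧ 0 < b ∧ ∀ x : X, a * ‖x‖ ^ 2 ≤ f x x ∧ f x x ≤ b * ‖x‖ ^ 2

/-- `F` is a bounded linear Lipschitz-extension operator from the subspace `Z` to `X`
with bound `C`: it is linear, and it sends every `K`-Lipschitz function on `Z` vanishing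
at `0` to a `C·K`-Lipschitz extension vanishing at `0`. -/
def IsLipExtensionOperator (Z : Submodule ℝ X) (C : ℝ≥0)
    (F : (Z → ℝ) →ₗ[ℝ] (X → ℝ)) : Prop :=
  ∀ (K : ℝ≥0) (f : Z → ℝ), f 0 = 0 → LipschitzWith K f →
    (∀ z : Z, F f (z : X) = f z) ∧ F f 0 = 0 ∧ LipschitzWith (C * K) (F f)

namespace LipExt

open Filter Topology

section UltrafilterLimit

variable {ι E : Type*} [NormedAddCommGroup E]

/-- The limit of a function along an ultrafilter. -/
noncomputable def ulim (W : Ultrafilter ι) (f : ι → E) : E := limUnder (W : Filter ι) f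

lemma tendsto_ulim_of_eventually [ProperSpace E] {W : Ultrafilter ι} {f : ι → E} {c : ℝ}
    (h : ∀ᶠ i in (W : Filter ι), ‖f i‖ ≤ c) : Tendsto f W (𝓝 (ulim W f)) := by
  refine tendsto_nhds_limUnder ?_
  obtain ⟨x, -, hx⟩ := (isCompact_closedBall (0 : E) c).ultrafilter_le_nhds' (W.map f)
    (Filter.mem_map.2 (h.mono fun i hi => by simpa using hi))
  exact ⟨x, hx⟩

lemma tendsto_ulim [ProperSpace E] (W : Ultrafilter ι) {f : ι → E} {c : ℝ}
    (h : ∀ i, ‖f i‖ ≤ c) : Tendsto f W (𝓝 (ulim W f)) :=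
  tendsto_ulim_of_eventually (.of_forall h)

lemma ulim_eq {W : Ultrafilter ι} {f : ι → E} {x : E} (h : Tendsto f W (𝓝 x)) :
    ulim W f = x := h.limUnder_eq

end UltrafilterLimit

section SpreadNorm

variable {ι V : Type*} [NormedAddCommGroup V] [NormedSpace ℝ V]

/-- The iterated limit along `W` of `‖v + ∑ j < k, a j • y (i j)‖`, the limit in the index with
the largest `j` being taken last. -/
noncomputable def spreadNorm (W : Ultrafilter ι) (y : ι → V) : ℕ → (ℕ → ℝ) → V → ℝ
  | 0, _, v => ‖v‖
  | k + 1, a, v => ulim W fun i => spreadNorm W y k a (v + a k • y i)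

variable {W : Ultrafilter ι} {y : ι → V}

lemma spreadNorm_mem (hy : ∀ i, ‖y i‖ = 1) (k : ℕ) (a : ℕ → ℝ) (v : V) :
    0 ≤ spreadNorm W y k a v ∧
      spreadNorm W y k a v ≤ ‖v‖ + ∑ j ∈ Finset.range k, |a j| := by
  induction k generalizing v with
  | zero => simp [spreadNorm]
  | succ k ih =>
    have key : ∀ i, 0 ≤ spreadNorm W y k a (v + a k • y i) ∧
        spreadNorm W y k a (v + a k • y i) ≤ ‖v‖ + ∑ j ∈ Finset.range (k + 1), |a j| := by
      intro i
      refine ⟨(ih _).1, (ih _).2.trans ?_⟩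
      have : ‖v + a k • y i‖ ≤ ‖v‖ + |a k| := by
        refine (norm_add_le _ _).trans ?_
        rw [norm_smul, hy, mul_one, Real.norm_eq_abs]
      rw [Finset.sum_range_succ]
      linarith
    have ht := tendsto_ulim W (f := fun i => spreadNorm W y k a (v + a k • y i))
      (fun i => (Real.norm_of_nonneg (key i).1).trans_le (key i).2)
    exact ⟨ge_of_tendsto' ht fun i => (key i).1, le_of_tendsto' ht fun i => (key i).2⟩

lemma tendsto_spreadNorm (hy : ∀ i, ‖y i‖ = 1) (k : ℕ) (a : ℕ → ℝ) (c : ℝ) (v : V) :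
    Tendsto (fun i => spreadNorm W y k a (v + c • y i)) W
      (𝓝 (ulim W fun i => spreadNorm W y k a (v + c • y i))) := by
  refine tendsto_ulim W (c := ‖v‖ + |c| + ∑ j ∈ Finset.range k, |a j|) fun i => ?_
  rw [Real.norm_of_nonneg (spreadNorm_mem hy k a _).1]
  refine (spreadNorm_mem hy k a _).2.trans ?_
  gcongr
  refine (norm_add_le _ _).trans ?_
  rw [norm_smul, hy, mul_one, Real.norm_eq_abs]

lemma tendsto_spreadNorm_succ (hy : ∀ i, ‖y i‖ = 1) (k : ℕ) (a : ℕ → ℝ) (v : V) :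
    Tendsto (fun i => spreadNorm W y k a (v + a k • y i)) W
      (𝓝 (spreadNorm W y (k + 1) a v)) :=
  tendsto_spreadNorm hy k a (a k) v

lemma spreadNorm_nonneg (hy : ∀ i, ‖y i‖ = 1) (k : ℕ) (a : ℕ → ℝ) (v : V) :
    0 ≤ spreadNorm W y k a v := (spreadNorm_mem hy k a v).1

lemma spreadNorm_congr {k : ℕ} {a b : ℕ → ℝ} (h : ∀ j < k, a j = b j) (v : V) :
    spreadNorm W y k a v = spreadNorm W y k b v := by
  induction k generalizing v with
  | zero => rfl
  | succ k ih =>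
    simp only [spreadNorm, h k k.lt_succ_self, ih fun j hj => h j (hj.trans k.lt_succ_self)]

lemma spreadNorm_succ_of_eq_zero (hy : ∀ i, ‖y i‖ = 1) {k : ℕ} {a : ℕ → ℝ} (h : a k = 0)
    (v : V) : spreadNorm W y (k + 1) a v = spreadNorm W y k a v := by
  refine tendsto_nhds_unique (tendsto_spreadNorm_succ hy k a v) ?_
  simp [h]

lemma spreadNorm_zero_left (hy : ∀ i, ‖y i‖ = 1) (k : ℕ) (v : V) :
    spreadNorm W y k 0 v = ‖v‖ := by
  induction k with
  | zero => rfl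
  | succ k ih => rw [spreadNorm_succ_of_eq_zero hy rfl, ih]

lemma spreadNorm_add_le (hy : ∀ i, ‖y i‖ = 1) (k : ℕ) (a b : ℕ → ℝ) (v w : V) :
    spreadNorm W y k (a + b) (v + w) ≤ spreadNorm W y k a v + spreadNorm W y k b w := by
  induction k generalizing v w with
  | zero => exact norm_add_le v w
  | succ k ih =>
    refine le_of_tendsto_of_tendsto' (tendsto_spreadNorm_succ hy k (a + b) (v + w))
      ((tendsto_spreadNorm_succ hy k a v).add (tendsto_spreadNorm_succ hy k b w)) fun i => ?_
    have h : v + w + (a + b) k • y i = v + a k • y i + (w + b k • y i) := by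
      rw [Pi.add_apply]; module
    rw [h]
    exact ih _ _

lemma spreadNorm_smul (hy : ∀ i, ‖y i‖ = 1) (k : ℕ) (c : ℝ) (a : ℕ → ℝ) (v : V) :
    spreadNorm W y k (c • a) (c • v) = |c| * spreadNorm W y k a v := by
  induction k generalizing v with
  | zero => simp [spreadNorm, norm_smul]
  | succ k ih =>
    refine tendsto_nhds_unique (tendsto_spreadNorm_succ hy k _ _)
      (((tendsto_spreadNorm_succ hy k a v).const_mul |c|).congr fun i => ?_)
    rw [← ih, Pi.smul_apply]
    congr 1
    module

/-- A weakly null direction can only increase the norm. -/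
lemma spreadNorm_le_succ (hy : ∀ i, ‖y i‖ = 1)
    (hw : ∀ f : V →L[ℝ] ℝ, Tendsto (fun i => f (y i)) W (𝓝 0)) (k : ℕ) (a : ℕ → ℝ) (v : V) :
    spreadNorm W y k a v ≤ spreadNorm W y (k + 1) a v := by
  by_cases h0 : ((a, v) : (ℕ → ℝ) × V) = 0
  · obtain ⟨rfl, rfl⟩ := Prod.mk_eq_zero.1 h0
    simp [spreadNorm_zero_left hy]
  obtain ⟨g, hg, hgN⟩ := exists_extension_of_le_sublinear
    (LinearPMap.mkSpanSingleton ((a, v) : (ℕ → ℝ) × V) (spreadNorm W y k a v) h0)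
    (fun p => spreadNorm W y k p.1 p.2)
    (fun c hc p => by
      rw [Prod.smul_fst, Prod.smul_snd, spreadNorm_smul hy, abs_of_pos hc])
    (fun p q => spreadNorm_add_le hy k p.1 q.1 p.2 q.2)
    (by
      rintro ⟨p, hp⟩
      obtain ⟨c, rfl⟩ := Submodule.mem_span_singleton.1 hp
      refine (LinearPMap.mkSpanSingleton'_apply _ _ _ c hp).trans_le ?_
      simp only [smul_eq_mul, Prod.smul_fst, Prod.smul_snd, RingHom.id_apply]
      rw [spreadNorm_smul hy]
      exact mul_le_mul_of_nonneg_right (le_abs_self c) (spreadNorm_nonneg hy k a v))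
  have hgx : g (a, v) = spreadNorm W y k a v := by
    have := hg ⟨(a, v), Submodule.mem_span_singleton_self _⟩
    exact this.trans (LinearPMap.mkSpanSingleton_apply ℝ ℝ h0 _)
  have hgv : ∀ w : V, |g (0, w)| ≤ 1 * ‖w‖ := by
    intro w
    have h1 := hgN (0, w)
    have h2 := hgN (0, -w)
    have h3 : g (0, -w) = - g (0, w) := by
      rw [← map_neg]; simp
    simp only [spreadNorm_zero_left hy, norm_neg] at h1 h2
    rw [abs_le]
    constructor <;> linarith
  let f : V →L[ℝ] ℝ := (g ∘ₗ LinearMap.inr ℝ (ℕ → ℝ) V).mkContinuous 1 hgv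
  have hf : ∀ w, f w = g (0, w) := fun w => rfl
  have hlim : Tendsto (fun i => spreadNorm W y k a v + a k * f (y i)) W
      (𝓝 (spreadNorm W y k a v + a k * 0)) := ((hw f).const_mul _).const_add _
  rw [mul_zero, add_zero] at hlim
  refine le_of_tendsto_of_tendsto' hlim (tendsto_spreadNorm_succ hy k a v) fun i => ?_
  have := hgN (a, v + a k • y i)
  have h2 : g (a, v + a k • y i) = g (a, v) + a k * g (0, y i) := by
    rw [← smul_eq_mul, ← map_smul, ← map_add]; simp
  rw [h2, hgx] at this
  exact this

lemma spreadNorm_mul_le (hy : ∀ i, ‖y i‖ = 1)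
    (hw : ∀ f : V →L[ℝ] ℝ, Tendsto (fun i => f (y i)) W (𝓝 0)) (k : ℕ) {t : ℕ → ℝ}
    (ht : ∀ j, t j ∈ Set.Icc 0 1) (a : ℕ → ℝ) (v : V) :
    spreadNorm W y k (t * a) v ≤ spreadNorm W y k a v := by
  induction k generalizing v with
  | zero => exact le_rfl
  | succ k ih =>
    have h1 : spreadNorm W y (k + 1) (t * a) v ≤
        t k * spreadNorm W y (k + 1) a v + (1 - t k) * spreadNorm W y k a v := by
      refine le_of_tendsto_of_tendsto' (tendsto_spreadNorm_succ hy k (t * a) v)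
        (((tendsto_spreadNorm_succ hy k a v).const_mul (t k)).add_const _) fun i => ?_
      refine (ih _).trans ?_
      have := spreadNorm_add_le (W := W) hy k (t k • a) ((1 - t k) • a) (t k • (v + a k • y i))
        ((1 - t k) • v)
      rw [spreadNorm_smul hy, spreadNorm_smul hy, abs_of_nonneg (ht k).1,
        abs_of_nonneg (sub_nonneg.2 (ht k).2)] at this
      have e1 : t k • a + (1 - t k) • a = a := by module
      have e2 : t k • (v + a k • y i) + (1 - t k) • v = v + (t * a) k • y i := by
        rw [Pi.mul_apply]; module
      rwa [e1, e2] at this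
    have h2 := spreadNorm_le_succ hy hw k a v
    have h3 := mul_le_mul_of_nonneg_left h2 (sub_nonneg.2 (ht k).2)
    linarith

lemma spreadNorm_indicator (hy : ∀ i, ‖y i‖ = 1) (k : ℕ) (A : Finset ℕ)
    (hA : A ⊆ Finset.range k) (v : V) :
    spreadNorm W y k ((A : Set ℕ).indicator 1) v = spreadNorm W y A.card 1 v := by
  classical
  induction k generalizing v A with
  | zero =>
    obtain rfl : A = ∅ := by simpa using hA
    rfl
  | succ k ih =>
    by_cases hk : k ∈ A
    · have hsub : A.erase k ⊆ Finset.range k := by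
        intro j hj
        have h1 := Finset.mem_range.1 (hA (Finset.mem_of_mem_erase hj))
        have h2 := Finset.ne_of_mem_erase hj
        exact Finset.mem_range.2 (by omega)
      have hc : A.card = (A.erase k).card + 1 := (Finset.card_erase_add_one hk).symm
      rw [hc]
      simp only [spreadNorm]
      congr 1
      funext i
      rw [← ih _ hsub]
      have hk' : (A : Set ℕ).indicator (1 : ℕ → ℝ) k = 1 := by simp [hk]
      rw [hk', Pi.one_apply]
      refine spreadNorm_congr (fun j hj => ?_) _
      by_cases hjA : j ∈ A
      · simp [Set.indicator, hjA, hj.ne]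
      · simp [Set.indicator, hjA]
    · rw [spreadNorm_succ_of_eq_zero hy (by simp [hk]), ih]
      intro j hj
      have h1 := Finset.mem_range.1 (hA hj)
      have h2 : j ≠ k := fun h => hk (h ▸ hj)
      exact Finset.mem_range.2 (by omega)

lemma norm_le_spreadNorm (hy : ∀ i, ‖y i‖ = 1)
    (hw : ∀ f : V →L[ℝ] ℝ, Tendsto (fun i => f (y i)) W (𝓝 0)) (k : ℕ) (a : ℕ → ℝ) (v : V) :
    ‖v‖ ≤ spreadNorm W y k a v := by
  induction k with
  | zero => exact le_rfl
  | succ k ih => exact ih.trans (spreadNorm_le_succ hy hw k a v)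

/-- Finitely many values of `spreadNorm` are approximated by norms of actual vectors. -/
lemma exists_approx_spreadNorm (hy : ∀ i, ‖y i‖ = 1) (k : ℕ) (P : Set ((ℕ → ℝ) × V))
    (hP : P.Finite) {ε : ℝ} (hε : 0 < ε) :
    ∃ s : ℕ → ι, ∀ p ∈ P,
      |‖p.2 + ∑ j ∈ Finset.range k, p.1 j • y (s j)‖ - spreadNorm W y k p.1 p.2| < ε := by
  classical
  induction k generalizing P ε with
  | zero =>
    obtain ⟨i⟩ : Nonempty ι := W.neBot.nonempty
    exact ⟨fun _ => i, fun p _ => by simpa [spreadNorm] using hε⟩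
  | succ k ih =>
    have hev : ∀ᶠ i in (W : Filter ι), ∀ p ∈ P, |spreadNorm W y k p.1 (p.2 + p.1 k • y i) -
        spreadNorm W y (k + 1) p.1 p.2| < ε / 2 := by
      rw [Filter.eventually_all_finite hP]
      intro p _
      exact (Metric.tendsto_nhds.1 (tendsto_spreadNorm_succ hy k p.1 p.2)) _ (half_pos hε)
    obtain ⟨i, hi⟩ := hev.exists
    obtain ⟨s, hs⟩ := ih ((fun p : (ℕ → ℝ) × V => (p.1, p.2 + p.1 k • y i)) '' P)
      (hP.image _) (half_pos hε)
    refine ⟨Function.update s k i, fun p hp => ?_⟩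
    have h1 := hi p hp
    have h2 := hs _ (Set.mem_image_of_mem _ hp)
    have h3 : p.2 + ∑ j ∈ Finset.range (k + 1), p.1 j • y (Function.update s k i j) =
        p.2 + p.1 k • y i + ∑ j ∈ Finset.range k, p.1 j • y (s j) := by
      rw [Finset.sum_range_succ, Function.update_self, add_assoc,
        add_comm (p.1 k • y i)]
      congr 2
      refine Finset.sum_congr rfl fun j hj => ?_
      rw [Function.update_of_ne (Finset.mem_range.1 hj).ne]
    rw [h3]
    simp only at h2
    rw [abs_lt] at *
    constructor <;> linarith [h1.1, h1.2, h2.1, h2.2]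

end SpreadNorm

section Flat

/-- A seminorm on functions on a finite type which is monotone under multiplication by functions
with values in `[0, 1]` and whose value at an indicator function depends only on the
cardinality. -/
structure IsFlat {Ω : Type*} (φ : ℕ → ℝ) (q : (Ω → ℝ) → ℝ) : Prop where
  add_le : ∀ f g, q (f + g) ≤ q f + q g
  smul : ∀ (c : ℝ) f, q (c • f) = |c| * q f
  mul_le : ∀ t : Ω → ℝ, (∀ x, t x ∈ Set.Icc 0 1) → ∀ f, q (t * f) ≤ q f
  indicator : ∀ A : Finset Ω, q ((A : Set Ω).indicator 1) = φ A.card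

variable {Ω : Type*} {φ : ℕ → ℝ} {q : (Ω → ℝ) → ℝ}

lemma IsFlat.zero (hq : IsFlat φ q) : q 0 = 0 := by
  have := hq.smul 0 0
  simpa using this

lemma IsFlat.neg (hq : IsFlat φ q) (f : Ω → ℝ) : q (-f) = q f := by
  have := hq.smul (-1) f
  simpa using this

lemma IsFlat.le_of_mem_Icc (hq : IsFlat φ q) (A : Finset Ω) {f : Ω → ℝ}
    (hf : ∀ x, f x ∈ Set.Icc 0 1) (hA : ∀ x ∉ A, f x = 0) : q f ≤ φ A.card := by
  rw [← hq.indicator A]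
  have : f = f * (A : Set Ω).indicator 1 := by
    funext x
    by_cases hx : x ∈ A
    · simp [hx]
    · simp [hx, hA x hx]
  calc q f = q (f * (A : Set Ω).indicator 1) := by rw [← this]
    _ ≤ _ := hq.mul_le f hf _

lemma IsFlat.mul_card_le (hq : IsFlat φ q) (A : Finset Ω) {f : Ω → ℝ} {c : ℝ} (hc : 0 < c)
    (hA : ∀ x ∈ A, c ≤ f x) : c * φ A.card ≤ q f := by
  classical
  rw [← hq.indicator A]
  conv_lhs => rw [← abs_of_pos hc]
  rw [← hq.smul]
  have : c • (A : Set Ω).indicator 1 = (fun x => if x ∈ A then c / f x else 0) * f := by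
    funext x
    by_cases hx : x ∈ A
    · have : f x ≠ 0 := (hc.trans_le (hA x hx)).ne'
      simp [hx, this]
    · simp [hx]
  rw [this]
  refine hq.mul_le _ (fun x => ?_) f
  by_cases hx : x ∈ A
  · have h1 := hA x hx
    have h2 := hc.trans_le h1
    simp only [hx, if_true]
    exact ⟨by positivity, (div_le_one h2).2 h1⟩
  · simp [hx]

/-- The layer-cake bound for the positive part of a function. -/
lemma IsFlat.clamp_le [Fintype Ω] (hq : IsFlat φ q) (f : Ω → ℝ) (J : ℕ) :
    q (fun x => max 0 (min (J : ℝ) (f x))) ≤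
      ∑ j ∈ Finset.range J, φ (Finset.univ.filter fun x => (j : ℝ) < f x).card := by
  induction J with
  | zero =>
    have : (fun x => max 0 (min ((0 : ℕ) : ℝ) (f x))) = 0 := by
      funext x; simp
    rw [this, hq.zero]; simp
  | succ J ih =>
    have hs : (fun x => max 0 (min ((J + 1 : ℕ) : ℝ) (f x))) =
        (fun x => max 0 (min (J : ℝ) (f x))) + fun x => max 0 (min 1 (f x - J)) := by
      funext x
      have hJ : (0 : ℝ) ≤ J := J.cast_nonneg
      simp only [Pi.add_apply, Nat.cast_add, Nat.cast_one]
      rcases le_total (f x) J with h | h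
      · rw [min_eq_right h, min_eq_right (by linarith : f x ≤ J + 1),
          min_eq_right (by linarith : f x - J ≤ 1), max_eq_left (by linarith : f x - J ≤ 0),
          add_zero]
      · rw [min_eq_left h, max_eq_right hJ, max_eq_right (le_min (by linarith) (by linarith)),
          max_eq_right (le_min (by linarith) (by linarith)), ← min_add_add_left]
        congr 1
        ring
    rw [hs, Finset.sum_range_succ]
    refine (hq.add_le _ _).trans (add_le_add ih (hq.le_of_mem_Icc _ (fun x => ?_) fun x hx => ?_))
    · exact ⟨le_max_left _ _, max_le zero_le_one (min_le_left _ _)⟩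
    · have : f x ≤ J := by simpa using hx
      exact max_eq_left ((min_le_right _ _).trans (by linarith))

lemma IsFlat.le_sum_layers [Fintype Ω] (hq : IsFlat φ q) (f : Ω → ℝ) :
    ∃ J : ℕ, q f ≤
      ∑ j ∈ Finset.range J, φ (Finset.univ.filter fun x => (j : ℝ) < f x).card +
      ∑ j ∈ Finset.range J, φ (Finset.univ.filter fun x => (j : ℝ) < -f x).card := by
  obtain ⟨J, hJ⟩ := exists_nat_ge (∑ x, |f x|)
  have hb : ∀ x, |f x| ≤ J := fun x =>
    (Finset.single_le_sum (f := fun x => |f x|) (fun _ _ => abs_nonneg _)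
      (Finset.mem_univ x)).trans hJ
  refine ⟨J, ?_⟩
  have hs : f = (fun x => max 0 (min (J : ℝ) (f x))) +
      -fun x => max 0 (min (J : ℝ) (-f x)) := by
    funext x
    obtain ⟨h1, h2⟩ := abs_le.1 (hb x)
    simp only [Pi.add_apply, Pi.neg_apply]
    rw [min_eq_right h2, min_eq_right (by linarith)]
    rcases le_total 0 (f x) with h | h
    · rw [max_eq_right h, max_eq_left (by linarith)]; ring
    · rw [max_eq_left h, max_eq_right (by linarith)]; ring
  calc q f = q ((fun x => max 0 (min (J : ℝ) (f x))) +
      -fun x => max 0 (min (J : ℝ) (-f x))) := by rw [← hs]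
    _ ≤ _ := hq.add_le _ _
    _ ≤ _ := by
      rw [hq.neg]
      exact add_le_add (hq.clamp_le f J) (hq.clamp_le (fun x => -f x) J)

end Flat

section Rademacher

variable {ι : Type*} [Fintype ι]

/-- The sum `∑ i, ± a i` with signs given by `x`. -/
def signSum (a : ι → ℝ) (x : ι → Bool) : ℝ := ∑ i, a i * if x i then 1 else -1

lemma sum_exp_signSum [DecidableEq ι] (a : ι → ℝ) :
    ∑ x : ι → Bool, Real.exp (signSum a x) =
      Fintype.card (ι → Bool) * ∏ i, Real.cosh (a i) := by
  have h1 : ∀ x : ι → Bool, Real.exp (signSum a x) =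
      ∏ i, (fun (i : ι) (b : Bool) => Real.exp (a i * if b then 1 else -1)) i (x i) := by
    intro x
    rw [signSum, Real.exp_sum]
  have h0 := Fintype.prod_sum fun (i : ι) (b : Bool) => Real.exp (a i * if b then 1 else -1)
  simp_rw [h1]
  rw [← h0]
  have h2 : ∀ i, ∑ b : Bool, Real.exp (a i * if b then 1 else -1) = 2 * Real.cosh (a i) := by
    intro i
    rw [Real.cosh_eq]
    simp
    ring
  simp_rw [h2]
  rw [Finset.prod_mul_distrib]
  simp

lemma prod_cosh_le (a : ι → ℝ) :
    ∏ i, Real.cosh (a i) ≤ Real.exp ((∑ i, a i ^ 2) / 2) := by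
  rw [Finset.sum_div, Real.exp_sum]
  exact Finset.prod_le_prod (fun i _ => (Real.cosh_pos _).le)
    fun i _ => Real.cosh_le_exp_half_sq _

lemma le_prod_cosh (a : ι → ℝ) : 1 + (∑ i, a i ^ 2) / 2 ≤ ∏ i, Real.cosh (a i) := by
  classical
  have hc : ∀ x : ℝ, 1 + x ^ 2 / 2 ≤ Real.cosh x := by
    intro x
    have := sum_le_hasSum (Finset.range 2) (fun n _ => by rw [pow_mul]; positivity)
      (Real.hasSum_cosh x)
    simpa [Finset.sum_range_succ] using this
  have : ∀ s : Finset ι, 1 + (∑ i ∈ s, a i ^ 2) / 2 ≤ ∏ i ∈ s, Real.cosh (a i) := by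
    intro s
    induction s using Finset.induction_on with
    | empty => simp
    | insert i s hi ih =>
      rw [Finset.sum_insert hi, Finset.prod_insert hi]
      have h1 : 0 ≤ ∑ i ∈ s, a i ^ 2 := Finset.sum_nonneg fun i _ => sq_nonneg _
      have h2 := hc (a i)
      have h3 : 0 ≤ a i ^ 2 := sq_nonneg _
      calc 1 + (a i ^ 2 + ∑ i ∈ s, a i ^ 2) / 2
          ≤ (1 + a i ^ 2 / 2) * (1 + (∑ i ∈ s, a i ^ 2) / 2) := by nlinarith
        _ ≤ _ := mul_le_mul h2 ih (by positivity) (Real.cosh_pos _).le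
  exact this _

lemma signSum_smul (c : ℝ) (a : ι → ℝ) (x : ι → Bool) :
    signSum (c • a) x = c * signSum a x := by
  simp [signSum, Finset.mul_sum]

lemma card_le_card_signSum [DecidableEq ι] {a : ι → ℝ} (ha : ∑ i, a i ^ 2 = 1) :
    Fintype.card (ι → Bool) ≤
      128 * (Finset.univ.filter fun x => (1 / 5 : ℝ) ≤ signSum a x).card := by
  set A := Finset.univ.filter fun x => (1 / 5 : ℝ) ≤ signSum a x with hA
  set N : ℝ := (Fintype.card (ι → Bool) : ℝ) with hN
  have hNpos : 0 ≤ N := Nat.cast_nonneg _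
  have h1 : N * (3 / 2) ≤ ∑ x, Real.exp (signSum a x) := by
    rw [sum_exp_signSum]
    refine mul_le_mul_of_nonneg_left ?_ hNpos
    have := le_prod_cosh a
    rw [ha] at this
    linarith
  have h2 : ∑ x, Real.exp (2 * signSum a x) ≤ N * 8 := by
    have h3 : ∀ x, Real.exp (2 * signSum a x) = Real.exp (signSum ((2 : ℝ) • a) x) := fun x => by
      rw [signSum_smul]
    simp_rw [h3]
    rw [sum_exp_signSum]
    refine mul_le_mul_of_nonneg_left ((prod_cosh_le _).trans ?_) hNpos
    have h4 : (∑ i, ((2 : ℝ) • a) i ^ 2) / 2 = 1 + 1 := by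
      have : ∀ i, ((2 : ℝ) • a) i ^ 2 = 4 * a i ^ 2 := fun i => by
        simp only [Pi.smul_apply, smul_eq_mul]; ring
      simp_rw [this]
      rw [← Finset.mul_sum, ha]
      norm_num
    rw [h4, Real.exp_add]
    have h5 := Real.exp_one_lt_d9
    have h6 := Real.exp_pos 1
    nlinarith
  have h3 : ∑ x, Real.exp (signSum a x) ≤ ∑ x : ι → Bool,
      (5 / 4 + (if x ∈ A then 16 else 0) + Real.exp (2 * signSum a x) / 64) := by
    refine Finset.sum_le_sum fun x _ => ?_
    have h4 : Real.exp (2 * signSum a x) = Real.exp (signSum a x) ^ 2 := by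
      rw [← Real.exp_nat_mul]; norm_num
    rw [h4]
    split_ifs with hx
    · nlinarith [sq_nonneg (Real.exp (signSum a x) / 8 - 4)]
    · have h5 : signSum a x ≤ 1 / 5 := by
        by_contra! h
        exact hx (by simp only [hA, Finset.mem_filter, Finset.mem_univ, true_and]; exact h.le)
      have h6 := Real.exp_le_exp.2 h5
      have h7 := Real.exp_bound_div_one_sub_of_interval (x := 1 / 5) (by norm_num) (by norm_num)
      norm_num at h7
      nlinarith [sq_nonneg (Real.exp (signSum a x))]
  rw [Finset.sum_add_distrib, Finset.sum_add_distrib, Finset.sum_ite_mem, Finset.univ_inter] at h3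
  simp only [← Finset.sum_div, Finset.sum_const, nsmul_eq_mul, Finset.card_univ] at h3
  rw [← hN] at h3
  have : N ≤ 128 * (A.card : ℝ) := by linarith
  rw [hN] at this
  exact_mod_cast this

lemma pow_mul_card_signSum_le [DecidableEq ι] {a : ι → ℝ} (ha : ∑ i, a i ^ 2 = 1) {K j₁ : ℕ}
    (hK : 2 ≤ K) (hj₁ : Real.exp (Real.log K ^ 2 / 2) ≤ (K : ℝ) ^ j₁) (j : ℕ) :
    K ^ j * (Finset.univ.filter fun x => (j : ℝ) < signSum a x).card ≤
      K ^ j₁ * Fintype.card (ι → Bool) := by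
  set A := Finset.univ.filter fun x => (j : ℝ) < signSum a x with hA
  have hK0 : (0 : ℝ) < K := by positivity
  have hlog : 0 ≤ Real.log K := Real.log_natCast_nonneg K
  have h1 : (A.card : ℝ) * (K : ℝ) ^ j ≤ ∑ x, Real.exp (Real.log K * signSum a x) := by
    rw [← nsmul_eq_mul]
    refine (Finset.card_nsmul_le_sum A (fun x => Real.exp (Real.log K * signSum a x)) _
      fun x hx => ?_).trans (Finset.sum_le_univ_sum_of_nonneg fun x => (Real.exp_pos _).le)
    have h2 : (j : ℝ) < signSum a x := by simpa [hA] using hx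
    rw [← Real.exp_log hK0, ← Real.exp_nat_mul, Real.exp_log hK0, mul_comm]
    exact Real.exp_le_exp.2 (mul_le_mul_of_nonneg_left h2.le hlog)
  have h2 : ∑ x, Real.exp (Real.log K * signSum a x) ≤
      Fintype.card (ι → Bool) * (K : ℝ) ^ j₁ := by
    simp_rw [← signSum_smul]
    rw [sum_exp_signSum]
    refine mul_le_mul_of_nonneg_left ((prod_cosh_le _).trans ?_) (Nat.cast_nonneg _)
    have : ∑ i, (Real.log K • a) i ^ 2 = Real.log K ^ 2 := by
      simp only [Pi.smul_apply, smul_eq_mul, mul_pow]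
      rw [← Finset.mul_sum, ha, mul_one]
    rwa [this]
  have h3 := h1.trans h2
  rw [mul_comm, mul_comm (Fintype.card (ι → Bool) : ℝ)] at h3
  exact_mod_cast h3

/-- If `φ` grows at a definite power rate, then the sign sums span Euclidean spaces in every
flat norm. -/
lemma exists_bound_signSum {φ : ℕ → ℝ} (hmono : Monotone φ) (h0 : 0 ≤ φ 0)
    (hsub : ∀ c m, φ (c * m) ≤ c * φ m) {K : ℕ} (hK : 2 ≤ K) (hgrow : ∀ m, 2 * φ m ≤ φ (K * m)) :
    ∃ C : ℝ, 0 < C ∧ ∀ (ι : Type) [Fintype ι] [DecidableEq ι] (q : ((ι → Bool) → ℝ) → ℝ),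
      IsFlat φ q →
      ∀ a : ι → ℝ, ∑ i, a i ^ 2 = 1 →
        φ (Fintype.card (ι → Bool)) / 640 ≤ q (signSum a) ∧
          q (signSum a) ≤ C * φ (Fintype.card (ι → Bool)) := by
  classical
  have hK1 : (1 : ℝ) < K := by exact_mod_cast hK
  obtain ⟨j₁, hj₁⟩ := pow_unbounded_of_one_lt (Real.exp (Real.log K ^ 2 / 2)) hK1
  have hnn : ∀ m, 0 ≤ φ m := fun m => h0.trans (hmono m.zero_le)
  have hiter : ∀ i m, 2 ^ i * φ m ≤ φ (K ^ i * m) := by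
    intro i m
    induction i with
    | zero => simp
    | succ i ih =>
      have := hgrow (K ^ i * m)
      rw [← mul_assoc, ← pow_succ'] at this
      rw [pow_succ']
      linarith
  refine ⟨2 ^ (j₁ + 2), by positivity, fun ι _ _ q hq a ha => ⟨?_, ?_⟩⟩
  · have h1 := hq.mul_card_le (Finset.univ.filter fun x => (1 / 5 : ℝ) ≤ signSum a x)
      (f := signSum a) (c := 1 / 5) (by norm_num) (fun x hx => (Finset.mem_filter.1 hx).2)
    have h2 := (hmono (card_le_card_signSum ha)).trans (hsub _ _)
    push_cast at h2
    linarith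
  · set N := Fintype.card (ι → Bool)
    have hlayer : ∀ b : ι → ℝ, ∑ i, b i ^ 2 = 1 → ∀ j : ℕ,
        φ (Finset.univ.filter fun x => (j : ℝ) < signSum b x).card ≤
          φ N * 2 ^ j₁ * (1 / 2) ^ j := by
      intro b hb j
      set A := Finset.univ.filter fun x => (j : ℝ) < signSum b x
      suffices h : 2 ^ j * φ A.card ≤ φ N * 2 ^ j₁ by
        rw [one_div, inv_pow, ← div_eq_mul_inv, le_div_iff₀ (by positivity)]
        linarith
      rcases le_total j j₁ with h | h
      · have h1 : φ A.card ≤ φ N := hmono (Finset.card_le_univ _)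
        have h2 : (2 : ℝ) ^ j ≤ 2 ^ j₁ := pow_le_pow_right₀ one_le_two h
        have h3 := hnn A.card
        have h4 : (0 : ℝ) < 2 ^ j₁ := by positivity
        nlinarith
      · obtain ⟨i, rfl⟩ := Nat.exists_eq_add_of_le h
        have h1 := pow_mul_card_signSum_le hb hK hj₁.le (j₁ + i)
        have h2 : K ^ i * A.card ≤ N := by
          rw [pow_add, mul_assoc] at h1
          exact Nat.le_of_mul_le_mul_left h1 (by positivity)
        have h3 := (hiter i A.card).trans (hmono h2)
        rw [pow_add]
        have h4 : (0 : ℝ) < 2 ^ j₁ := by positivity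
        nlinarith
    have hsum : ∀ b : ι → ℝ, ∑ i, b i ^ 2 = 1 → ∀ J : ℕ,
        ∑ j ∈ Finset.range J, φ (Finset.univ.filter fun x => (j : ℝ) < signSum b x).card ≤
          2 * (φ N * 2 ^ j₁) := by
      intro b hb J
      refine (Finset.sum_le_sum fun j _ => hlayer b hb j).trans ?_
      rw [← Finset.mul_sum, mul_comm]
      refine mul_le_mul_of_nonneg_right ?_ (mul_nonneg (hnn _) (by positivity))
      exact sum_geometric_two_le J
    obtain ⟨J, hJ⟩ := hq.le_sum_layers (signSum a)
    have h1 := hsum a ha J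
    have h2 := hsum (-a) (by simpa using ha) J
    have h3 : ∀ x, signSum (-a) x = - signSum a x := fun x => by
      rw [← neg_one_smul ℝ, signSum_smul, neg_one_mul]
    simp_rw [h3] at h2
    rw [pow_add]
    linarith

end Rademacher

section EuclideanSubspaces

lemma IsFlat.le_two_mul {Ω : Type*} [Fintype Ω] {φ : ℕ → ℝ} {q : (Ω → ℝ) → ℝ} (hq : IsFlat φ q)
    {f : Ω → ℝ} (hf : ∀ x, |f x| ≤ 1) : q f ≤ 2 * φ (Fintype.card Ω) := by
  have h1 : ∀ g : Ω → ℝ, (∀ x, |g x| ≤ 1) →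
      q (fun x => max (g x) 0) ≤ φ (Fintype.card Ω) := fun g hg =>
    hq.le_of_mem_Icc Finset.univ
      (fun x => ⟨le_max_right _ _, max_le ((le_abs_self _).trans (hg x)) zero_le_one⟩)
      fun x hx => absurd (Finset.mem_univ x) hx
  have h2 := h1 f hf
  have h3 := h1 (-f) (fun x => by simpa using hf x)
  have hs : f = (fun x => max (f x) 0) + -fun x => max ((-f) x) 0 := by
    funext x
    simp only [Pi.add_apply, Pi.neg_apply]
    rcases le_total 0 (f x) with h | h
    · rw [max_eq_left h, max_eq_right (by linarith)]; ring
    · rw [max_eq_right h, max_eq_left (by linarith)]; ring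
  have h4 := hq.add_le (fun x => max (f x) 0) (-fun x => max ((-f) x) 0)
  rw [← hs, hq.neg] at h4
  linarith

/-- Every fundamental function admits uniformly Euclidean subspaces of all dimensions. -/
lemma exists_euclidean_of_flat {φ : ℕ → ℝ} (hmono : Monotone φ) (h0 : φ 0 = 0) (h1 : 0 < φ 1)
    (hsub : ∀ c m, φ (c * m) ≤ c * φ m) :
    ∃ C : ℝ, 0 < C ∧ ∀ (ι : Type) [Fintype ι], ∃ (Ω : Type) (_ : Fintype Ω)
      (R : EuclideanSpace ℝ ι →ₗ[ℝ] (Ω → ℝ)) (r : ℝ), 0 < r ∧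
        ∀ q, IsFlat φ q → ∀ a, ‖a‖ = 1 → r ≤ q (R a) ∧ q (R a) ≤ C * r := by
  classical
  have hpos : ∀ m, 0 < m → 0 < φ m := fun m hm => h1.trans_le (hmono hm)
  by_cases hgrow : ∃ K : ℕ, 2 ≤ K ∧ ∀ m, 2 * φ m ≤ φ (K * m)
  · obtain ⟨K, hK, hgrow⟩ := hgrow
    obtain ⟨C, hC, h⟩ := exists_bound_signSum hmono h0.ge hsub hK hgrow
    refine ⟨640 * C, by positivity, fun ι _ => ⟨ι → Bool, inferInstance,
      { toFun := fun a => signSum a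
        map_add' := fun a b => ?_
        map_smul' := fun c a => ?_ }, φ (Fintype.card (ι → Bool)) / 640, ?_, fun q hq a ha => ?_⟩⟩
    · funext x
      simp only [signSum, PiLp.add_apply, Pi.add_apply, add_mul, Finset.sum_add_distrib]
    · funext x
      exact signSum_smul c _ x
    · exact div_pos (hpos _ Fintype.card_pos) (by norm_num)
    · have := h ι q hq a (by
        have := EuclideanSpace.real_norm_sq_eq a
        rw [ha] at this
        linarith)
      refine ⟨this.1, this.2.trans_eq ?_⟩
      ring
  · push Not at hgrow
    refine ⟨8, by norm_num, fun ι _ => ?_⟩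
    obtain ⟨T, hTs, hTf, hT⟩ := (isCompact_sphere (0 : EuclideanSpace ℝ ι) 1).finite_cover_balls
      (e := 1 / 2) (by norm_num)
    have : Fintype T := hTf.fintype
    obtain ⟨m, hm⟩ := hgrow (Fintype.card T + 2) (by omega)
    have hm0 : 0 < m := by
      rcases Nat.eq_zero_or_pos m with rfl | h
      · simp [h0] at hm
      · exact h
    refine ⟨T × Fin m, inferInstance,
      { toFun := fun a x => inner ℝ (x.1 : EuclideanSpace ℝ ι) a
        map_add' := fun a b => by funext x; exact inner_add_right _ _ _
        map_smul' := fun c a => by funext x; exact inner_smul_right _ _ _ },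
      φ m / 2, by have := hpos m hm0; positivity, fun q hq a ha => ⟨?_, ?_⟩⟩
    · have ha' : a ∈ Metric.sphere (0 : EuclideanSpace ℝ ι) 1 := by simpa using ha
      obtain ⟨θ, hθ, hθa⟩ := Set.mem_iUnion₂.1 (hT ha')
      have hin : (1 / 2 : ℝ) ≤ inner ℝ θ a := by
        have hθ1 : ‖θ‖ = 1 := by simpa using hTs hθ
        rw [Metric.mem_ball, dist_eq_norm] at hθa
        have := norm_sub_sq_real a θ
        rw [ha, hθ1, real_inner_comm] at this
        nlinarith [norm_nonneg (a - θ)]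
      have := hq.mul_card_le (Finset.univ.map ⟨fun j : Fin m => ((⟨θ, hθ⟩ : T), j),
        fun i j h => (Prod.ext_iff.1 h).2⟩) (c := 1 / 2) (by norm_num)
        (f := fun x : T × Fin m => inner ℝ (x.1 : EuclideanSpace ℝ ι) a)
        (by
          intro x hx
          obtain ⟨j, -, rfl⟩ := Finset.mem_map.1 hx
          exact hin)
      rw [Finset.card_map, Finset.card_univ, Fintype.card_fin] at this
      rw [div_eq_inv_mul, ← one_div]
      exact this
    · have h2 := hq.le_two_mul (f := fun x : T × Fin m => inner ℝ (x.1 : EuclideanSpace ℝ ι) a)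
        (fun x => by
          have hθ1 : ‖(x.1 : EuclideanSpace ℝ ι)‖ = 1 := by simpa using hTs x.1.2
          refine (abs_real_inner_le_norm _ _).trans ?_
          rw [ha, hθ1, one_mul])
      have h3 : φ (Fintype.card (T × Fin m)) ≤ φ ((Fintype.card T + 2) * m) := by
        apply hmono
        rw [Fintype.card_prod, Fintype.card_fin]
        exact Nat.mul_le_mul_right _ (by omega)
      refine h2.trans ?_
      linarith

variable {J V : Type*} [NormedAddCommGroup V] [NormedSpace ℝ V] {W : Ultrafilter J} {y : J → V}

lemma isFlat_spreadNorm (hy : ∀ i, ‖y i‖ = 1)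
    (hw : ∀ f : V →L[ℝ] ℝ, Tendsto (fun i => f (y i)) W (𝓝 0)) {Ω : Type*} (e : Ω ↪ ℕ) {k : ℕ}
    (hk : ∀ x, e x < k) :
    IsFlat (fun m => spreadNorm W y m 1 0)
      fun f : Ω → ℝ => spreadNorm W y k (Function.ExtendByZero.linearMap ℝ e f) 0 where
  add_le f g := by
    have := spreadNorm_add_le (W := W) hy k (Function.ExtendByZero.linearMap ℝ e f)
      (Function.ExtendByZero.linearMap ℝ e g) 0 0
    rwa [← map_add, add_zero] at this
  smul c f := by
    have := spreadNorm_smul (W := W) hy k c (Function.ExtendByZero.linearMap ℝ e f) 0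
    rwa [← map_smul, smul_zero] at this
  mul_le t ht f := by
    have h := Function.extend_mul e t f (0 : ℕ → ℝ) 0
    rw [mul_zero] at h
    change spreadNorm W y k (Function.extend e (t * f) 0) 0 ≤ _
    rw [h]
    refine spreadNorm_mul_le hy hw k (fun j => ?_) _ _
    by_cases hj : ∃ x, e x = j
    · obtain ⟨x, rfl⟩ := hj
      rw [e.injective.extend_apply]
      exact ht x
    · rw [Function.extend_apply' _ _ _ hj]
      simp
  indicator A := by
    rw [← Finset.card_map e, ← spreadNorm_indicator hy k]
    · congr 1
      funext j
      simp only [Function.ExtendByZero.linearMap_apply]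
      by_cases hj : ∃ x, e x = j
      · obtain ⟨x, rfl⟩ := hj
        rw [e.injective.extend_apply]
        by_cases hx : x ∈ A
        · rw [Set.indicator_of_mem (Finset.mem_coe.2 hx),
            Set.indicator_of_mem (Finset.mem_coe.2 ((Finset.mem_map' e).2 hx))]
          rfl
        · rw [Set.indicator_of_notMem (mt Finset.mem_coe.1 hx),
            Set.indicator_of_notMem fun h => hx ((Finset.mem_map' e).1 (Finset.mem_coe.1 h))]
      · rw [Function.extend_apply' _ _ _ hj, Set.indicator_of_notMem]
        · rfl
        · simp only [Finset.coe_map]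
          rintro ⟨x, -, hx⟩
          exact hj ⟨x, hx⟩
    · intro j hj
      obtain ⟨x, -, rfl⟩ := Finset.mem_map.1 hj
      exact Finset.mem_range.2 (hk x)

/-- The spreading model contains uniformly Euclidean subspaces of all dimensions. -/
lemma exists_euclidean_spreadNorm (hy : ∀ i, ‖y i‖ = 1)
    (hw : ∀ f : V →L[ℝ] ℝ, Tendsto (fun i => f (y i)) W (𝓝 0)) :
    ∃ C : ℝ, 0 < C ∧ ∀ (ι : Type) [Fintype ι], ∃ (k : ℕ)
      (S : EuclideanSpace ℝ ι →ₗ[ℝ] (ℕ → ℝ)), ∀ a,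
        ‖a‖ ≤ spreadNorm W y k (S a) 0 ∧ spreadNorm W y k (S a) 0 ≤ C * ‖a‖ := by
  set φ : ℕ → ℝ := fun m => spreadNorm W y m 1 0 with hφ
  have h0 : φ 0 = 0 := by simp [hφ, spreadNorm]
  have h1 : φ 1 = 1 := by
    have : Tendsto (fun _ : J => (1 : ℝ)) W (𝓝 (φ 1)) :=
      (tendsto_spreadNorm_succ (W := W) hy 0 1 0).congr fun i => by simp [spreadNorm, hy]
    exact tendsto_nhds_unique this tendsto_const_nhds
  have hmono : Monotone φ := monotone_nat_of_le_succ fun m => spreadNorm_le_succ hy hw m 1 0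
  have hadd : ∀ m n, φ (m + n) ≤ φ m + φ n := by
    intro m n
    have hd : Disjoint (Finset.range m) ((Finset.range n).map (addLeftEmbedding m)) :=
      Finset.disjoint_range_addLeftEmbedding _ _
    have h2 := spreadNorm_add_le (W := W) hy (m + n)
      ((Finset.range m : Set ℕ).indicator 1)
      (((Finset.range n).map (addLeftEmbedding m) : Set ℕ).indicator 1) 0 0
    have hu := Set.indicator_union_of_disjoint (Finset.disjoint_coe.2 hd) (1 : ℕ → ℝ)
    rw [← Finset.coe_union] at hu
    change _ = (_ : ℕ → ℝ) + _ at hu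
    rw [add_zero, ← hu,
      spreadNorm_indicator hy, spreadNorm_indicator hy, spreadNorm_indicator hy,
      Finset.card_union_of_disjoint hd, Finset.card_map, Finset.card_range,
      Finset.card_range] at h2
    · exact h2
    · intro j hj
      simp only [Finset.mem_map, Finset.mem_range, addLeftEmbedding_apply] at hj ⊢
      obtain ⟨a, ha, rfl⟩ := hj
      omega
    · intro j hj
      simp only [Finset.mem_range] at hj ⊢
      omega
    · intro j hj
      simp only [Finset.mem_union, Finset.mem_map, Finset.mem_range, addLeftEmbedding_apply] at hj ⊢
      rcases hj with hj | ⟨a, ha, rfl⟩ <;> omega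
  have hsub : ∀ c m, φ (c * m) ≤ c * φ m := by
    intro c m
    induction c with
    | zero => simp [h0]
    | succ c ih =>
      have := hadd (c * m) m
      rw [add_mul, one_mul]
      push_cast
      linarith
  obtain ⟨C, hC, h⟩ := exists_euclidean_of_flat hmono h0 (h1 ▸ one_pos) hsub
  refine ⟨C, hC, fun ι _ => ?_⟩
  obtain ⟨Ω, _, R, r, hr, hR⟩ := h ι
  let e : Ω ↪ ℕ := (Fintype.equivFin Ω).toEmbedding.trans Fin.valEmbedding
  have hq := isFlat_spreadNorm hy hw e (k := Fintype.card Ω) fun x => (Fintype.equivFin Ω x).2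
  have hR' := hR _ hq
  refine ⟨Fintype.card Ω, r⁻¹ • (Function.ExtendByZero.linearMap ℝ e ∘ₗ R), fun a => ?_⟩
  rcases eq_or_ne a 0 with rfl | ha
  · simp [spreadNorm_zero_left hy]
  have hn : 0 < ‖a‖ := norm_pos_iff.2 ha
  have h2 := hR' (‖a‖⁻¹ • a) (by rw [norm_smul, norm_inv, norm_norm, inv_mul_cancel₀ hn.ne'])
  have h3 : spreadNorm W y (Fintype.card Ω)
      ((r⁻¹ • (Function.ExtendByZero.linearMap ℝ e ∘ₗ R)) a) 0 =
      (r⁻¹ * ‖a‖) * spreadNorm W y (Fintype.card Ω)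
        (Function.ExtendByZero.linearMap ℝ e (R (‖a‖⁻¹ • a))) 0 := by
    have := spreadNorm_smul (W := W) hy (Fintype.card Ω) (r⁻¹ * ‖a‖)
      (Function.ExtendByZero.linearMap ℝ e (R (‖a‖⁻¹ • a))) 0
    rw [abs_of_pos (by positivity), smul_zero] at this
    rw [← this, map_smul, map_smul, smul_smul, mul_assoc, mul_inv_cancel₀ hn.ne', mul_one]
    rfl
  rw [h3]
  have h4 : r⁻¹ * ‖a‖ * r = ‖a‖ := by field_simp
  have h5 : 0 ≤ r⁻¹ * ‖a‖ := by positivity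
  constructor
  · calc ‖a‖ = r⁻¹ * ‖a‖ * r := h4.symm
      _ ≤ _ := mul_le_mul_of_nonneg_left h2.1 h5
  · calc _ ≤ r⁻¹ * ‖a‖ * (C * r) := mul_le_mul_of_nonneg_left h2.2 h5
      _ = C * (r⁻¹ * ‖a‖ * r) := by ring
      _ = _ := by rw [h4]

end EuclideanSubspaces

section Bootstrap

variable {V : Type*} [NormedAddCommGroup V] [NormedSpace ℝ V]

/-- A normalised family in an infinite-dimensional space tending weakly to zero along an
ultrafilter. -/
lemma exists_weakly_null (hV : ¬ FiniteDimensional ℝ V) :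
    ∃ (W : Ultrafilter (Finset (V →L[ℝ] ℝ))) (y : Finset (V →L[ℝ] ℝ) → V), (∀ i, ‖y i‖ = 1) ∧
      ∀ f : V →L[ℝ] ℝ, Tendsto (fun i => f (y i)) W (𝓝 0) := by
  classical
  have hex : ∀ S : Finset (V →L[ℝ] ℝ), ∃ x : V, ‖x‖ = 1 ∧ ∀ f ∈ S, f x = 0 := by
    intro S
    let Φ : V →ₗ[ℝ] (S → ℝ) := LinearMap.pi fun f => (f.1 : V →ₗ[ℝ] ℝ)
    have hΦ : ¬ Function.Injective Φ := fun h => hV (FiniteDimensional.of_injective Φ h)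
    rw [← LinearMap.ker_eq_bot, Submodule.eq_bot_iff] at hΦ
    push Not at hΦ
    obtain ⟨x, hx, hx0⟩ := hΦ
    refine ⟨‖x‖⁻¹ • x, ?_, fun f hf => ?_⟩
    · rw [norm_smul, norm_inv, norm_norm, inv_mul_cancel₀ (norm_ne_zero_iff.2 hx0)]
    · have : f x = 0 := congrFun (LinearMap.mem_ker.1 hx) ⟨f, hf⟩
      rw [map_smul, this, smul_zero]
  choose y hy1 hy0 using hex
  refine ⟨Ultrafilter.of atTop, y, hy1, fun f => ?_⟩
  refine (tendsto_const_nhds.congr' ?_).mono_left (Ultrafilter.of_le atTop)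
  filter_upwards [eventually_ge_atTop {f}] with S hS
  exact (hy0 S f (hS (Finset.mem_singleton_self f))).symm

/-- There is a linear projection onto `E` of norm at most `c`. -/
def HasProj (E : Submodule ℝ V) (c : ℝ) : Prop :=
  ∃ P : V →ₗ[ℝ] V, (∀ x, P x ∈ E) ∧ (∀ x ∈ E, P x = x) ∧ ∀ x, ‖P x‖ ≤ c * ‖x‖

/-- The subspace `E` has distance at most `d` from a Euclidean space. -/
def IsNearEuclidean (E : Submodule ℝ V) (d : ℝ) : Prop :=
  ∃ (ι : Type) (_ : Fintype ι) (L : E →ₗ[ℝ] EuclideanSpace ℝ ι),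
    ∀ e, ‖e‖ ≤ ‖L e‖ ∧ ‖L e‖ ≤ d * ‖e‖

lemma IsNearEuclidean.mono {E : Submodule ℝ V} {c d : ℝ} (h : IsNearEuclidean E c) (hcd : c ≤ d) :
    IsNearEuclidean E d := by
  obtain ⟨ι, _, L, hL⟩ := h
  exact ⟨ι, inferInstance, L, fun e => ⟨(hL e).1, (hL e).2.trans (by gcongr)⟩⟩

lemma exists_isNearEuclidean (E : Submodule ℝ V) [FiniteDimensional ℝ E] :
    ∃ d, 0 < d ∧ IsNearEuclidean E d := by
  let T : E ≃L[ℝ] EuclideanSpace ℝ (Fin (Module.finrank ℝ E)) := toEuclidean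
  set a := ‖(T.symm : EuclideanSpace ℝ (Fin (Module.finrank ℝ E)) →L[ℝ] E)‖ + 1
  set b := ‖(T : E →L[ℝ] EuclideanSpace ℝ (Fin (Module.finrank ℝ E)))‖ + 1
  have ha : 0 < a := by positivity
  have hb : 0 < b := by positivity
  refine ⟨a * b, by positivity, _, inferInstance, a • T.toLinearEquiv.toLinearMap, fun e => ?_⟩
  have h1 : ‖(a • T.toLinearEquiv.toLinearMap) e‖ = a * ‖T e‖ := by
    rw [LinearMap.smul_apply, norm_smul, Real.norm_of_nonneg ha.le]
    rfl
  rw [h1]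
  constructor
  · have := (T.symm : EuclideanSpace ℝ (Fin (Module.finrank ℝ E)) →L[ℝ] E).le_opNorm (T e)
    simp only [ContinuousLinearEquiv.coe_coe, ContinuousLinearEquiv.symm_apply_apply] at this
    refine this.trans ?_
    gcongr
    simp [a]
  · have := (T : E →L[ℝ] EuclideanSpace ℝ (Fin (Module.finrank ℝ E))).le_opNorm e
    rw [mul_assoc]
    refine mul_le_mul_of_nonneg_left (this.trans ?_) ha.le
    gcongr
    simp [b]

variable {J : Type*} {W : Ultrafilter J} {y : J → V}

/-- A finite-dimensional part of the spreading norm is realised in the space itself. -/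
lemma exists_realisation (hy : ∀ i, ‖y i‖ = 1)
    (hw : ∀ f : V →L[ℝ] ℝ, Tendsto (fun i => f (y i)) W (𝓝 0)) {F : Type*} [NormedAddCommGroup F]
    [NormedSpace ℝ F] [FiniteDimensional ℝ F] {k : ℕ} {S : F →ₗ[ℝ] (ℕ → ℝ)}
    (hS : ∀ a, ‖a‖ ≤ spreadNorm W y k (S a) 0) (E : Submodule ℝ V) [FiniteDimensional ℝ E] :
    ∃ B : F →ₗ[ℝ] V, ∀ (e : E) (a : F), spreadNorm W y k (S a) e / 2 ≤ ‖(e : V) + B a‖ ∧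
      ‖(e : V) + B a‖ ≤ 2 * spreadNorm W y k (S a) e := by
  set Q : E × F → ℝ := fun p => spreadNorm W y k (S p.2) p.1 with hQ
  have hQadd : ∀ p q, Q (p + q) ≤ Q p + Q q := fun p q => by
    have := spreadNorm_add_le (W := W) hy k (S p.2) (S q.2) (p.1 : V) q.1
    rwa [← map_add] at this
  have hQsmul : ∀ (c : ℝ) p, Q (c • p) = |c| * Q p := fun c p => by
    have := spreadNorm_smul (W := W) hy k c (S p.2) (p.1 : V)
    rwa [← map_smul] at this
  have hQlow : ∀ p, ‖p‖ ≤ 2 * Q p := by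
    rintro ⟨e, a⟩
    have h1 : ‖(e : V)‖ ≤ Q (e, a) := norm_le_spreadNorm hy hw k (S a) e
    have h2 := hS a
    have h3 := spreadNorm_add_le (W := W) hy k (S a) 0 (e : V) (-e)
    rw [spreadNorm_zero_left hy, norm_neg, add_zero, add_neg_cancel] at h3
    have h4 : spreadNorm W y k (S a) e = Q (e, a) := rfl
    have h5 : ‖e‖ = ‖(e : V)‖ := rfl
    have h6 := norm_nonneg (e : V)
    rw [Prod.norm_def]
    apply max_le
    · simp only
      linarith
    · simp only
      linarith
  let S' : ℕ → (F →L[ℝ] ℝ) := fun j => LinearMap.toContinuousLinearMap (LinearMap.proj j ∘ₗ S)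
  set C : ℝ := 1 + ∑ j ∈ Finset.range k, ‖S' j‖ with hC
  have hC0 : 0 < C := by positivity
  have hM : ∀ p : E × F, ‖p.1‖ + ∑ j ∈ Finset.range k, |S p.2 j| ≤ C * ‖p‖ := by
    intro p
    rw [hC, add_mul, one_mul, Finset.sum_mul]
    gcongr with j hj
    · exact norm_fst_le p
    · exact ((S' j).le_opNorm p.2).trans (by gcongr; exact norm_snd_le p)
  have hQup : ∀ p, Q p ≤ C * ‖p‖ := fun p => (spreadNorm_mem hy k _ _).2.trans (hM p)
  obtain ⟨T, hTs, hTf, hT⟩ := (isCompact_sphere (0 : E × F) 1).finite_cover_balls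
    (e := 1 / (16 * C)) (by positivity)
  obtain ⟨s, hs⟩ := exists_approx_spreadNorm (W := W) hy k
    ((fun p : E × F => (S p.2, (p.1 : V))) '' T) (hTf.image _) (ε := 1 / 16) (by norm_num)
  let B : F →ₗ[ℝ] V := ∑ j ∈ Finset.range k, (LinearMap.proj j ∘ₗ S).smulRight (y (s j))
  have hB : ∀ a, B a = ∑ j ∈ Finset.range k, S a j • y (s j) := fun a => by
    simp [B]
  let T' : E × F →ₗ[ℝ] V := E.subtype.coprod B
  have hT' : ∀ p : E × F, T' p = p.1 + B p.2 := fun p => rfl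
  have hT'up : ∀ p : E × F, ‖T' p‖ ≤ C * ‖p‖ := by
    intro p
    refine le_trans ?_ (hM p)
    rw [hT', hB]
    refine (norm_add_le _ _).trans (add_le_add le_rfl ((norm_sum_le _ _).trans ?_))
    refine Finset.sum_le_sum fun j _ => ?_
    rw [norm_smul, hy, mul_one, Real.norm_eq_abs]
  have key : ∀ p : E × F, ‖p‖ = 1 → |‖T' p‖ - Q p| ≤ Q p / 2 := by
    intro p hp
    obtain ⟨q, hq, hpq⟩ := Set.mem_iUnion₂.1
      (hT (show p ∈ Metric.sphere (0 : E × F) 1 by simpa using hp))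
    rw [Metric.mem_ball, dist_eq_norm, lt_div_iff₀ (by positivity)] at hpq
    have h1 := hs _ (Set.mem_image_of_mem _ hq)
    simp only [← hB] at h1
    change |‖T' q‖ - Q q| < 1 / 16 at h1
    have h2 : |‖T' p‖ - ‖T' q‖| ≤ 1 / 16 := by
      refine (abs_norm_sub_norm_le _ _).trans ?_
      rw [← map_sub]
      refine (hT'up _).trans ?_
      linarith
    have h3 : Q (p - q) ≤ 1 / 16 := (hQup _).trans (by linarith)
    have h4 : Q (q - p) ≤ 1 / 16 := (hQup _).trans (by rw [norm_sub_rev]; linarith)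
    have h5 := hQadd (p - q) q
    have h6 := hQadd (q - p) p
    rw [sub_add_cancel] at h5 h6
    have h7 := hQlow p
    rw [hp] at h7
    rw [abs_lt] at h1
    rw [abs_le] at h2 ⊢
    constructor <;> linarith [h1.1, h1.2, h2.1, h2.2]
  have key' : ∀ p : E × F, |‖T' p‖ - Q p| ≤ Q p / 2 := by
    intro p
    rcases eq_or_ne p 0 with rfl | hp
    · have : Q 0 = 0 := by
        have := hQsmul 0 0
        simpa using this
      simp [this]
    · have hn : 0 < ‖p‖ := norm_pos_iff.2 hp
      have h1 := key (‖p‖⁻¹ • p) (by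
        rw [norm_smul, norm_inv, norm_norm, inv_mul_cancel₀ hn.ne'])
      rw [hQsmul, map_smul, norm_smul, Real.norm_eq_abs, abs_of_pos (inv_pos.2 hn), ← mul_sub,
        abs_mul, abs_of_pos (inv_pos.2 hn), mul_div_assoc] at h1
      exact le_of_mul_le_mul_left h1 (inv_pos.2 hn)
  refine ⟨B, fun e a => ?_⟩
  have h1 := abs_le.1 (key' (e, a))
  have h2 : 0 ≤ Q (e, a) := spreadNorm_nonneg hy k _ _
  change Q (e, a) / 2 ≤ ‖T' (e, a)‖ ∧ ‖T' (e, a)‖ ≤ 2 * Q (e, a)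
  constructor <;> linarith [h1.1, h1.2]

/-- The self-improving estimate for the distance to a Euclidean space. -/
lemma IsNearEuclidean.improve (hy : ∀ i, ‖y i‖ = 1)
    (hw : ∀ f : V →L[ℝ] ℝ, Tendsto (fun i => f (y i)) W (𝓝 0)) {C c : ℝ} (hC : 0 < C)
    (hS : ∀ (ι : Type) [Fintype ι], ∃ (k : ℕ) (S : EuclideanSpace ℝ ι →ₗ[ℝ] (ℕ → ℝ)), ∀ a,
      ‖a‖ ≤ spreadNorm W y k (S a) 0 ∧ spreadNorm W y k (S a) 0 ≤ C * ‖a‖)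
    (hc : 0 < c) (hproj : ∀ E : Submodule ℝ V, FiniteDimensional ℝ E → HasProj E c)
    (E : Submodule ℝ V) [FiniteDimensional ℝ E] {d : ℝ} (hd : 0 < d) (h : IsNearEuclidean E d) :
    IsNearEuclidean E (8 * c * (1 + C) * √d) := by
  obtain ⟨ι, _, L, hL⟩ := h
  obtain ⟨k, S, hkS⟩ := hS ι
  obtain ⟨B, hB⟩ := exists_realisation hy hw (fun a => (hkS a).1) E
  set t : ℝ := (√d)⁻¹ with ht
  have hsd : 0 < √d := Real.sqrt_pos.2 hd
  have ht0 : 0 < t := inv_pos.2 hsd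
  have htd : t * d = √d := by
    rw [ht, inv_mul_eq_div, Real.div_sqrt]
  let g : E →ₗ[ℝ] V := E.subtype + B ∘ₗ (t • L)
  have hg : ∀ e, g e = e + B (t • L e) := fun e => rfl
  have hg1 : ∀ e, ‖e‖ ≤ 2 * ‖g e‖ := fun e => by
    have h1 := (hB e (t • L e)).1
    have h2 := norm_le_spreadNorm hy hw k (S (t • L e)) (e : V)
    have h3 : ‖e‖ = ‖(e : V)‖ := rfl
    rw [hg]
    linarith
  have hg2 : ∀ e, t * ‖L e‖ ≤ 4 * ‖g e‖ := fun e => by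
    have h1 := (hB e (t • L e)).1
    have h2 := norm_le_spreadNorm hy hw k (S (t • L e)) (e : V)
    have h3 := spreadNorm_add_le (W := W) hy k (S (t • L e)) 0 (e : V) (-e)
    rw [spreadNorm_zero_left hy, norm_neg, add_zero, add_neg_cancel] at h3
    have h4 := (hkS (t • L e)).1
    rw [norm_smul, Real.norm_of_nonneg ht0.le] at h4
    rw [hg]
    linarith
  have hinj : Function.Injective g := by
    rw [← LinearMap.ker_eq_bot, Submodule.eq_bot_iff]
    intro e he
    have := hg1 e
    rw [LinearMap.mem_ker.1 he, norm_zero, mul_zero] at this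
    exact norm_le_zero_iff.1 this
  obtain ⟨P, hP1, hP2, hP3⟩ := hproj (LinearMap.range g) inferInstance
  let ρ : V →ₗ[ℝ] E := (LinearEquiv.ofInjective g hinj).symm.toLinearMap ∘ₗ P.codRestrict _ hP1
  have hgρ : ∀ x, g (ρ x) = P x := fun x => by
    have := (LinearEquiv.ofInjective g hinj).apply_symm_apply (P.codRestrict _ hP1 x)
    exact congrArg Subtype.val this
  have hρg : ∀ e, ρ (g e) = e := fun e => hinj (by rw [hgρ, hP2 _ ⟨e, rfl⟩])
  have hρ1 : ∀ x, ‖ρ x‖ ≤ 2 * c * ‖x‖ := fun x => by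
    have h1 := hg1 (ρ x)
    have h2 := hP3 x
    rw [hgρ] at h1
    linarith
  have hρ2 : ∀ x, t * ‖L (ρ x)‖ ≤ 4 * c * ‖x‖ := fun x => by
    have h1 := hg2 (ρ x)
    have h2 := hP3 x
    rw [hgρ] at h1
    linarith
  let L₁ : E →ₗ[ℝ] EuclideanSpace ℝ ι := (2 : ℝ) • (L ∘ₗ ρ ∘ₗ E.subtype)
  let L₂ : E →ₗ[ℝ] EuclideanSpace ℝ ι := (8 * c * C * t) • L
  let L' : E →ₗ[ℝ] EuclideanSpace ℝ (ι ⊕ ι) :=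
    (WithLp.linearEquiv 2 ℝ (ι ⊕ ι → ℝ)).symm.toLinearMap ∘ₗ
      LinearMap.pi (Sum.elim (fun i => LinearMap.proj i ∘ₗ
        (WithLp.linearEquiv 2 ℝ (ι → ℝ)).toLinearMap ∘ₗ L₁) (fun i => LinearMap.proj i ∘ₗ
        (WithLp.linearEquiv 2 ℝ (ι → ℝ)).toLinearMap ∘ₗ L₂))
  have hL' : ∀ e, ‖L' e‖ ^ 2 = ‖L₁ e‖ ^ 2 + ‖L₂ e‖ ^ 2 := fun e => by
    rw [EuclideanSpace.real_norm_sq_eq, EuclideanSpace.real_norm_sq_eq,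
      EuclideanSpace.real_norm_sq_eq, Fintype.sum_sum_type]
    rfl
  have hL₁ : ∀ e, ‖L₁ e‖ = 2 * ‖L (ρ e)‖ := fun e => by
    simp [L₁, norm_smul]
  have hL₂ : ∀ e, ‖L₂ e‖ = 8 * c * C * (t * ‖L e‖) := fun e => by
    simp only [L₂, LinearMap.smul_apply, norm_smul]
    rw [Real.norm_of_nonneg (by positivity)]
    ring
  refine ⟨ι ⊕ ι, inferInstance, L', fun e => ⟨?_, ?_⟩⟩
  · have h1 : ‖e‖ ≤ ‖ρ e‖ + ‖ρ (B (t • L e))‖ := by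
      conv_lhs => rw [← hρg e, hg, map_add]
      exact norm_add_le _ _
    have h2 : ‖ρ e‖ ≤ ‖L₁ e‖ / 2 := by
      rw [hL₁]
      have := (hL (ρ e)).1
      linarith
    have h3 : ‖ρ (B (t • L e))‖ ≤ ‖L₂ e‖ / 2 := by
      have h4 := hρ1 (B (t • L e))
      have h5 := (hB 0 (t • L e)).2
      rw [ZeroMemClass.coe_zero, zero_add] at h5
      have h6 := (hkS (t • L e)).2
      rw [norm_smul, Real.norm_of_nonneg ht0.le] at h6
      rw [hL₂]
      have h7 : 2 * c * ‖B (t • L e)‖ ≤ 2 * c * (2 * (C * (t * ‖L e‖))) := by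
        gcongr
        linarith
      linarith
    have h4 : ‖L₁ e‖ ≤ ‖L' e‖ :=
      abs_le_of_sq_le_sq' (by rw [hL']; nlinarith [norm_nonneg (L₂ e)]) (norm_nonneg _) |>.2
    have h5 : ‖L₂ e‖ ≤ ‖L' e‖ :=
      abs_le_of_sq_le_sq' (by rw [hL']; nlinarith [norm_nonneg (L₁ e)]) (norm_nonneg _) |>.2
    linarith
  · have h1 : ‖L' e‖ ≤ ‖L₁ e‖ + ‖L₂ e‖ :=
      abs_le_of_sq_le_sq' (by rw [hL']; nlinarith [norm_nonneg (L₁ e), norm_nonneg (L₂ e)])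
        (by positivity) |>.2
    have h2 : ‖L₁ e‖ ≤ 8 * c * √d * ‖e‖ := by
      have := mul_le_mul_of_nonneg_left (hρ2 e) hsd.le
      rw [ht, mul_inv_cancel_left₀ hsd.ne'] at this
      have h3 : ‖(e : V)‖ = ‖e‖ := rfl
      rw [hL₁]
      rw [h3] at this
      linarith
    have h3 : ‖L₂ e‖ ≤ 8 * c * C * √d * ‖e‖ := by
      rw [hL₂, mul_assoc (8 * c * C), ← htd, mul_assoc t]
      gcongr
      exact (hL e).2
    linarith

/-- In a space whose finite-dimensional subspaces are uniformly complemented, the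
finite-dimensional subspaces are uniformly Euclidean. -/
theorem exists_uniform_isNearEuclidean {c : ℝ}
    (hproj : ∀ E : Submodule ℝ V, FiniteDimensional ℝ E → HasProj E c) :
    ∃ D : ℝ, 0 < D ∧ ∀ E : Submodule ℝ V, FiniteDimensional ℝ E → IsNearEuclidean E D := by
  by_cases hV : FiniteDimensional ℝ V
  · obtain ⟨d, hd, ι, _, L, hL⟩ := exists_isNearEuclidean (⊤ : Submodule ℝ V)
    refine ⟨d, hd, fun E _ => ⟨ι, inferInstance,
      L ∘ₗ Submodule.topEquiv.symm.toLinearMap ∘ₗ E.subtype, fun e => hL ⟨e, trivial⟩⟩⟩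
  obtain ⟨W, y, hy, hw⟩ := exists_weakly_null hV
  obtain ⟨C, hC, hS⟩ := exists_euclidean_spreadNorm hy hw
  have hc' : 0 < max c 1 := by positivity
  have hproj' : ∀ E : Submodule ℝ V, FiniteDimensional ℝ E → HasProj E (max c 1) := by
    intro E hE
    obtain ⟨P, h1, h2, h3⟩ := hproj E hE
    exact ⟨P, h1, h2, fun x => (h3 x).trans (by gcongr; exact le_max_left _ _)⟩
  set b := 8 * max c 1 * (1 + C)
  have hb : 0 < b := by positivity
  refine ⟨b ^ 2 + 1, by positivity, fun E _ => ?_⟩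
  have hne : {d | 0 < d ∧ IsNearEuclidean E d}.Nonempty := exists_isNearEuclidean E
  have hbdd : BddBelow {d | 0 < d ∧ IsNearEuclidean E d} := ⟨0, fun d hd => hd.1.le⟩
  set s := sInf {d | 0 < d ∧ IsNearEuclidean E d}
  have hs : s ≤ b ^ 2 := by
    by_contra! h
    have hs0 : 0 < s := (by positivity : 0 < b ^ 2).trans h
    have h1 : s < s ^ 2 / b ^ 2 := by
      rw [lt_div_iff₀ (by positivity)]
      nlinarith
    obtain ⟨d, ⟨hd, hE⟩, hds⟩ := exists_lt_of_csInf_lt hne h1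
    have h2 : s ≤ b * √d := csInf_le hbdd ⟨by positivity,
      hE.improve hy hw hC hS hc' hproj' E hd⟩
    rw [lt_div_iff₀ (by positivity)] at hds
    have h3 := Real.sq_sqrt hd.le
    have h4 : s ^ 2 ≤ (b * √d) ^ 2 := by gcongr
    rw [mul_pow, h3] at h4
    linarith
  obtain ⟨d, ⟨-, hE⟩, hds⟩ := exists_lt_of_csInf_lt hne (hs.trans_lt (lt_add_one _))
  exact hE.mono hds.le

end Bootstrap

section InnerProductOfFiniteDimensional

variable {V : Type*} [NormedAddCommGroup V] [NormedSpace ℝ V]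

/-- A space whose finite-dimensional subspaces are uniformly Euclidean is Hilbertian. -/
theorem isomorphicToHilbert_of_isNearEuclidean {D : ℝ} (hD : 0 < D)
    (h : ∀ E : Submodule ℝ V, FiniteDimensional ℝ E → IsNearEuclidean E D) :
    IsomorphicToHilbert V := by
  classical
  have hex : ∀ S : Finset V, ∃ b : V →ₗ[ℝ] V →ₗ[ℝ] ℝ, (∀ x y, b x y = b y x) ∧
      ∀ x ∈ S, ‖x‖ ^ 2 ≤ b x x ∧ b x x ≤ D ^ 2 * ‖x‖ ^ 2 ∧
        ∀ y ∈ S, |b x y| ≤ (D * ‖x‖) * (D * ‖y‖) := by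
    intro S
    obtain ⟨ι, _, L, hL⟩ := h (Submodule.span ℝ S) inferInstance
    obtain ⟨L', hL'⟩ := L.exists_extend
    have hL'' : ∀ x ∈ S, ‖x‖ ≤ ‖L' x‖ ∧ ‖L' x‖ ≤ D * ‖x‖ := fun x hx => by
      have h1 := hL ⟨x, Submodule.subset_span hx⟩
      rw [← hL'] at h1
      exact h1
    refine ⟨(innerₗ (EuclideanSpace ℝ ι)).compl₁₂ L' L', fun x y => real_inner_comm (L' y) (L' x),
      fun x hx => ⟨?_, ?_, fun y hy => ?_⟩⟩
    · simp only [LinearMap.compl₁₂_apply, innerₗ_apply_apply, real_inner_self_eq_norm_sq]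
      have := (hL'' x hx).1
      gcongr
    · simp only [LinearMap.compl₁₂_apply, innerₗ_apply_apply, real_inner_self_eq_norm_sq]
      rw [← mul_pow]
      have := (hL'' x hx).2
      gcongr
    · refine (abs_real_inner_le_norm (L' x) (L' y)).trans ?_
      have h1 := (hL'' x hx).2
      have h2 := (hL'' y hy).2
      gcongr
  choose b hsymm hb using hex
  let W : Ultrafilter (Finset V) := Ultrafilter.of atTop
  have hmem : ∀ x : V, ∀ᶠ S in (W : Filter (Finset V)), x ∈ S := fun x =>
    Ultrafilter.of_le atTop ((eventually_ge_atTop {x}).mono fun S hS =>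
      hS (Finset.mem_singleton_self x))
  let f : V → V → ℝ := fun x y => ulim W fun S => b S x y
  have hf : ∀ x y, Tendsto (fun S => b S x y) W (𝓝 (f x y)) := fun x y => by
    refine tendsto_ulim_of_eventually (c := (D * ‖x‖) * (D * ‖y‖)) ?_
    filter_upwards [hmem x, hmem y] with S hx hy
    exact (hb S x hx).2.2 y hy
  have hlow : ∀ x, ‖x‖ ^ 2 ≤ f x x := fun x => ge_of_tendsto (hf x x)
    ((hmem x).mono fun S hS => (hb S x hS).1)
  have hup : ∀ x, f x x ≤ D ^ 2 * ‖x‖ ^ 2 := fun x => le_of_tendsto (hf x x)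
    ((hmem x).mono fun S hS => (hb S x hS).2.1)
  refine ⟨f, ⟨fun x y => ?_, fun a x y => ?_, fun x y z => ?_, fun x hx => ?_⟩, 1, D ^ 2, one_pos,
    by positivity, fun x => ⟨by simpa using hlow x, hup x⟩⟩
  · exact tendsto_nhds_unique (hf x y) ((hf y x).congr fun S => hsymm S y x)
  · exact tendsto_nhds_unique (hf (a • x) y) (((hf x y).const_mul a).congr fun S => by simp)
  · exact tendsto_nhds_unique (hf (x + y) z) (((hf x z).add (hf y z)).congr fun S => by simp)
  · exact (by positivity : 0 < ‖x‖ ^ 2).trans_le (hlow x)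

end InnerProductOfFiniteDimensional

section InvariantMean

variable {A E : Type*} [AddCommGroup A] [NormedAddCommGroup E] [NormedSpace ℝ E]

/-- The iterated average of `h` over the first `n` multiples of each member of a list. -/
noncomputable def listAverage (n : ℕ) : List A → (A → E) → E
  | [], h => h 0
  | s :: l, h => (n : ℝ)⁻¹ • ∑ k ∈ Finset.range n, listAverage n l fun x => h (x + k • s)

lemma listAverage_add (n : ℕ) (l : List A) (f g : A → E) :
    listAverage n l (fun x => f x + g x) = listAverage n l f + listAverage n l g := by
  induction l generalizing f g with
  | nil => rfl
  | cons s l ih => simp only [listAverage, ih, Finset.sum_add_distrib, smul_add]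

lemma listAverage_const {n : ℕ} (hn : n ≠ 0) (l : List A) (c : E) :
    listAverage n l (fun _ => c) = c := by
  induction l with
  | nil => rfl
  | cons s l ih =>
    simp only [listAverage, ih, Finset.sum_const, Finset.card_range]
    rw [← Nat.cast_smul_eq_nsmul ℝ, smul_smul, inv_mul_cancel₀ (Nat.cast_ne_zero.2 hn), one_smul]

lemma norm_inv_smul_sum_le (n : ℕ) {v : ℕ → E} {c : ℝ} (hc : 0 ≤ c) (hv : ∀ k, ‖v k‖ ≤ c) :
    ‖(n : ℝ)⁻¹ • ∑ k ∈ Finset.range n, v k‖ ≤ c := by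
  rcases Nat.eq_zero_or_pos n with rfl | hn
  · simpa using hc
  have hn' : (0 : ℝ) < n := Nat.cast_pos.2 hn
  rw [norm_smul, norm_inv, Real.norm_of_nonneg hn'.le, inv_mul_le_iff₀ hn']
  refine (norm_sum_le _ _).trans ((Finset.sum_le_card_nsmul _ _ c fun k _ => hv k).trans_eq ?_)
  simp

lemma norm_listAverage_le (n : ℕ) (l : List A) {h : A → E} {c : ℝ} (hh : ∀ x, ‖h x‖ ≤ c) :
    ‖listAverage n l h‖ ≤ c := by
  induction l generalizing h with
  | nil => exact hh 0
  | cons s l ih =>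
    exact norm_inv_smul_sum_le n ((norm_nonneg _).trans (hh 0)) fun k => ih fun x => hh _

lemma norm_listAverage_shift_le (n : ℕ) {l : List A} {s : A} (hs : s ∈ l) {h : A → E} {c : ℝ}
    (hh : ∀ x, ‖h x‖ ≤ c) :
    ‖listAverage n l (fun x => h (x + s)) - listAverage n l h‖ ≤ (n : ℝ)⁻¹ * (2 * c) := by
  have hc : 0 ≤ c := (norm_nonneg _).trans (hh 0)
  induction l generalizing h with
  | nil => simp at hs
  | cons r l ih =>
    rcases List.mem_cons.1 hs with rfl | hs
    · have h1 : ∀ k : ℕ, (fun x => h (x + k • s + s)) = fun x => h (x + (k + 1) • s) := fun k => by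
        funext x
        rw [add_smul, one_smul, add_assoc]
      simp only [listAverage, h1]
      rw [← smul_sub, ← Finset.sum_sub_distrib,
        Finset.sum_range_sub fun k => listAverage n l fun x => h (x + k • s), norm_smul, norm_inv,
        Real.norm_of_nonneg n.cast_nonneg, two_mul]
      gcongr
      exact (norm_sub_le _ _).trans
        (add_le_add (norm_listAverage_le n l fun x => hh _) (norm_listAverage_le n l fun x => hh _))
    · simp only [listAverage]
      rw [← smul_sub, ← Finset.sum_sub_distrib]
      refine norm_inv_smul_sum_le n (by positivity) fun k => ?_
      have := ih hs (h := fun x => h (x + k • r)) fun x => hh _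
      simp only [add_right_comm _ s] at this
      exact this

/-- Abelian groups are amenable. -/
lemma exists_invariant_mean (A E : Type*) [AddCommGroup A] [NormedAddCommGroup E] [NormedSpace ℝ E]
    [ProperSpace E] :
    ∃ m : (A → E) → E,
      (∀ f g c d, (∀ x, ‖f x‖ ≤ c) → (∀ x, ‖g x‖ ≤ d) → m (fun x => f x + g x) = m f + m g) ∧
      (∀ f c, (∀ x, ‖f x‖ ≤ c) → ‖m f‖ ≤ c) ∧
      (∀ c, m (fun _ => c) = c) ∧
      ∀ f c a, (∀ x, ‖f x‖ ≤ c) → m (fun x => f (x + a)) = m f := by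
  classical
  let W : Ultrafilter (Finset A × ℕ) := Ultrafilter.of atTop
  have hW : (W : Filter (Finset A × ℕ)) ≤ atTop := Ultrafilter.of_le _
  let m : (A → E) → E := fun h => ulim W fun p => listAverage p.2 p.1.toList h
  have hm : ∀ f c, (∀ x, ‖f x‖ ≤ c) →
      Tendsto (fun p : Finset A × ℕ => listAverage p.2 p.1.toList f) W (𝓝 (m f)) := fun f c hf =>
    tendsto_ulim W fun p => norm_listAverage_le p.2 _ hf
  have hsnd : Tendsto (fun p : Finset A × ℕ => p.2) W atTop :=
    (tendsto_snd.mono_left (prod_atTop_atTop_eq (α := Finset A) (β := ℕ)).ge).mono_left hW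
  refine ⟨m, fun f g c d hf hg => ?_, fun f c hf => ?_, fun c => ?_, fun f c a hf => ?_⟩
  · refine tendsto_nhds_unique (hm _ (c + d) fun x => (norm_add_le _ _).trans
      (add_le_add (hf x) (hg x))) (((hm f c hf).add (hm g d hg)).congr fun p => ?_)
    rw [listAverage_add]
  · exact le_of_tendsto' (hm f c hf).norm fun p => norm_listAverage_le p.2 _ hf
  · refine ulim_eq (tendsto_const_nhds.congr' ?_)
    filter_upwards [hsnd.eventually_ne_atTop 0] with p hp
    rw [listAverage_const hp]
  · have h1 : Tendsto (fun p : Finset A × ℕ => (p.2 : ℝ)⁻¹ * (2 * c)) W (𝓝 0) := by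
      have := (tendsto_inv_atTop_zero.comp
        ((tendsto_natCast_atTop_atTop (R := ℝ)).comp hsnd)).mul_const (2 * c)
      rwa [zero_mul] at this
    have h2 : ∀ᶠ p in (W : Filter (Finset A × ℕ)), a ∈ p.1 :=
      hW ((eventually_ge_atTop (({a} : Finset A), 0)).mono fun p hp =>
        hp.1 (Finset.mem_singleton_self a))
    have h3 := squeeze_zero_norm' (h2.mono fun p hp =>
      norm_listAverage_shift_le p.2 (Finset.mem_toList.2 hp) hf) h1
    have h4 := (hm (fun x => f (x + a)) c fun x => hf _).sub (hm f c hf)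
    exact sub_eq_zero.1 (tendsto_nhds_unique h4 h3)

variable {V : Type*} [NormedAddCommGroup V] [NormedSpace ℝ V]

/-- A Lipschitz retraction onto a finite-dimensional subspace can be linearised. -/
lemma hasProj_of_retraction {E : Submodule ℝ V} [FiniteDimensional ℝ E] {K : ℝ} (g : V → E)
    (hg : ∀ x y, ‖g x - g y‖ ≤ K * ‖x - y‖) (hgE : ∀ e : E, g e = e) : HasProj E K := by
  have : ProperSpace E := FiniteDimensional.proper ℝ E
  obtain ⟨m, hadd, hnorm, hconst, hinv⟩ := exists_invariant_mean E E
  have hb : ∀ (x : V) (e : E), ‖g (x + e) - e‖ ≤ K * ‖x‖ := fun x e => by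
    have := hg (x + e) e
    rwa [hgE, add_sub_cancel_right] at this
  let G : V → E := fun x => m fun e => g (x + e) - e
  have hG : ∀ x y, ‖G x - G y‖ ≤ K * ‖x - y‖ := fun x y => by
    have h1 : ∀ e : E, ‖g (x + e) - g (y + e)‖ ≤ K * ‖x - y‖ := fun e => by
      have := hg (x + e) (y + e)
      rwa [add_sub_add_right_eq_sub] at this
    have h2 := hadd (fun e => g (x + e) - g (y + e)) (fun e => g (y + e) - e) _ _ h1 (hb y)
    simp only [sub_add_sub_cancel] at h2
    have h3 : G x - G y = m fun e => g (x + e) - g (y + e) := by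
      rw [sub_eq_iff_eq_add]
      exact h2
    rw [h3]
    exact hnorm _ _ h1
  have hGE : ∀ (x : V) (a : E), G (a + x) = G x + a := fun x a => by
    have h1 := hinv (fun e => g (x + e) - e) _ a (hb x)
    have h2 := hadd (fun e => g (x + (e + a : E)) - (e + a)) (fun _ => a) _ _ (fun e => hb x _)
      fun _ => le_rfl
    rw [hconst, h1] at h2
    rw [← h2]
    refine congrArg m (funext fun e => ?_)
    have : (a : V) + x + e = x + (e + a : E) := by
      push_cast
      abel
    rw [this]
    abel
  obtain ⟨m', hadd', hnorm', hconst', hinv'⟩ := exists_invariant_mean V E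
  have hb' : ∀ x z, ‖G (x + z) - G z‖ ≤ K * ‖x‖ := fun x z => by
    have := hG (x + z) z
    rwa [add_sub_cancel_right] at this
  let P : V → E := fun x => m' fun z => G (x + z) - G z
  have hPadd : ∀ x y, P (x + y) = P x + P y := fun x y => by
    have h1 := hinv' (fun z => G (x + z) - G z) _ y (hb' x)
    have h2 := hadd' (fun z => G (x + (z + y)) - G (z + y)) (fun z => G (y + z) - G z) _ _
      (fun z => hb' x _) (hb' y)
    rw [h1] at h2
    refine Eq.trans (congrArg m' (funext fun z => ?_)) h2
    have : x + y + z = x + (z + y) := by abel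
    rw [this, add_comm y z, sub_add_sub_cancel]
  have hPnorm : ∀ x, ‖P x‖ ≤ K * ‖x‖ := fun x => hnorm' _ _ (hb' x)
  have hPE : ∀ e : E, P e = e := fun e => by
    refine Eq.trans (congrArg m' (funext fun z => ?_)) (hconst' e)
    rw [hGE, add_sub_cancel_left]
  let P₀ : V →+ E := AddMonoidHom.mk' P hPadd
  let P₁ : V →L[ℝ] E := P₀.toRealLinearMap
    (AddMonoidHomClass.continuous_of_bound P₀ K hPnorm)
  exact ⟨E.subtype ∘ₗ P₁.toLinearMap, fun x => (P x).2,
    fun x hx => congrArg Subtype.val (hPE ⟨x, hx⟩),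
    hPnorm⟩

end InvariantMean

section UniformComplementation

variable {V : Type*} [NormedAddCommGroup V] [NormedSpace ℝ V]

/-- The common kernel of finitely many functionals. -/
def commonKer (S : Finset (V →L[ℝ] ℝ)) : Submodule ℝ V :=
  ⨅ f ∈ S, LinearMap.ker (f : V →ₗ[ℝ] ℝ)

lemma mem_commonKer {S : Finset (V →L[ℝ] ℝ)} {x : V} : x ∈ commonKer S ↔ ∀ f ∈ S, f x = 0 := by
  simp [commonKer]

lemma commonKer_anti {S T : Finset (V →L[ℝ] ℝ)} (h : S ⊆ T) : commonKer T ≤ commonKer S :=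
  fun _ hx => mem_commonKer.2 fun f hf => mem_commonKer.1 hx f (h hf)

lemma HasProj.mono {E : Submodule ℝ V} {c d : ℝ} (h : HasProj E c) (hcd : c ≤ d) :
    HasProj E d := by
  obtain ⟨P, h1, h2, h3⟩ := h
  exact ⟨P, h1, h2, fun x => (h3 x).trans (by gcongr)⟩

/-- Adding one dimension to a complemented subspace. -/
lemma HasProj.of_inf_ker {E : Submodule ℝ V} {g : V →L[ℝ] ℝ} {c : ℝ} (hc : 0 ≤ c)
    (h : HasProj (E ⊓ LinearMap.ker (g : V →ₗ[ℝ] ℝ)) c) : HasProj E (2 * c + 1) := by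
  by_cases hE : E ≤ LinearMap.ker (g : V →ₗ[ℝ] ℝ)
  · rw [inf_eq_left.2 hE] at h
    exact h.mono (by linarith)
  obtain ⟨e, heE, hge⟩ := Set.not_subset.1 hE
  obtain ⟨P, hP1, hP2, hP3⟩ := h
  set u := e - P e with hu
  have huE : u ∈ E := E.sub_mem heE (hP1 e).1
  have hgu : g u ≠ 0 := by
    have h1 : g (P e) = 0 := (hP1 e).2
    rw [hu, map_sub, h1, sub_zero]
    exact hge
  have hu0 : u ≠ 0 := fun h => hgu (by rw [h, map_zero])
  have hPu : P u = 0 := by rw [hu, map_sub, hP2 _ (hP1 e), sub_self]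
  have hun : ‖u‖ ≠ 0 := norm_ne_zero_iff.2 hu0
  obtain ⟨φ, hφ1, hφu⟩ := exists_dual_vector ℝ u hun
  have hφu' : φ u = ‖u‖ := hφu
  let Q : V →ₗ[ℝ] V := (φ : V →ₗ[ℝ] ℝ).smulRight (‖u‖⁻¹ • u)
  have hQ : ∀ x, Q x = φ x • ‖u‖⁻¹ • u := fun x => rfl
  refine ⟨P + Q ∘ₗ (LinearMap.id - P), fun x => ?_, fun x hx => ?_, fun x => ?_⟩
  · exact E.add_mem (hP1 x).1 (E.smul_mem _ (E.smul_mem _ huE))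
  · have h1 : x - (g x / g u) • u ∈ E ⊓ LinearMap.ker (g : V →ₗ[ℝ] ℝ) := by
      refine ⟨E.sub_mem hx (E.smul_mem _ huE), ?_⟩
      change g (x - (g x / g u) • u) = 0
      rw [map_sub, map_smul, smul_eq_mul, div_mul_cancel₀ _ hgu, sub_self]
    have h2 := hP2 _ h1
    rw [map_sub, map_smul, hPu, smul_zero, sub_zero] at h2
    change P x + Q (x - P x) = x
    rw [h2, sub_sub_cancel, map_smul, hQ, hφu', smul_smul (‖u‖), mul_inv_cancel₀ hun, one_smul,
      sub_add_cancel]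
  · change ‖P x + Q (x - P x)‖ ≤ _
    have h1 : ‖Q (x - P x)‖ ≤ ‖x - P x‖ := by
      rw [hQ, norm_smul, norm_smul, norm_inv, norm_norm, inv_mul_cancel₀ hun, mul_one]
      have := φ.le_opNorm (x - P x)
      rwa [hφ1, one_mul] at this
    have h2 := norm_add_le (P x) (Q (x - P x))
    have h3 := norm_sub_le x (P x)
    have h4 := hP3 x
    linarith

lemma not_hasProj_commonKer
    (hV : ¬ ∃ c : ℝ, ∀ E : Submodule ℝ V, FiniteDimensional ℝ E → HasProj E c)
    (S : Finset (V →L[ℝ] ℝ)) :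
    ¬ ∃ c : ℝ, ∀ E : Submodule ℝ V, FiniteDimensional ℝ E → E ≤ commonKer S → HasProj E c := by
  classical
  induction S using Finset.induction_on with
  | empty =>
    rintro ⟨c, h⟩
    exact hV ⟨c, fun E hE => h E hE (by simp [commonKer])⟩
  | insert g S hg ih =>
    rintro ⟨c, h⟩
    refine ih ⟨2 * max c 0 + 1, fun E hE hES => ?_⟩
    refine HasProj.of_inf_ker (g := g) (le_max_right _ _)
      ((h _ (Submodule.finiteDimensional_of_le inf_le_left) fun x hx => ?_).mono (le_max_left _ _))
    rw [mem_commonKer]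
    intro f hf
    rcases Finset.mem_insert.1 hf with rfl | hf
    · exact hx.2
    · exact mem_commonKer.1 (hES hx.1) f hf

/-- Finitely many functionals norm a finite-dimensional subspace up to a factor `2`. -/
lemma exists_norming (E : Submodule ℝ V) [FiniteDimensional ℝ E] :
    ∃ S : Finset (V →L[ℝ] ℝ), ∀ v ∈ E, ∀ y ∈ commonKer S, ‖v‖ ≤ 2 * ‖v + y‖ := by
  classical
  obtain ⟨T, hTs, hTf, hT⟩ := (isCompact_sphere (0 : E) 1).finite_cover_balls
    (e := 1 / 2) (by norm_num)
  choose φ hφ1 hφ using fun v : V => exists_dual_vector'' ℝ v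
  refine ⟨hTf.toFinset.image fun θ : E => φ (θ : V), fun v hv y hy => ?_⟩
  rcases eq_or_ne v 0 with rfl | hv0
  · simp
  have hn : 0 < ‖v‖ := norm_pos_iff.2 hv0
  let v' : E := ‖v‖⁻¹ • ⟨v, hv⟩
  have hv' : ‖v'‖ = 1 := by
    change ‖‖v‖⁻¹ • v‖ = 1
    rw [norm_smul, norm_inv, norm_norm, inv_mul_cancel₀ hn.ne']
  obtain ⟨θ, hθ, hvθ⟩ := Set.mem_iUnion₂.1
    (hT (show v' ∈ Metric.sphere (0 : E) 1 by simpa using hv'))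
  have hθ1 : ‖(θ : V)‖ = 1 := by simpa using hTs hθ
  rw [Metric.mem_ball, dist_eq_norm] at hvθ
  have h1 : φ θ y = 0 := mem_commonKer.1 hy _
    (Finset.mem_image_of_mem (fun θ : E => φ (θ : V)) (hTf.mem_toFinset.2 hθ))
  have h2 : φ θ (θ : V) = 1 := by
    have := hφ (θ : V)
    rw [hθ1] at this
    exact this
  have hle : ∀ x, |φ θ x| ≤ ‖x‖ := fun x => by
    have := (φ θ).le_opNorm x
    exact this.trans (mul_le_of_le_one_left (norm_nonneg _) (hφ1 _))
  have h3 := (le_abs_self _).trans (hle ((θ : V) - v'))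
  have h4 : ‖(θ : V) - v'‖ < 1 / 2 := by
    rw [norm_sub_rev]
    exact hvθ
  have h5 : φ θ (v' : V) = ‖v‖⁻¹ * φ θ v := (φ θ).map_smul _ _
  have h6 := (le_abs_self _).trans (hle (v + y))
  rw [map_add, h1, add_zero] at h6
  rw [map_sub, h2, h5] at h3
  have h7 : 1 / 2 < ‖v‖⁻¹ * φ θ v := by linarith
  rw [inv_mul_eq_div, lt_div_iff₀ hn] at h7
  linarith

/-- An extension operator on `Z` turns a linear retraction of `Z` onto a finite-dimensional
subspace into a retraction of the whole space. -/
lemma hasProj_of_isLipExtensionOperator {Z E : Submodule ℝ V} [FiniteDimensional ℝ E] (hEZ : E ≤ Z)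
    {C : ℝ≥0} {F : (Z → ℝ) →ₗ[ℝ] (V → ℝ)} (hF : IsLipExtensionOperator V Z C F) (f : V →L[ℝ] E)
    (hfE : ∀ e : E, f e = e) {K : ℝ≥0} (hf : ∀ z ∈ Z, ‖f z‖ ≤ K * ‖z‖) : HasProj E (C * K) := by
  let b := Module.finBasis ℝ E
  let u : (E →ₗ[ℝ] ℝ) → Z → ℝ := fun φ z => φ (f z)
  let g : V → E := fun x => ∑ j, F (u (b.coord j)) x • b j
  have hφg : ∀ (φ : E →ₗ[ℝ] ℝ) x, φ (g x) = F (u φ) x := by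
    intro φ x
    have h1 : u φ = ∑ j, φ (b j) • u (b.coord j) := by
      funext z
      have h2 := congrArg φ (b.sum_repr (f z))
      rw [map_sum] at h2
      simp only [u, Finset.sum_apply, Pi.smul_apply, smul_eq_mul, Module.Basis.coord_apply]
      rw [← h2]
      exact Finset.sum_congr rfl fun j _ => by rw [map_smul, smul_eq_mul, mul_comm]
    rw [map_sum, h1, map_sum, Finset.sum_apply]
    exact Finset.sum_congr rfl fun j _ => by
      rw [map_smul, map_smul, Pi.smul_apply, smul_eq_mul, smul_eq_mul, mul_comm]
  have hlip : ∀ φ : E →L[ℝ] ℝ, LipschitzWith (‖φ‖₊ * K) (u φ) := fun φ => by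
    refine LipschitzWith.of_dist_le_mul fun x y => ?_
    have h1 : u φ x - u φ y = φ (f ((x - y : Z) : V)) := by
      simp [u]
    rw [dist_eq_norm, dist_eq_norm, h1]
    refine (φ.le_opNorm _).trans ?_
    rw [NNReal.coe_mul, coe_nnnorm, mul_assoc]
    gcongr
    exact hf _ (x - y).2
  have hu0 : ∀ φ : E →ₗ[ℝ] ℝ, u φ 0 = 0 := fun φ => by simp [u]
  refine hasProj_of_retraction g (fun x y => ?_) fun e => ?_
  · obtain ⟨φ, hφ1, hφ⟩ := exists_dual_vector'' ℝ (g x - g y)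
    have h1 := (hF _ _ (hu0 φ) (hlip φ)).2.2.dist_le_mul x y
    rw [← hφg, ← hφg, dist_eq_norm, dist_eq_norm, ← map_sub] at h1
    have h2 : (φ : E →ₗ[ℝ] ℝ) (g x - g y) = ‖g x - g y‖ := hφ
    rw [h2, norm_norm] at h1
    refine h1.trans ?_
    push_cast
    gcongr
    exact mul_le_of_le_one_left K.2 hφ1
  · have h1 : ∀ φ : E →ₗ[ℝ] ℝ, φ (g e) = φ e := fun φ => by
      rw [hφg]
      have := (hF _ _ (hu0 φ) (hlip φ.toContinuousLinearMap)).1 ⟨e, hEZ e.2⟩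
      refine this.trans ?_
      simp [u, hfE]
    exact b.ext_elem fun j => h1 (b.coord j)

end UniformComplementation

section FiniteDimensionalDecomposition

variable {V : Type*} [NormedAddCommGroup V] [NormedSpace ℝ V]

lemma exists_bounded_retraction {Z R E Y : Submodule ℝ V} [FiniteDimensional ℝ E] (hEZ : E ≤ Z)
    (hZ : Z ≤ R ⊔ E ⊔ Y) (hR : ∀ v ∈ R, ∀ y ∈ E ⊔ Y, ‖v‖ ≤ 2 * ‖v + y‖)
    (hRE : ∀ v ∈ R ⊔ E, ∀ y ∈ Y, ‖v‖ ≤ 2 * ‖v + y‖) :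
    ∃ f : V →L[ℝ] E, (∀ e : E, f e = e) ∧ ∀ z ∈ Z.topologicalClosure, ‖f z‖ ≤ 4 * ‖z‖ := by
  have key : ∀ e ∈ E, ∀ q ∈ R ⊔ Y, ‖e‖ ≤ 4 * ‖e + q‖ := by
    intro e he q hq
    obtain ⟨r, hr, y, hy, rfl⟩ := Submodule.mem_sup.1 hq
    have h1 := hR r hr (e + y) (Submodule.add_mem_sup he hy)
    have h2 := hRE (r + e) (Submodule.add_mem_sup hr he) y hy
    have h3 := norm_sub_le (r + e) r
    rw [add_sub_cancel_left] at h3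
    rw [show r + (e + y) = e + (r + y) by abel] at h1
    rw [show r + e + y = e + (r + y) by abel] at h2
    linarith
  have hdisj : Disjoint E (R ⊔ Y) := by
    rw [Submodule.disjoint_def]
    intro x hx hx'
    have := key x hx (-x) (neg_mem hx')
    rw [add_neg_cancel, norm_zero, mul_zero] at this
    exact norm_le_zero_iff.1 this
  obtain ⟨W, hW, hWc⟩ := hdisj.symm.exists_isCompl
  let p : V →ₗ[ℝ] E := Submodule.projectionOnto E W hWc.symm
  have hp : ∀ z ∈ Z, ‖p z‖ ≤ 4 * ‖z‖ := by
    intro z hz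
    obtain ⟨v, hv, y, hy, rfl⟩ := Submodule.mem_sup.1 (hZ hz)
    obtain ⟨r, hr, e, he, rfl⟩ := Submodule.mem_sup.1 hv
    have hq : r + y ∈ R ⊔ Y := Submodule.add_mem_sup hr hy
    have h1 : p (e + (r + y)) = ⟨e, he⟩ := by
      rw [map_add, show p (r + y) = 0 from Submodule.projectionOnto_apply_right hWc.symm ⟨_, hW hq⟩,
        add_zero]
      exact Submodule.projectionOnto_apply_left _ ⟨e, he⟩
    rw [show r + e + y = e + (r + y) by abel, h1]
    exact key e he _ hq
  let p' : Z →L[ℝ] E := (p ∘ₗ Z.subtype).mkContinuous 4 fun z => hp z z.2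
  obtain ⟨f, hf⟩ := p'.exist_extension_of_finiteDimensional_range
  have hfp : ∀ z ∈ Z, f z = p z := fun z hz => (DFunLike.congr_fun hf ⟨z, hz⟩).symm
  refine ⟨f, fun e => ?_, fun z hz => ?_⟩
  · rw [hfp _ (hEZ e.2)]
    exact Submodule.projectionOnto_apply_left _ e
  · have hcl : IsClosed {z : V | ‖f z‖ ≤ 4 * ‖z‖} := isClosed_le (by fun_prop) (by fun_prop)
    refine closure_minimal (fun z hz => ?_) hcl hz
    change ‖f z‖ ≤ _
    rw [hfp z hz]
    exact hp z hz

/-- If every closed subspace admits an extension operator, then the finite-dimensional subspaces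
are uniformly complemented. -/
theorem exists_hasProj_of_forall_isLipExtensionOperator
    (h : ∀ Z : Submodule ℝ V, IsClosed (Z : Set V) →
      ∃ (C : ℝ≥0) (F : (Z → ℝ) →ₗ[ℝ] (V → ℝ)), IsLipExtensionOperator V Z C F) :
    ∃ c : ℝ, ∀ E : Submodule ℝ V, FiniteDimensional ℝ E → HasProj E c := by
  classical
  by_contra hV
  have hex : ∀ (S : Finset (V →L[ℝ] ℝ)) (n : ℕ), ∃ E : Submodule ℝ V,
      FiniteDimensional ℝ E ∧ E ≤ commonKer S ∧ ¬ HasProj E n := by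
    intro S n
    by_contra! hS
    exact not_hasProj_commonKer hV S ⟨n, hS⟩
  choose B hBfin hBker hBproj using hex
  have hnorm : ∀ E : {E : Submodule ℝ V // FiniteDimensional ℝ E},
      ∃ S : Finset (V →L[ℝ] ℝ), ∀ v ∈ E.1, ∀ y ∈ commonKer S, ‖v‖ ≤ 2 * ‖v + y‖ :=
    fun E => have := E.2; exists_norming E.1
  choose N hN using hnorm
  let enlarge : ℕ → {E : Submodule ℝ V // FiniteDimensional ℝ E} × Finset (V →L[ℝ] ℝ) →
      {E : Submodule ℝ V // FiniteDimensional ℝ E} := fun n p =>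
    ⟨p.1.1 ⊔ B p.2 n, have := p.1.2; have := hBfin p.2 n; inferInstance⟩
  let st : ℕ → {E : Submodule ℝ V // FiniteDimensional ℝ E} × Finset (V →L[ℝ] ℝ) := fun n =>
    Nat.rec (⟨⊥, inferInstance⟩, ∅) (fun n p => (enlarge n p, p.2 ∪ N (enlarge n p))) n
  let U : ℕ → Submodule ℝ V := fun n => (st n).1.1
  let S : ℕ → Finset (V →L[ℝ] ℝ) := fun n => (st n).2
  let E : ℕ → Submodule ℝ V := fun n => B (S n) n
  have hU : ∀ n, U (n + 1) = U n ⊔ E n := fun n => rfl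
  have hS : Monotone S := monotone_nat_of_le_succ fun n => Finset.subset_union_left
  have hUN : ∀ n, ∀ v ∈ U n, ∀ y ∈ commonKer (S n), ‖v‖ ≤ 2 * ‖v + y‖ := by
    rintro (_ | n) v hv y hy
    · rw [(Submodule.mem_bot ℝ).1 hv, norm_zero]
      positivity
    · exact hN (enlarge n (st n)) v hv y (commonKer_anti Finset.subset_union_right hy)
  have hUmono : Monotone U := monotone_nat_of_le_succ fun n => le_sup_left
  obtain ⟨C, F, hF⟩ := h (⨆ n, U n).topologicalClosure (Submodule.isClosed_topologicalClosure _)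
  obtain ⟨n, hn⟩ := exists_nat_ge ((C : ℝ) * 4)
  have hle : ∀ m, U m ≤ U n ⊔ E n ⊔ commonKer (S (n + 1)) := by
    intro m
    rcases le_total m (n + 1) with hm | hm
    · exact (hUmono hm).trans le_sup_left
    · induction m, hm using Nat.le_induction with
      | base => exact le_sup_left
      | succ m hm ih =>
        exact sup_le ih (((hBker _ _).trans (commonKer_anti (hS hm))).trans le_sup_right)
  have hEU : E n ≤ ⨆ n, U n := le_trans le_sup_right (le_iSup U (n + 1))
  have := hBfin (S n) n
  obtain ⟨f, hfE, hf⟩ := exists_bounded_retraction hEU (iSup_le hle)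
    (fun v hv y hy => hUN n v hv y
      (sup_le (hBker _ _) (commonKer_anti (hS n.le_succ)) hy)) (hUN (n + 1))
  refine hBproj (S n) n ((hasProj_of_isLipExtensionOperator
    (hEU.trans (Submodule.le_topologicalClosure _)) hF f hfE (K := 4) hf).mono ?_)
  exact_mod_cast hn

end FiniteDimensionalDecomposition

section HilbertSpaceExtension

/-- A copy of a vector space which carries no norm. -/
def Copy (V : Type*) : Type _ := V

instance (V : Type*) [AddCommGroup V] : AddCommGroup (Copy V) := inferInstanceAs (AddCommGroup V)

instance (V : Type*) [AddCommGroup V] [Module ℝ V] : Module ℝ (Copy V) :=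
  inferInstanceAs (Module ℝ V)

variable {V : Type*} [NormedAddCommGroup V] [NormedSpace ℝ V]

lemma exists_projection_of_isomorphicToHilbert [CompleteSpace V] (h : IsomorphicToHilbert V)
    {Z : Submodule ℝ V} (hZ : IsClosed (Z : Set V)) :
    ∃ P : V →L[ℝ] V, (∀ x, P x ∈ Z) ∧ ∀ x ∈ Z, P x = x := by
  obtain ⟨f, ⟨hsymm, hsmul, hadd, hpos⟩, a, b, ha, hb, hab⟩ := h
  let core : InnerProductSpace.Core ℝ (Copy V) :=
    { inner := fun x y => f x y
      conj_inner_symm := fun x y => hsymm y x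
      re_inner_nonneg := fun x => (mul_nonneg ha.le (sq_nonneg _)).trans (hab x).1
      add_left := hadd
      smul_left := fun x y r => hsmul r x y
      definite := fun x hx => by
        by_contra hne
        exact (hpos x hne).ne' hx }
  let _ : NormedAddCommGroup (Copy V) := core.toNormedAddCommGroup
  let _ : InnerProductSpace ℝ (Copy V) := InnerProductSpace.ofCore core.toCore
  let e₀ : V ≃ₗ[ℝ] Copy V := LinearEquiv.refl ℝ V
  have hnorm : ∀ x : V, ‖e₀ x‖ ^ 2 = f x x := fun x => (real_inner_self_eq_norm_sq (e₀ x)).symm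
  let e : V ≃L[ℝ] Copy V := e₀.toContinuousLinearEquivOfBounds (√b) (√a)⁻¹
    (fun x => by
      refine le_of_sq_le_sq ?_ (by positivity)
      rw [hnorm, mul_pow, Real.sq_sqrt hb.le]
      exact (hab x).2)
    (fun x => by
      have h1 := (hab (e₀.symm x)).1
      rw [← hnorm, e₀.apply_symm_apply] at h1
      rw [inv_mul_eq_div, le_div_iff₀ (Real.sqrt_pos.2 ha)]
      refine le_of_sq_le_sq ?_ (norm_nonneg _)
      rw [mul_pow, Real.sq_sqrt ha.le]
      linarith)
  have : CompleteSpace (Copy V) :=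
    (completeSpace_congr (e := e.toEquiv) e.isUniformEmbedding).1 inferInstance
  let Z' : Submodule ℝ (Copy V) := Z.comap (e.symm : Copy V →ₗ[ℝ] V)
  have hZ' : IsClosed (Z' : Set (Copy V)) := hZ.preimage e.symm.continuous
  have : CompleteSpace Z' := hZ'.completeSpace_coe
  refine ⟨(e.symm : Copy V →L[ℝ] V) ∘L Z'.starProjection ∘L (e : V →L[ℝ] Copy V), fun x => ?_,
    fun x hx => ?_⟩
  · exact Z'.starProjection_apply_mem (e x)
  · have hx' : e x ∈ Z' := by
      change e.symm (e x) ∈ Z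
      rwa [e.symm_apply_apply]
    change e.symm (Z'.starProjection (e x)) = x
    rw [Submodule.starProjection_eq_self_iff.2 hx', e.symm_apply_apply]

/-- Composition with a bounded projection extends Lipschitz functions. -/
theorem exists_isLipExtensionOperator_of_isomorphicToHilbert [CompleteSpace V]
    (h : IsomorphicToHilbert V) {Z : Submodule ℝ V} (hZ : IsClosed (Z : Set V)) :
    ∃ (C : ℝ≥0) (F : (Z → ℝ) →ₗ[ℝ] (V → ℝ)), IsLipExtensionOperator V Z C F := by
  obtain ⟨P, hP, hPZ⟩ := exists_projection_of_isomorphicToHilbert h hZ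
  refine ⟨‖P‖₊, LinearMap.funLeft ℝ ℝ fun x => (⟨P x, hP x⟩ : Z), fun K f hf hK => ⟨?_, ?_, ?_⟩⟩
  · intro z
    exact congrArg f (Subtype.ext (hPZ z z.2))
  · rw [LinearMap.funLeft_apply, ← hf]
    exact congrArg f (Subtype.ext (map_zero P))
  · rw [mul_comm]
    exact hK.comp fun x y => P.lipschitz x y

end HilbertSpaceExtension

end LipExt

/-- Theorem 3.B.3: a real Banach space `X` is isomorphic to a Hilbert space if and only
if for every closed subspace `Z` of `X` there is a bounded linear Lipschitz-extension
operator `Lip₀(Z) → Lip₀(X)`. -/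
theorem hilbert_iff_lipschitz_extension_operator [CompleteSpace X] :
    IsomorphicToHilbert X ↔
      ∀ Z : Submodule ℝ X, IsClosed (Z : Set X) →
        ∃ (C : ℝ≥0) (F : (Z → ℝ) →ₗ[ℝ] (X → ℝ)), IsLipExtensionOperator X Z C F := by
  refine ⟨fun h Z hZ => LipExt.exists_isLipExtensionOperator_of_isomorphicToHilbert h hZ,
    fun h => ?_⟩
  obtain ⟨c, hc⟩ := LipExt.exists_hasProj_of_forall_isLipExtensionOperator h
  obtain ⟨D, hD, hE⟩ := LipExt.exists_uniform_isNearEuclidean hc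
  exact LipExt.isomorphicToHilbert_of_isNearEuclidean hD hE
end

section
/- Let X be a real Banach space such that for every closed subspace M of X, the quotient map φ : X → X/M admits a Lipschitz right inverse, i.e., there exists a Lipschitz map ψ : X/M → X with φ(ψ(u)) = u for all u ∈ X/M. Then X is isomorphic to a Hilbert space. -/
open scoped NNReal

universe u

variable (X : Type u) [NormedAddCommGroup X] [NormedSpace ℝ X]

open scoped BigOperators

/-- The real number `±1` attached to a sign. -/
def signReal (u : ℤˣ) : ℝ := ((u : ℤ) : ℝ)

lemma signReal_one : signReal 1 = 1 := by simp [signReal]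

lemma signReal_neg (u : ℤˣ) : signReal (-u) = -signReal u := by simp [signReal]

lemma signReal_mul (u v : ℤˣ) : signReal (u * v) = signReal u * signReal v := by
  simp [signReal]

lemma signReal_mul_self (u : ℤˣ) : signReal u * signReal u = 1 := by
  rcases Int.units_eq_one_or u with rfl | rfl <;> simp [signReal]

lemma abs_signReal (u : ℤˣ) : |signReal u| = 1 := by
  rcases Int.units_eq_one_or u with rfl | rfl <;> simp [signReal]

lemma expect_fin_succ_signs {n : ℕ} (f : (Fin (n + 1) → ℤˣ) → ℝ) :
    𝔼 ω, f ω = ((𝔼 ω : Fin n → ℤˣ, f (Fin.cons 1 ω)) +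
      𝔼 ω : Fin n → ℤˣ, f (Fin.cons (-1) ω)) / 2 := by
  rw [← Fintype.expect_equiv (Fin.consEquiv fun _ => ℤˣ) (fun p => f (Fin.cons p.1 p.2)) f
    (fun _ => rfl), ← Finset.univ_product_univ, Finset.expect_product,
    Fintype.expect_eq_sum_div_card]
  rw [UnitsInt.univ]
  simp

/-- Multiplying by a fixed sign vector preserves the uniform average over sign vectors. -/
lemma expect_mul_left_signs {ι : Type*} [Fintype ι] [DecidableEq ι] (η : ι → ℤˣ)
    (f : (ι → ℤˣ) → ℝ) : 𝔼 ω, f (η * ω) = 𝔼 ω, f ω :=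
  Fintype.expect_equiv (Equiv.mulLeft η) _ _ fun _ => rfl

lemma expect_flip_signs {ι : Type*} [Fintype ι] [DecidableEq ι] (i : ι)
    (f : (ι → ℤˣ) → ℝ) : 𝔼 ω, f (Function.update ω i (-ω i)) = 𝔼 ω, f ω := by
  rw [← expect_mul_left_signs (Pi.mulSingle i (-1)) f]
  refine Finset.expect_congr rfl fun ω _ => congrArg f ?_
  ext j
  by_cases h : j = i
  · subst h; simp
  · simp [h]

/-- The Poincaré inequality on the discrete cube `{±1}ⁿ`. -/
lemma poincare_signs_fin {n : ℕ} (f : (Fin n → ℤˣ) → ℝ) :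
    𝔼 ω, f ω ^ 2 ≤ (𝔼 ω, f ω) ^ 2 +
      (1 / 4) * ∑ i, 𝔼 ω, (f ω - f (Function.update ω i (-ω i))) ^ 2 := by
  induction n with
  | zero => simp
  | succ n ih =>
    have h1 := ih fun ω => f (Fin.cons 1 ω)
    have h2 := ih fun ω => f (Fin.cons (-1) ω)
    have h3 : ((𝔼 ω : Fin n → ℤˣ, f (Fin.cons 1 ω)) -
        𝔼 ω : Fin n → ℤˣ, f (Fin.cons (-1) ω)) ^ 2 ≤
        𝔼 ω : Fin n → ℤˣ, (f (Fin.cons 1 ω) - f (Fin.cons (-1) ω)) ^ 2 := by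
      rw [← Finset.expect_sub_distrib]
      have := Finset.expect_nonneg (s := (Finset.univ : Finset (Fin n → ℤˣ)))
        (f := fun ω => (f (Fin.cons 1 ω) - f (Fin.cons (-1) ω) -
          𝔼 ω : Fin n → ℤˣ, (f (Fin.cons 1 ω) - f (Fin.cons (-1) ω))) ^ 2)
        (fun _ _ => sq_nonneg _)
      simp only [sub_sq (_ - _) (Finset.expect _ _), Finset.expect_add_distrib,
        Finset.expect_sub_distrib _ (fun ω => (f (Fin.cons 1 ω) - f (Fin.cons (-1) ω)) ^ 2),
        ← Finset.expect_mul, ← Finset.mul_expect, Fintype.expect_const] at this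
      nlinarith
    rw [expect_fin_succ_signs, expect_fin_succ_signs, Fin.sum_univ_succ]
    simp only [expect_fin_succ_signs (n := n), Fin.cons_zero, Fin.cons_succ, Fin.update_cons_zero,
      ← Fin.cons_update, neg_neg]
    have h4 : 𝔼 ω : Fin n → ℤˣ, (f (Fin.cons (-1) ω) - f (Fin.cons 1 ω)) ^ 2 =
        𝔼 ω : Fin n → ℤˣ, (f (Fin.cons 1 ω) - f (Fin.cons (-1) ω)) ^ 2 :=
      Finset.expect_congr rfl fun ω _ => by ring
    rw [h4, ← Finset.sum_div, Finset.sum_add_distrib]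
    nlinarith

lemma poincare_signs {ι : Type*} [Fintype ι] [DecidableEq ι] (f : (ι → ℤˣ) → ℝ) :
    𝔼 ω, f ω ^ 2 ≤ (𝔼 ω, f ω) ^ 2 +
      (1 / 4) * ∑ i, 𝔼 ω, (f ω - f (Function.update ω i (-ω i))) ^ 2 := by
  let e := Fintype.equivFin ι
  let E : (Fin (Fintype.card ι) → ℤˣ) ≃ (ι → ℤˣ) := Equiv.arrowCongr e.symm (Equiv.refl _)
  have h := poincare_signs_fin fun ω => f (E ω)
  rw [Fintype.expect_equiv E _ (fun ω => f ω ^ 2) fun _ => rfl,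
    Fintype.expect_equiv E _ f fun _ => rfl] at h
  refine h.trans_eq ?_
  congr 2
  refine Fintype.sum_equiv e.symm _ _ fun i => Fintype.expect_equiv E _ _ fun ω => ?_
  congr 3
  ext j
  by_cases hj : j = e.symm i
  · subst hj; simp [E]
  · have : e j ≠ i := fun h => hj (by simp [← h])
    simp [E, hj, this]

lemma expect_sq_sub_expect {α : Type*} [Fintype α] [Nonempty α] (f : α → ℝ) :
    𝔼 ω, (f ω - 𝔼 ω, f ω) ^ 2 = 𝔼 ω, f ω ^ 2 - (𝔼 ω, f ω) ^ 2 := by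
  simp only [sub_sq, Finset.expect_add_distrib,
    Finset.expect_sub_distrib, ← Finset.expect_mul, ← Finset.mul_expect, Fintype.expect_const]
  ring

/-- Second and fourth moments of a Rademacher sum. -/
lemma moments_signs {n : ℕ} (c : Fin n → ℝ) :
    𝔼 ω : Fin n → ℤˣ, (∑ b, signReal (ω b) * c b) ^ 2 = ∑ b, c b ^ 2 ∧
    𝔼 ω : Fin n → ℤˣ, (∑ b, signReal (ω b) * c b) ^ 4 ≤ 3 * (∑ b, c b ^ 2) ^ 2 := by
  induction n with
  | zero => simp
  | succ n ih =>
    obtain ⟨h1, h2⟩ := ih fun b => c b.succ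
    have key2 : ∀ y : ℝ, (c 0 + y) ^ 2 + (-c 0 + y) ^ 2 = 2 * c 0 ^ 2 + 2 * y ^ 2 := by
      intro y; ring
    have key4 : ∀ y : ℝ, (c 0 + y) ^ 4 + (-c 0 + y) ^ 4 =
        2 * c 0 ^ 4 + 12 * c 0 ^ 2 * y ^ 2 + 2 * y ^ 4 := by
      intro y; ring
    simp only [expect_fin_succ_signs, ← Finset.expect_add_distrib, Fin.sum_univ_succ,
      Fin.cons_zero, Fin.cons_succ, signReal_neg, signReal_one, one_mul, neg_mul, key2, key4]
    simp only [Finset.expect_add_distrib, ← Finset.mul_expect, Fintype.expect_const, h1]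
    constructor
    · ring
    · nlinarith [sq_nonneg (c 0), sq_nonneg (c 0 ^ 2)]

/-- The `L¹` Khintchine inequality. -/
lemma khintchine_signs {n : ℕ} (c : Fin n → ℝ) (hc : ∑ b, c b ^ 2 = 1) :
    5 / 9 ≤ 𝔼 ω : Fin n → ℤˣ, |∑ b, signReal (ω b) * c b| := by
  obtain ⟨h1, h2⟩ := moments_signs c
  have key : ∀ x : ℝ, x ^ 2 - (4 / 27) * x ^ 4 ≤ |x| := by
    intro x
    have h : ∀ y : ℝ, 0 ≤ y → y ^ 2 - (4 / 27) * y ^ 4 ≤ y := by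
      intro y hy
      have : 0 ≤ y * ((y - 3 / 2) ^ 2 * (y + 3)) := by positivity
      nlinarith
    have := h |x| (abs_nonneg x)
    rwa [sq_abs, show |x| ^ 4 = x ^ 4 by rw [← abs_pow, abs_of_nonneg (by positivity)]] at this
  have := Finset.expect_le_expect (s := (Finset.univ : Finset (Fin n → ℤˣ)))
    (fun ω _ => key (∑ b, signReal (ω b) * c b))
  rw [Finset.expect_sub_distrib, ← Finset.mul_expect, h1, hc] at this
  rw [hc] at h2
  linarith

lemma expect_row_signs {ι β : Type*} [Fintype ι] [Fintype β] [DecidableEq ι] [DecidableEq β]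
    (a : ι) (g : (β → ℤˣ) → ℝ) :
    𝔼 ω : ι × β → ℤˣ, g (fun b => ω (a, b)) = 𝔼 ζ, g ζ := by
  have h : ∀ ζ : β → ℤˣ, 𝔼 ω : ι × β → ℤˣ, g (fun b => ω (a, b) * ζ b) =
      𝔼 ω : ι × β → ℤˣ, g (fun b => ω (a, b)) := by
    intro ζ
    rw [← expect_mul_left_signs (fun p : ι × β => ζ p.2) fun ω => g fun b => ω (a, b)]
    simp [mul_comm]
  calc 𝔼 ω : ι × β → ℤˣ, g (fun b => ω (a, b))
      = 𝔼 ζ : β → ℤˣ, 𝔼 ω : ι × β → ℤˣ, g (fun b => ω (a, b) * ζ b) := by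
        simp only [h, Fintype.expect_const]
    _ = 𝔼 ω : ι × β → ℤˣ, 𝔼 ζ : β → ℤˣ, g ((fun b => ω (a, b)) * ζ) :=
        Finset.expect_comm _ _ _
    _ = 𝔼 ζ, g ζ := by simp only [expect_mul_left_signs, Fintype.expect_const]

section RademacherSums

variable {Y : Type*} [NormedAddCommGroup Y] [NormedSpace ℝ Y]

/-- The average over signs of `‖∑ ± xₐ‖` does not depend on the signs of the scalar
coefficients. -/
lemma expect_norm_sum_abs {ι : Type*} [Fintype ι] [DecidableEq ι] (r : ι → ℝ) (v : ι → Y) :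
    𝔼 η : ι → ℤˣ, ‖∑ a, signReal (η a) • |r a| • v a‖ =
      𝔼 η : ι → ℤˣ, ‖∑ a, signReal (η a) • r a • v a‖ := by
  rw [← expect_mul_left_signs (fun a => if 0 ≤ r a then 1 else -1)
    fun η => ‖∑ a, signReal (η a) • r a • v a‖]
  refine Finset.expect_congr rfl fun η _ => ?_
  congr 1
  refine Finset.sum_congr rfl fun a _ => ?_
  simp only [Pi.mul_apply, signReal_mul]
  split_ifs with h
  · simp [abs_of_nonneg h, signReal_one]
  · simp [abs_of_neg (not_le.1 h), signReal_one, signReal_neg]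

/-- Introducing independent signs on the rows of a doubly indexed Rademacher sum. -/
lemma expect_norm_sum_prod {ι β : Type*} [Fintype ι] [Fintype β] [DecidableEq ι]
    [DecidableEq β] (c : β → ℝ) (v : ι → Y) :
    𝔼 ω : ι × β → ℤˣ, ‖∑ p, signReal (ω p) • c p.2 • v p.1‖ =
      𝔼 ω : ι × β → ℤˣ, 𝔼 η : ι → ℤˣ,
        ‖∑ a, signReal (η a) • (∑ b, signReal (ω (a, b)) * c b) • v a‖ := by
  have hsum : ∀ (η : ι → ℤˣ) (ω : ι × β → ℤˣ),
      ∑ p : ι × β, signReal (((fun q : ι × β => η q.1) * ω) p) • c p.2 • v p.1 =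
        ∑ a, signReal (η a) • (∑ b, signReal (ω (a, b)) * c b) • v a := by
    intro η ω
    rw [Fintype.sum_prod_type]
    refine Finset.sum_congr rfl fun a _ => ?_
    simp only [Pi.mul_apply, signReal_mul, Finset.sum_smul, Finset.smul_sum, smul_smul]
    exact Finset.sum_congr rfl fun b _ => by congr 1; ring
  rw [Finset.expect_comm]
  simp only [← hsum]
  simp only [expect_mul_left_signs (ι := ι × β) _
    fun ω => ‖∑ p, signReal (ω p) • c p.2 • v p.1‖, Fintype.expect_const]

/-- Comparison of a Rademacher average of `v` with the same average where every sign is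
replaced by an independent Rademacher sum. -/
lemma expect_abs_mul_expect_norm_le {ι β : Type*} [Fintype ι] [Fintype β] [DecidableEq ι]
    [DecidableEq β] (c : β → ℝ) (v : ι → Y) :
    (𝔼 ζ : β → ℤˣ, |∑ b, signReal (ζ b) * c b|) *
        𝔼 η : ι → ℤˣ, ‖∑ a, signReal (η a) • v a‖ ≤
      𝔼 ω : ι × β → ℤˣ, ‖∑ p, signReal (ω p) • c p.2 • v p.1‖ := by
  set κ := 𝔼 ζ : β → ℤˣ, |∑ b, signReal (ζ b) * c b|
  let ξ : (ι × β → ℤˣ) → ι → ℝ := fun ω a => ∑ b, signReal (ω (a, b)) * c b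
  have hξ : ∀ a, 𝔼 ω, |ξ ω a| = κ := fun a =>
    expect_row_signs a fun ζ => |∑ b, signReal (ζ b) * c b|
  calc κ * 𝔼 η : ι → ℤˣ, ‖∑ a, signReal (η a) • v a‖
      = 𝔼 η : ι → ℤˣ, κ * ‖∑ a, signReal (η a) • v a‖ := Finset.mul_expect _ _ _
    _ ≤ 𝔼 η : ι → ℤˣ, 𝔼 ω, ‖∑ a, signReal (η a) • |ξ ω a| • v a‖ := by
        refine Finset.expect_le_expect fun η _ => ?_
        obtain ⟨φ, hφ, hφv⟩ := exists_dual_vector'' ℝ (∑ a, signReal (η a) • v a)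
        have h1 : ∀ ω, φ (∑ a, signReal (η a) • |ξ ω a| • v a) ≤
            ‖∑ a, signReal (η a) • |ξ ω a| • v a‖ := fun ω =>
          (le_abs_self _).trans ((φ.le_opNorm _).trans
            (mul_le_of_le_one_left (norm_nonneg _) hφ))
        refine le_trans (le_of_eq ?_) (Finset.expect_le_expect fun ω _ => h1 ω)
        simp only [map_sum, map_smul, smul_eq_mul] at hφv ⊢
        rw [RCLike.ofReal_real_eq_id, id] at hφv
        rw [← hφv, Finset.expect_sum_comm, Finset.mul_sum]
        refine Finset.sum_congr rfl fun a _ => ?_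
        rw [← Finset.mul_expect, ← Finset.expect_mul, hξ]
        ring
    _ = 𝔼 ω, 𝔼 η : ι → ℤˣ, ‖∑ a, signReal (η a) • ξ ω a • v a‖ := by
        rw [Finset.expect_comm]
        simp only [expect_norm_sum_abs]
    _ = 𝔼 ω : ι × β → ℤˣ, ‖∑ p, signReal (ω p) • c p.2 • v p.1‖ :=
        (expect_norm_sum_prod c v).symm

/-- A single term is dominated by the Rademacher average. -/
lemma norm_le_expect_norm {ι : Type*} [Fintype ι] [DecidableEq ι] (x : ι → Y) (i : ι) :
    ‖x i‖ ≤ 𝔼 η : ι → ℤˣ, ‖∑ a, signReal (η a) • x a‖ := by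
  have h : ∀ η : ι → ℤˣ, 2 * ‖x i‖ ≤ ‖∑ a, signReal (η a) • x a‖ +
      ‖∑ a, signReal (Function.update η i (-η i) a) • x a‖ := by
    intro η
    have h1 : ∑ a, signReal (η a) • x a - ∑ a, signReal (Function.update η i (-η i) a) • x a =
        (2 * signReal (η i)) • x i := by
      rw [← Finset.sum_sub_distrib, Finset.sum_eq_single i]
      · simp [signReal_neg, two_mul, add_smul]
      · intro b _ hb
        simp [hb]
      · simp
    calc 2 * ‖x i‖ = ‖(2 * signReal (η i)) • x i‖ := by
          rw [norm_smul, Real.norm_eq_abs, abs_mul, abs_signReal]; norm_num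
      _ ≤ _ := h1 ▸ norm_sub_le _ _
  have h2 := Finset.expect_le_expect (s := (Finset.univ : Finset (ι → ℤˣ))) fun η _ => h η
  rw [Fintype.expect_const, Finset.expect_add_distrib,
    expect_flip_signs i fun η => ‖∑ a, signReal (η a) • x a‖] at h2
  linarith

/-- Rademacher sums with bounded weak `ℓ²` norm are concentrated around their mean. -/
lemma variance_norm_le {ι : Type*} [Fintype ι] [DecidableEq ι] (x : ι → Y)
    (hx : ∀ φ : Y →L[ℝ] ℝ, ‖φ‖ ≤ 1 → ∑ a, φ (x a) ^ 2 ≤ 1) :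
    𝔼 ω : ι → ℤˣ, (‖∑ a, signReal (ω a) • x a‖ -
      𝔼 ω : ι → ℤˣ, ‖∑ a, signReal (ω a) • x a‖) ^ 2 ≤ 2 := by
  set f : (ι → ℤˣ) → ℝ := fun ω => ‖∑ a, signReal (ω a) • x a‖ with hf
  change 𝔼 ω, (f ω - 𝔼 ω, f ω) ^ 2 ≤ 2
  rw [expect_sq_sub_expect]
  have hsplit : ∀ i, 𝔼 ω, (f ω - f (Function.update ω i (-ω i))) ^ 2 =
      2 * 𝔼 ω, (max (f ω - f (Function.update ω i (-ω i))) 0) ^ 2 := by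
    intro i
    have h1 : ∀ ω, (f ω - f (Function.update ω i (-ω i))) ^ 2 =
        (max (f ω - f (Function.update ω i (-ω i))) 0) ^ 2 +
        (max (f (Function.update ω i (-ω i)) - f ω) 0) ^ 2 := by
      intro ω
      rcases le_total (f ω) (f (Function.update ω i (-ω i))) with h | h
      · rw [max_eq_right (by linarith), max_eq_left (by linarith)]; ring
      · rw [max_eq_left (by linarith), max_eq_right (by linarith)]; ring
    have h2 := expect_flip_signs i
      fun ω => (max (f ω - f (Function.update ω i (-ω i))) 0) ^ 2
    simp only [Function.update_idem, Function.update_self, neg_neg, Function.update_eq_self] at h2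
    simp only [h1, Finset.expect_add_distrib, h2]
    ring
  have hpt : ∀ ω, ∑ i, (max (f ω - f (Function.update ω i (-ω i))) 0) ^ 2 ≤ 4 := by
    intro ω
    obtain ⟨φ, hφ, hφv⟩ := exists_dual_vector'' ℝ (∑ a, signReal (ω a) • x a)
    rw [RCLike.ofReal_real_eq_id, id] at hφv
    have h1 : ∀ i, (max (f ω - f (Function.update ω i (-ω i))) 0) ^ 2 ≤ 4 * φ (x i) ^ 2 := by
      intro i
      have h2 : φ (∑ a, signReal (Function.update ω i (-ω i) a) • x a) ≤
          f (Function.update ω i (-ω i)) :=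
        (le_abs_self _).trans ((φ.le_opNorm _).trans
            (mul_le_of_le_one_left (norm_nonneg _) hφ))
      have h3 : φ (∑ a, signReal (ω a) • x a) -
          φ (∑ a, signReal (Function.update ω i (-ω i) a) • x a) =
          2 * signReal (ω i) * φ (x i) := by
        rw [← map_sub, ← Finset.sum_sub_distrib, Finset.sum_eq_single i]
        · simp [signReal_neg]; ring
        · intro b _ hb
          simp [hb]
        · simp
      have h4 : max (f ω - f (Function.update ω i (-ω i))) 0 ≤ |2 * signReal (ω i) * φ (x i)| := by
        refine max_le ?_ (abs_nonneg _)
        refine le_trans ?_ (le_abs_self _)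
        rw [← h3, hφv]
        linarith
      calc _ ≤ |2 * signReal (ω i) * φ (x i)| ^ 2 := by gcongr
        _ = 4 * (signReal (ω i) * signReal (ω i)) * φ (x i) ^ 2 := by rw [sq_abs]; ring
        _ = _ := by rw [signReal_mul_self]; ring
    calc _ ≤ ∑ i, 4 * φ (x i) ^ 2 := Finset.sum_le_sum fun i _ => h1 i
      _ ≤ 4 := by rw [← Finset.mul_sum]; linarith [hx φ hφ]
  have hP := poincare_signs f
  simp only [hsplit] at hP
  rw [← Finset.mul_sum, ← Finset.expect_sum_comm] at hP
  have := (Finset.expect_le_expect (s := (Finset.univ : Finset (ι → ℤˣ)))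
    fun ω _ => hpt ω).trans_eq (Fintype.expect_const _)
  linarith

/-- If `v : ℓ²ₙ → Y` has norm at most one, the weak `ℓ²` norm of its columns is at most one. -/
lemma sum_sq_dual_le_one {ι : Type*} [Fintype ι] {v : ι → Y}
    (hv : ∀ a : ι → ℝ, ‖∑ i, a i • v i‖ ≤ √(∑ i, a i ^ 2)) (φ : Y →L[ℝ] ℝ) (hφ : ‖φ‖ ≤ 1) :
    ∑ i, φ (v i) ^ 2 ≤ 1 := by
  have h1 : ∑ i, φ (v i) ^ 2 ≤ √(∑ i, φ (v i) ^ 2) := by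
    calc ∑ i, φ (v i) ^ 2 = φ (∑ i, φ (v i) • v i) := by simp [sq]
      _ ≤ ‖∑ i, φ (v i) • v i‖ := (le_abs_self _).trans ((φ.le_opNorm _).trans
            (mul_le_of_le_one_left (norm_nonneg _) hφ))
      _ ≤ _ := hv _
  have h0 : 0 ≤ ∑ i, φ (v i) ^ 2 := Finset.sum_nonneg fun _ _ => sq_nonneg _
  have h2 := Real.sq_sqrt h0
  by_contra! h
  have : 1 < √(∑ i, φ (v i) ^ 2) := by rw [Real.lt_sqrt] <;> linarith
  nlinarith

end RademacherSums

section DvoretzkyRogers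

open Matrix

variable {Y : Type*} [NormedAddCommGroup Y] [NormedSpace ℝ Y]

/-- Among the matrices `A` such that `L ∘ A` is a contraction from Euclidean space, one has
maximal determinant. -/
lemma exists_max_det {N : ℕ} (L : (Fin N → ℝ) →ₗ[ℝ] Y) (hL : Function.Injective L) :
    ∃ A : Matrix (Fin N) (Fin N) ℝ, (∀ x, ‖L (A *ᵥ x)‖ ≤ √(x ⬝ᵥ x)) ∧ 0 < A.det ∧
      ∀ B : Matrix (Fin N) (Fin N) ℝ, (∀ x, ‖L (B *ᵥ x)‖ ≤ √(x ⬝ᵥ x)) → B.det ≤ A.det := by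
  have hLc : Continuous L := L.continuous_of_finiteDimensional
  obtain ⟨K, hK, hKL⟩ := (LinearMap.injective_iff_antilipschitz L).1 hL
  let S : Set (Matrix (Fin N) (Fin N) ℝ) := {A | ∀ x, ‖L (A *ᵥ x)‖ ≤ √(x ⬝ᵥ x)}
  have hSc : IsClosed S := by
    simp only [S, Set.ofPred_forall]
    exact isClosed_iInter fun x => isClosed_le
      (hLc.comp (continuous_id.matrix_mulVec continuous_const)).norm continuous_const
  have hSb : S ⊆ Set.pi Set.univ fun _ => Set.pi Set.univ fun _ => Set.Icc (-(K : ℝ)) K := by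
    intro A hA i _ j _
    have h1 := hA (Pi.single j 1)
    have h2 := hKL.le_mul_dist (A *ᵥ Pi.single j 1) 0
    rw [map_zero, dist_zero_right, dist_zero_right] at h2
    have h3 := norm_le_pi_norm (A *ᵥ Pi.single j 1) i
    simp only [mulVec_single_one, single_one_dotProduct, Pi.single_eq_same, Real.sqrt_one,
      Real.norm_eq_abs] at h1 h2 h3
    have h4 : |A i j| ≤ K := h3.trans (h2.trans (mul_le_of_le_one_right K.2 h1))
    exact abs_le.1 h4
  have hScomp : IsCompact S :=
    (isCompact_univ_pi fun _ => isCompact_univ_pi fun _ => isCompact_Icc).of_isClosed_subset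
      hSc hSb
  let L' : (Fin N → ℝ) →L[ℝ] Y := ⟨L, hLc⟩
  let c : ℝ := (‖L'‖ + 1)⁻¹
  have hc : 0 < c := by positivity
  have hcS : c • (1 : Matrix (Fin N) (Fin N) ℝ) ∈ S := by
    intro x
    have h1 : ‖x‖ ≤ √(x ⬝ᵥ x) := by
      refine (pi_norm_le_iff_of_nonneg (Real.sqrt_nonneg _)).2 fun i => ?_
      refine Real.le_sqrt_of_sq_le ?_
      rw [Real.norm_eq_abs, sq_abs, sq]
      exact Finset.single_le_sum (f := fun i => x i * x i) (fun i _ => mul_self_nonneg _)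
        (Finset.mem_univ i)
    calc ‖L ((c • (1 : Matrix (Fin N) (Fin N) ℝ)) *ᵥ x)‖ = c * ‖L' x‖ := by
          rw [smul_mulVec, one_mulVec, map_smul, norm_smul, Real.norm_of_nonneg hc.le]; rfl
      _ ≤ c * ((‖L'‖ + 1) * ‖x‖) := by
          gcongr
          exact (L'.le_opNorm x).trans (by gcongr; linarith)
      _ = ‖x‖ := by rw [← mul_assoc, inv_mul_cancel₀ (by positivity), one_mul]
      _ ≤ _ := h1
  obtain ⟨A, hA, hmax⟩ := hScomp.exists_isMaxOn ⟨_, hcS⟩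
    (continuous_id.matrix_det.continuousOn : ContinuousOn (fun A => A.det) S)
  refine ⟨A, hA, lt_of_lt_of_le ?_ (hmax hcS), fun B hB => hmax hB⟩
  have : 0 < (c • (1 : Matrix (Fin N) (Fin N) ℝ)).det := by
    rw [det_smul, det_one, mul_one]
    positivity
  exact this

lemma exists_orthonormal_rows {N n : ℕ} (hN : N = 2 * n) (L : (Fin N → ℝ) →ₗ[ℝ] Y)
    {A : Matrix (Fin N) (Fin N) ℝ} (hA : ∀ x, ‖L (A *ᵥ x)‖ ≤ √(x ⬝ᵥ x)) (hdet : 0 < A.det)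
    (hmax : ∀ B : Matrix (Fin N) (Fin N) ℝ, (∀ x, ‖L (B *ᵥ x)‖ ≤ √(x ⬝ᵥ x)) →
      B.det ≤ A.det) (j : ℕ) (hj : j ≤ n) :
    ∃ X : Matrix (Fin j) (Fin N) ℝ, X * Xᵀ = 1 ∧ ∀ i, 1 / 2 ≤ ‖L (A *ᵥ X i)‖ := by
  induction j with
  | zero => exact ⟨0, Subsingleton.elim _ _, fun i => i.elim0⟩
  | succ j ih =>
    obtain ⟨X, hX, hXA⟩ := ih (by omega)
    by_cases hex : ∃ x : Fin N → ℝ, X *ᵥ x = 0 ∧ x ⬝ᵥ x = 1 ∧ 1 / 2 ≤ ‖L (A *ᵥ x)‖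
    · obtain ⟨x, hx0, hx1, hxA⟩ := hex
      obtain ⟨W, hW0, hWs⟩ : ∃ W : Matrix (Fin (j + 1)) (Fin N) ℝ,
          W 0 = x ∧ ∀ a : Fin j, W a.succ = X a := ⟨Fin.cons x X, rfl, fun _ => rfl⟩
      refine ⟨W, ?_, fun i => ?_⟩
      · ext a b
        have h0 : ∀ b, X b ⬝ᵥ x = 0 := fun b => congrFun hx0 b
        have h1 : ∀ a b, X a ⬝ᵥ X b = (1 : Matrix (Fin j) (Fin j) ℝ) a b := fun a b => by
          rw [← hX]; rfl
        change W a ⬝ᵥ W b = _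
        refine Fin.cases ?_ (fun a => ?_) a <;> refine Fin.cases ?_ (fun b => ?_) b
        · simp [hW0, hx1]
        · simp [hW0, hWs, dotProduct_comm x, h0, one_apply, (Fin.succ_ne_zero b).symm]
        · simp [hW0, hWs, h0, one_apply]
        · simp [hWs, h1, one_apply]
      · refine Fin.cases ?_ (fun i => ?_) i
        · rwa [hW0]
        · rw [hWs]; exact hXA i
    · exfalso
      push Not at hex
      have horth : ∀ x, X *ᵥ x = 0 → ‖L (A *ᵥ x)‖ ≤ 1 / 2 * √(x ⬝ᵥ x) := by
        intro x hx
        have hxx : 0 ≤ x ⬝ᵥ x := Finset.sum_nonneg fun i _ => mul_self_nonneg (x i)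
        rcases hxx.eq_or_lt with h | h
        · simpa [← h] using hA x
        · have hs : 0 < √(x ⬝ᵥ x) := Real.sqrt_pos.2 h
          have := hex ((√(x ⬝ᵥ x))⁻¹ • x) (by rw [mulVec_smul, hx, smul_zero]) (by
            rw [smul_dotProduct, dotProduct_smul, smul_eq_mul, smul_eq_mul, ← mul_assoc,
              ← mul_inv, Real.mul_self_sqrt hxx, inv_mul_cancel₀ h.ne'])
          rw [mulVec_smul, map_smul, norm_smul, Real.norm_of_nonneg (by positivity),
            inv_mul_lt_iff₀ hs] at this
          linarith
      have hB := hmax (√2 • (A * (1 - (1 / 2 : ℝ) • (Xᵀ * X)))) fun x => by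
        set x1 := (Xᵀ * X) *ᵥ x with hx1
        set x2 := x - x1 with hx2
        have hX2 : X *ᵥ x2 = 0 := by
          rw [hx2, hx1, mulVec_sub, mulVec_mulVec, ← Matrix.mul_assoc, hX, Matrix.one_mul, sub_self]
        have h12 : x1 ⬝ᵥ x2 = 0 := by
          rw [hx1, ← mulVec_mulVec, mulVec_transpose, ← dotProduct_mulVec, hX2, dotProduct_zero]
        have hxx : x ⬝ᵥ x = x1 ⬝ᵥ x1 + x2 ⬝ᵥ x2 := by
          have : x = x1 + x2 := by rw [hx2]; abel
          conv_lhs => rw [this]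
          simp only [add_dotProduct, dotProduct_add, h12, dotProduct_comm x2 x1]
          ring
        have hval : (√2 • (A * (1 - (1 / 2 : ℝ) • (Xᵀ * X)))) *ᵥ x =
            √2 • ((1 / 2 : ℝ) • (A *ᵥ x1) + A *ᵥ x2) := by
          rw [smul_mulVec, ← mulVec_mulVec, sub_mulVec, one_mulVec, smul_mulVec, ← hx1,
            ← mulVec_smul A (1 / 2 : ℝ), ← mulVec_add]
          congr 2
          rw [hx2]
          module
        have n1 : 0 ≤ x1 ⬝ᵥ x1 := Finset.sum_nonneg fun i _ => mul_self_nonneg (x1 i)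
        have n2 : 0 ≤ x2 ⬝ᵥ x2 := Finset.sum_nonneg fun i _ => mul_self_nonneg (x2 i)
        rw [hval, map_smul, map_add, map_smul, norm_smul, Real.norm_of_nonneg (Real.sqrt_nonneg 2)]
        have h3 : ‖(1 / 2 : ℝ) • L (A *ᵥ x1) + L (A *ᵥ x2)‖ ≤
            1 / 2 * (√(x1 ⬝ᵥ x1) + √(x2 ⬝ᵥ x2)) := by
          refine (norm_add_le _ _).trans ?_
          rw [norm_smul, Real.norm_of_nonneg (by norm_num)]
          linarith [hA x1, horth x2 hX2]
        refine (mul_le_mul_of_nonneg_left h3 (Real.sqrt_nonneg 2)).trans ?_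
        refine Real.le_sqrt_of_sq_le ?_
        rw [hxx]
        have e1 := Real.sq_sqrt n1
        have e2 := Real.sq_sqrt n2
        have e3 := Real.sq_sqrt (show (0 : ℝ) ≤ 2 by norm_num)
        rw [mul_pow, e3]
        nlinarith [sq_nonneg (√(x1 ⬝ᵥ x1) - √(x2 ⬝ᵥ x2))]
      have hd : (1 - (1 / 2 : ℝ) • (Xᵀ * X)).det = (1 / 2) ^ j := by
        rw [← Matrix.smul_mul, det_one_sub_mul_comm, Matrix.mul_smul, hX,
          show (1 : Matrix (Fin j) (Fin j) ℝ) - (1 / 2 : ℝ) • 1 = (1 / 2 : ℝ) • 1 by module,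
          det_smul, det_one, mul_one, Fintype.card_fin]
      have hp : √2 ^ N = 2 ^ n := by
        rw [hN, pow_mul, Real.sq_sqrt (show (0 : ℝ) ≤ 2 by norm_num)]
      rw [det_smul, det_mul, hd, Fintype.card_fin, hp] at hB
      have hlt : (1 : ℝ) < 2 ^ n * (1 / 2) ^ j := by
        rw [one_div, inv_pow, ← div_eq_mul_inv, one_lt_div (by positivity)]
        exact pow_lt_pow_right₀ (by norm_num) (by omega)
      nlinarith

/-- The Dvoretzky–Rogers lemma. -/
lemma dvoretzky_rogers (hY : ¬ FiniteDimensional ℝ Y) (n : ℕ) :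
    ∃ v : Fin n → Y, (∀ i, 1 / 2 ≤ ‖v i‖) ∧
      ∀ a : Fin n → ℝ, ‖∑ i, a i • v i‖ ≤ √(∑ i, a i ^ 2) := by
  have hr : ((2 * n : ℕ) : Cardinal) ≤ Module.rank ℝ Y := by
    refine Cardinal.natCast_lt_aleph0.le.trans ?_
    rwa [← not_lt, Module.rank_lt_aleph0_iff]
  obtain ⟨s, hs, hli⟩ := le_rank_iff_exists_linearIndependent_finset.1 hr
  let y : Fin (2 * n) → Y := fun i => (s.equivFinOfCardEq hs).symm i
  have hy : LinearIndependent ℝ y := hli.comp _ (Equiv.injective _)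
  let L := Fintype.linearCombination ℝ y
  have hL : Function.Injective L := hy.fintypeLinearCombination_injective
  obtain ⟨A, hA, hdet, hmax⟩ := exists_max_det L hL
  obtain ⟨X, hX, hXA⟩ := exists_orthonormal_rows rfl L hA hdet hmax n le_rfl
  refine ⟨fun i => L (A *ᵥ X i), hXA, fun a => ?_⟩
  have h1 : ∑ i, a i • L (A *ᵥ X i) = L (A *ᵥ (a ᵥ* X)) := by
    rw [vecMul_eq_sum, mulVec_sum, map_sum]
    simp [mulVec_smul]
  have h2 : (a ᵥ* X) ⬝ᵥ (a ᵥ* X) = ∑ i, a i ^ 2 := by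
    rw [← dotProduct_mulVec, ← mulVec_transpose, mulVec_mulVec, hX, one_mulVec]
    simp [dotProduct, sq]
  rw [h1, ← h2]
  exact hA _

end DvoretzkyRogers

section Dvoretzky

variable {Y : Type*} [NormedAddCommGroup Y] [NormedSpace ℝ Y]

/-- The average norm of `∑ᵢ ξᵢ vᵢ` for independent copies `ξᵢ` of the Rademacher sum with
coefficients `c`. -/
noncomputable def radAverage {n N : ℕ} (v : Fin n → Y) (c : Fin N → ℝ) : ℝ :=
  𝔼 ω : Fin n × Fin N → ℤˣ, ‖∑ p, signReal (ω p) • c p.2 • v p.1‖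

lemma radAverage_le {n N : ℕ} (v : Fin n → Y) (c : Fin N → ℝ) (hc : ∑ b, c b ^ 2 = 1) :
    radAverage v c ≤ ∑ i, ‖v i‖ := by
  have h1 : ∀ ω : Fin n × Fin N → ℤˣ, ‖∑ p, signReal (ω p) • c p.2 • v p.1‖ ≤
      ∑ i, (1 + (∑ b, signReal (ω (i, b)) * c b) ^ 2) / 2 * ‖v i‖ := by
    intro ω
    rw [Fintype.sum_prod_type]
    refine (norm_sum_le _ _).trans (Finset.sum_le_sum fun i _ => ?_)
    simp only [smul_smul]
    rw [← Finset.sum_smul, norm_smul, Real.norm_eq_abs]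
    gcongr
    set x := ∑ b, signReal (ω (i, b)) * c b
    nlinarith [sq_nonneg (|x| - 1), sq_abs x]
  refine (Finset.expect_le_expect fun ω _ => h1 ω).trans_eq ?_
  rw [Finset.expect_sum_comm]
  refine Finset.sum_congr rfl fun i _ => ?_
  rw [← Finset.expect_mul, ← Finset.expect_div, Finset.expect_add_distrib, Fintype.expect_const,
    expect_row_signs i fun ζ => (∑ b, signReal (ζ b) * c b) ^ 2, (moments_signs c).1, hc]
  ring

lemma expect_norm_reindex {ι κ : Type*} [Fintype ι] [Fintype κ] [DecidableEq ι] [DecidableEq κ]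
    (e : ι ≃ κ) (x : κ → Y) :
    𝔼 ω : ι → ℤˣ, ‖∑ i, signReal (ω i) • x (e i)‖ =
      𝔼 ω : κ → ℤˣ, ‖∑ j, signReal (ω j) • x j‖ := by
  refine Fintype.expect_equiv (Equiv.arrowCongr e (Equiv.refl _)) _ _ fun ω => ?_
  congr 1
  exact Fintype.sum_equiv e _ _ fun i => by simp

/-- The Rademacher averages of long sequences of vectors of norm at least `1/2` are large. -/
lemma exists_radAverage_ge (m : ℕ) (hm : 0 < m) : ∃ n : ℕ, ∀ v : Fin n → Y,
    (∀ i, 1 / 2 ≤ ‖v i‖) → √m / 4 ≤ radAverage v (fun _ : Fin m => (√m)⁻¹) := by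
  classical
  let g : (Fin m → ℤˣ) → ℝ := fun ζ => if ζ = 1 then 0 else 1
  have hg : 𝔼 ζ, g ζ < 1 := by
    rw [← Fintype.expect_one (ι := Fin m → ℤˣ) (M := ℝ), Fintype.expect_eq_sum_div_card,
      Fintype.expect_eq_sum_div_card]
    refine div_lt_div_of_pos_right ?_ (by positivity)
    exact Finset.sum_lt_sum (fun ζ _ => by simp only [g]; split_ifs <;> norm_num)
      ⟨1, Finset.mem_univ _, by simp [g]⟩
  have hg0 : 0 ≤ 𝔼 ζ, g ζ := Finset.expect_nonneg fun ζ _ => by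
    simp only [g]; split_ifs <;> norm_num
  obtain ⟨n, hn⟩ := exists_pow_lt_of_lt_one (show (0 : ℝ) < 1 / 2 by norm_num) hg
  refine ⟨n, fun v hv => ?_⟩
  rw [radAverage, expect_norm_sum_prod (fun _ : Fin m => (√(m : ℝ))⁻¹) v]
  have hm' : 0 < √(m : ℝ) := Real.sqrt_pos.2 (by exact_mod_cast hm)
  have h1 : ∀ ω : Fin n × Fin m → ℤˣ, √m / 2 * (1 - ∏ i, g fun b => ω (i, b)) ≤
      𝔼 η : Fin n → ℤˣ,
        ‖∑ a, signReal (η a) • (∑ b, signReal (ω (a, b)) * (√(m : ℝ))⁻¹) • v a‖ := by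
    intro ω
    by_cases h : ∃ i, (fun b => ω (i, b)) = 1
    · obtain ⟨i, hi⟩ := h
      rw [Finset.prod_eq_zero (Finset.mem_univ i) (by simp [g, hi])]
      refine le_trans ?_ (norm_le_expect_norm _ i)
      have h2 : ∑ b, signReal (ω (i, b)) * (√(m : ℝ))⁻¹ = √m := by
        have : ∀ b, ω (i, b) = 1 := fun b => congrFun hi b
        simp only [this, signReal_one, one_mul, Finset.sum_const, Finset.card_univ,
          Fintype.card_fin, nsmul_eq_mul]
        rw [← div_eq_mul_inv, Real.div_sqrt]
      rw [h2, norm_smul, Real.norm_of_nonneg hm'.le]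
      nlinarith [hv i]
    · push Not at h
      rw [Finset.prod_eq_one fun i _ => by simp [g, h i]]
      simp only [sub_self, mul_zero]
      exact Finset.expect_nonneg fun _ _ => norm_nonneg _
  refine le_trans ?_ (Finset.expect_le_expect fun ω _ => h1 ω)
  rw [← Finset.mul_expect, Finset.expect_sub_distrib, Fintype.expect_const]
  have h2 : 𝔼 ω : Fin n × Fin m → ℤˣ, ∏ i, g (fun b => ω (i, b)) = (𝔼 ζ, g ζ) ^ n := by
    rw [Finset.expect_pow, Fintype.piFinset_univ]
    exact Fintype.expect_equiv (Equiv.curry _ _ _) _ _ fun _ => rfl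
  rw [h2]
  nlinarith

lemma exists_near_maximal_radAverage {n m : ℕ} (v : Fin n → Y) (c₀ : Fin m → ℝ)
    (hc₀ : ∑ b, c₀ b ^ 2 = 1) (hpos : 0 < radAverage v c₀) :
    ∃ (N : ℕ) (c : Fin N → ℝ), ∑ b, c b ^ 2 = 1 ∧ radAverage v c₀ ≤ 2 * radAverage v c ∧
      ∀ (N' : ℕ) (c' : Fin N' → ℝ), ∑ b, c' b ^ 2 = 1 →
        radAverage v c' ≤ 2 * radAverage v c := by
  let S : Set ℝ := {r | ∃ (N : ℕ) (c : Fin N → ℝ), ∑ b, c b ^ 2 = 1 ∧ r = radAverage v c}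
  have hb : BddAbove S := ⟨∑ i, ‖v i‖, by
    rintro _ ⟨N, c, hc, rfl⟩
    exact radAverage_le v c hc⟩
  have h0 : radAverage v c₀ ≤ sSup S := le_csSup hb ⟨m, c₀, hc₀, rfl⟩
  obtain ⟨_, ⟨N, c, hc, rfl⟩, hlt⟩ := exists_lt_of_lt_csSup (s := S) (b := sSup S / 2)
    ⟨_, m, c₀, hc₀, rfl⟩ (by linarith)
  refine ⟨N, c, hc, by linarith, fun N' c' hc' => ?_⟩
  linarith [le_csSup hb ⟨N', c', hc', rfl⟩]

/-- A linear map which is bounded above and below on a `1/10`-net of the unit sphere is bounded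
above and below. -/
lemma norm_bounds_of_net {E : Type*} [NormedAddCommGroup E] [NormedSpace ℝ E]
    (U : E →L[ℝ] Y) {T : Set E} {A : ℝ} (hA : 0 ≤ A)
    (hnet : ∀ x : E, ‖x‖ = 1 → ∃ t ∈ T, ‖x - t‖ ≤ 1 / 10)
    (hT : ∀ t ∈ T, A / 2 ≤ ‖U t‖ ∧ ‖U t‖ ≤ 21 / 10 * A) (x : E) :
    A / 4 * ‖x‖ ≤ ‖U x‖ ∧ ‖U x‖ ≤ 5 / 2 * A * ‖x‖ := by
  have happ : ∀ x : E, ‖x‖ = 1 → ∃ t ∈ T, ‖U (x - t)‖ ≤ ‖U‖ / 10 := by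
    intro x hx
    obtain ⟨t, ht, hxt⟩ := hnet x hx
    exact ⟨t, ht, (U.le_opNorm _).trans (by nlinarith [norm_nonneg U])⟩
  have hU : ‖U‖ ≤ 21 / 10 * A + ‖U‖ / 10 := by
    refine ContinuousLinearMap.opNorm_le_of_unit_norm (by positivity) fun x hx => ?_
    obtain ⟨t, ht, hxt⟩ := happ x hx
    have := norm_add_le (U t) (U (x - t))
    rw [← map_add, add_sub_cancel] at this
    linarith [(hT t ht).2]
  refine ⟨?_, (U.le_opNorm x).trans (by gcongr; linarith)⟩
  rcases eq_or_ne x 0 with rfl | hx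
  · simp
  have hx' : 0 < ‖x‖ := norm_pos_iff.2 hx
  have h1 : ‖(‖x‖⁻¹ • x)‖ = 1 := norm_smul_inv_norm hx
  obtain ⟨t, ht, hxt⟩ := happ _ h1
  have h2 : A / 4 ≤ ‖U (‖x‖⁻¹ • x)‖ := by
    have := norm_sub_le (U (‖x‖⁻¹ • x)) (U (‖x‖⁻¹ • x - t))
    rw [← map_sub, sub_sub_cancel] at this
    linarith [(hT t ht).1]
  rw [map_smul, norm_smul, norm_inv, norm_norm, inv_mul_eq_div, le_div_iff₀ hx'] at h2
  exact h2

/-- Infinite-dimensional normed spaces contain uniformly isomorphic copies of `ℓ²ₖ` for all `k`,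
a weak form of Dvoretzky's theorem. -/
theorem weak_dvoretzky (hY : ¬ FiniteDimensional ℝ Y) (k : ℕ) :
    ∃ U : EuclideanSpace ℝ (Fin k) →ₗ[ℝ] Y, ∀ t, ‖t‖ ≤ ‖U t‖ ∧ ‖U t‖ ≤ 10 * ‖t‖ := by
  obtain ⟨T, hTs, hTf, hTc⟩ := (isCompact_sphere (0 : EuclideanSpace ℝ (Fin k)) 1).finite_cover_balls
    (e := 1 / 10) (by norm_num)
  lift T to Finset (EuclideanSpace ℝ (Fin k)) using hTf
  obtain ⟨m, hm⟩ := exists_nat_gt (max 1 ((144 * √(2 * T.card)) ^ 2))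
  have hm1 : (1 : ℝ) < m := (le_max_left _ _).trans_lt hm
  have hm0 : 0 < m := by exact_mod_cast zero_lt_one.trans hm1
  obtain ⟨n, hn⟩ := exists_radAverage_ge (Y := Y) m hm0
  obtain ⟨v, hv1, hv2⟩ := dvoretzky_rogers hY n
  have hsm : 0 < √(m : ℝ) := Real.sqrt_pos.2 (by linarith)
  have hc₀ : ∑ _b : Fin m, ((√(m : ℝ))⁻¹) ^ 2 = 1 := by
    rw [Finset.sum_const, Finset.card_univ, Fintype.card_fin, nsmul_eq_mul, inv_pow,
      Real.sq_sqrt (by linarith), mul_inv_cancel₀ (by linarith)]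
  have hlarge := hn v hv1
  obtain ⟨N, c, hc, hA₀, hmax⟩ := exists_near_maximal_radAverage v _ hc₀ (by linarith)
  set A := radAverage v c with hAdef
  have hA : 0 < A := by linarith
  have hTA : √(2 * T.card) ≤ A / 18 := by
    have : 144 * √(2 * T.card) ≤ √m :=
      Real.le_sqrt_of_sq_le ((le_max_right _ _).trans hm.le)
    linarith
  let w : Fin n × Fin N → Y := fun q => c q.2 • v q.1
  let x : EuclideanSpace ℝ (Fin k) → (Fin n × Fin N) × Fin k → Y := fun t p => t p.2 • w p.1
  let avg : EuclideanSpace ℝ (Fin k) → ℝ := fun t =>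
    𝔼 ω : (Fin n × Fin N) × Fin k → ℤˣ, ‖∑ p, signReal (ω p) • x t p‖
  have hsq : ∀ t ∈ T, ∑ b, t b ^ 2 = 1 := by
    intro t ht
    have : ‖t‖ = 1 := by simpa using hTs ht
    rw [← EuclideanSpace.real_norm_sq_eq, this, one_pow]
  have hlow : ∀ t ∈ T, 5 / 9 * A ≤ avg t := by
    intro t ht
    refine le_trans ?_ (expect_abs_mul_expect_norm_le (fun b => t b) w)
    exact mul_le_mul_of_nonneg_right (khintchine_signs _ (hsq t ht)) hA.le
  have hupp : ∀ t ∈ T, avg t ≤ 2 * A := by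
    intro t ht
    obtain ⟨e⟩ : Nonempty (Fin N × Fin k ≃ Fin (N * k)) := ⟨finProdFinEquiv⟩
    let c' : Fin (N * k) → ℝ := fun j => t (e.symm j).2 * c (e.symm j).1
    have hc' : ∑ b, c' b ^ 2 = 1 := by
      rw [← Fintype.sum_equiv e (fun q => (t q.2 * c q.1) ^ 2) (fun b => c' b ^ 2)
        (fun q => by simp [c']), Fintype.sum_prod_type_right]
      simp only [mul_pow, ← Finset.mul_sum, hc, mul_one, hsq t ht]
    refine le_of_eq_of_le ?_ (hmax _ c' hc')
    rw [radAverage, ← expect_norm_reindex ((Equiv.prodAssoc _ _ _).trans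
      (Equiv.prodCongr (Equiv.refl (Fin n)) e))]
    simp [avg, x, w, c', smul_smul, mul_comm]
  have hvar : ∀ t ∈ T, 𝔼 ω : (Fin n × Fin N) × Fin k → ℤˣ, (‖∑ p, signReal (ω p) • x t p‖ -
      avg t) ^ 2 ≤ 2 := by
    intro t ht
    refine variance_norm_le _ fun φ hφ => ?_
    have h1 := sum_sq_dual_le_one hv2 φ hφ
    have : ∑ a, φ (x t a) ^ 2 = (∑ b, t b ^ 2) * ((∑ b, c b ^ 2) * ∑ i, φ (v i) ^ 2) := by
      simp only [x, w, map_smul, smul_eq_mul, mul_pow]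
      rw [Fintype.sum_prod_type_right, Finset.sum_mul]
      refine Finset.sum_congr rfl fun b _ => ?_
      simp only [← Finset.mul_sum]
      rw [Fintype.sum_prod_type_right, Finset.sum_mul]
      simp only [← Finset.mul_sum]
    rw [this, hsq t ht, hc]
    linarith
  obtain ⟨ω, -, hω⟩ := Finset.exists_le_of_expect_le (s := Finset.univ)
    (f := fun ω : (Fin n × Fin N) × Fin k → ℤˣ => ∑ t ∈ T, (‖∑ p, signReal (ω p) • x t p‖ -
      avg t) ^ 2) (a := 2 * (T.card : ℝ)) Finset.univ_nonempty (by
    rw [Finset.expect_sum_comm]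
    refine (Finset.sum_le_sum hvar).trans_eq ?_
    rw [Finset.sum_const, nsmul_eq_mul, mul_comm])
  let U : EuclideanSpace ℝ (Fin k) →ₗ[ℝ] Y :=
    { toFun := fun t => ∑ p, signReal (ω p) • x t p
      map_add' := fun s t => by
        simp only [x, PiLp.add_apply, add_smul, smul_add, Finset.sum_add_distrib]
      map_smul' := fun r t => by
        simp only [x, PiLp.smul_apply, smul_eq_mul, RingHom.id_apply, Finset.smul_sum]
        exact Finset.sum_congr rfl fun p _ => by rw [mul_smul, smul_comm r (signReal _)] }
  have hnear : ∀ t ∈ T, |‖U t‖ - avg t| ≤ A / 18 := by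
    intro t ht
    refine (Real.abs_le_sqrt ?_).trans hTA
    exact (Finset.single_le_sum (f := fun t => (‖∑ p, signReal (ω p) • x t p‖ -
      avg t) ^ 2) (fun t _ => sq_nonneg _) ht).trans hω
  have hbd := norm_bounds_of_net (LinearMap.toContinuousLinearMap U) (T := T) hA.le
    (fun y hy => by
      obtain ⟨t, ht, hyt⟩ := Set.mem_iUnion₂.1 (hTc (show y ∈ Metric.sphere 0 1 by simpa using hy))
      exact ⟨t, ht, by simpa [dist_eq_norm] using (Metric.mem_ball.1 hyt).le⟩)
    (fun t ht => by
      have h1 := abs_le.1 (hnear t ht)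
      have h2 := hlow t ht
      have h3 := hupp t ht
      simp only [LinearMap.coe_toContinuousLinearMap']
      constructor <;> linarith)
  refine ⟨(4 / A) • U, fun t => ?_⟩
  obtain ⟨h1, h2⟩ := hbd t
  simp only [LinearMap.coe_toContinuousLinearMap'] at h1 h2
  rw [LinearMap.smul_apply, norm_smul, Real.norm_of_nonneg (by positivity)]
  constructor
  · calc ‖t‖ = 4 / A * (A / 4 * ‖t‖) := by field_simp
      _ ≤ _ := by gcongr
  · calc 4 / A * ‖U t‖ ≤ 4 / A * (5 / 2 * A * ‖t‖) := by gcongr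
      _ = _ := by field_simp; ring

end Dvoretzky

section Localization

/-- The Banach–Mazur distance from `E` to a finite-dimensional Euclidean space is at most `C`. -/
def EuclideanBound (E : Type*) [NormedAddCommGroup E] [NormedSpace ℝ E] (C : ℝ) : Prop :=
  ∃ (k : ℕ) (T : E →ₗ[ℝ] EuclideanSpace ℝ (Fin k)), ∀ x, ‖x‖ ≤ ‖T x‖ ∧ ‖T x‖ ≤ C * ‖x‖

lemma exists_euclideanBound (E : Type*) [NormedAddCommGroup E] [NormedSpace ℝ E]
    [FiniteDimensional ℝ E] : ∃ C, 0 < C ∧ EuclideanBound E C := by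
  let e : E ≃L[ℝ] EuclideanSpace ℝ (Fin (Module.finrank ℝ E)) := toEuclidean
  let a := ‖(e.symm : EuclideanSpace ℝ (Fin (Module.finrank ℝ E)) →L[ℝ] E)‖
  let b := ‖(e : E →L[ℝ] EuclideanSpace ℝ (Fin (Module.finrank ℝ E)))‖
  have ha : 0 ≤ a := norm_nonneg _
  refine ⟨a * b + 1, by positivity, _, a • e.toLinearMap, fun x => ?_⟩
  have h1 : ‖x‖ ≤ a * ‖e x‖ := by
    simpa using (e.symm : EuclideanSpace ℝ (Fin (Module.finrank ℝ E)) →L[ℝ] E).le_opNorm (e x)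
  have h2 : ‖e x‖ ≤ b * ‖x‖ := 
    (e : E →L[ℝ] EuclideanSpace ℝ (Fin (Module.finrank ℝ E))).le_opNorm x
  have h3 : ‖(a • e.toLinearMap) x‖ = a * ‖e x‖ := by
    simp [norm_smul, abs_of_nonneg ha]
  rw [h3]
  refine ⟨h1, ?_⟩
  nlinarith [norm_nonneg x, mul_le_mul_of_nonneg_left h2 ha]

open Filter Topology in
/-- A normed space whose finite-dimensional subspaces are uniformly Euclidean is Hilbertian. -/
lemma isomorphicToHilbert_of_forall_euclideanBound (Y : Type*) [NormedAddCommGroup Y]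
    [NormedSpace ℝ Y] (C : ℝ)
    (hC : ∀ E : Submodule ℝ Y, FiniteDimensional ℝ E → EuclideanBound E C) :
    IsomorphicToHilbert Y := by
  classical
  choose k T hT using fun F : Finset Y => hC (Submodule.span ℝ (F : Set Y)) inferInstance
  let g : Finset Y → Y → Y → ℝ := fun F x y =>
    if h : x ∈ Submodule.span ℝ (F : Set Y) ∧ y ∈ Submodule.span ℝ (F : Set Y) then
      inner ℝ (T F ⟨x, h.1⟩) (T F ⟨y, h.2⟩) else 0
  have hgv : ∀ (F : Finset Y) x y (hx : x ∈ Submodule.span ℝ (F : Set Y))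
      (hy : y ∈ Submodule.span ℝ (F : Set Y)),
      g F x y = inner ℝ (T F ⟨x, hx⟩) (T F ⟨y, hy⟩) := fun F x y hx hy => dif_pos ⟨hx, hy⟩
  have hgb : ∀ x y F, |g F x y| ≤ (|C| * ‖x‖) * (|C| * ‖y‖) := by
    intro x y F
    by_cases h : x ∈ Submodule.span ℝ (F : Set Y) ∧ y ∈ Submodule.span ℝ (F : Set Y)
    · rw [hgv F x y h.1 h.2]
      refine (abs_real_inner_le_norm _ _).trans ?_
      gcongr
      · exact (hT F _).2.trans (mul_le_mul_of_nonneg_right (le_abs_self C) (norm_nonneg _))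
      · exact (hT F _).2.trans (mul_le_mul_of_nonneg_right (le_abs_self C) (norm_nonneg _))
    · simp only [g, dif_neg h, abs_zero]
      positivity
  let U : Ultrafilter (Finset Y) := Ultrafilter.of atTop
  have hlim : ∀ x y, ∃ r, Tendsto (fun F => g F x y) U (𝓝 r) := by
    intro x y
    obtain ⟨r, -, hr⟩ := (isCompact_Icc (a := -((|C| * ‖x‖) * (|C| * ‖y‖)))
      (b := (|C| * ‖x‖) * (|C| * ‖y‖))).ultrafilter_le_nhds (U.map fun F => g F x y)
      (le_principal_iff.2 (Filter.mem_map.2 (Filter.univ_mem' fun F => abs_le.1 (hgb x y F))))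
    exact ⟨r, hr⟩
  choose f hf using hlim
  have hmem : ∀ x : Y, ∀ᶠ F : Finset Y in (U : Filter (Finset Y)), x ∈ Submodule.span ℝ (F : Set Y) := by
    intro x
    have h : ∀ᶠ F : Finset Y in (atTop : Filter (Finset Y)), x ∈ Submodule.span ℝ (F : Set Y) := by
      filter_upwards [eventually_ge_atTop {x}] with F hF
      exact Submodule.subset_span (by simpa using hF)
    exact Ultrafilter.of_le _ h
  have hdiag : ∀ x, ∀ᶠ F : Finset Y in (U : Filter (Finset Y)),
      ‖x‖ ^ 2 ≤ g F x x ∧ g F x x ≤ (|C| + 1) ^ 2 * ‖x‖ ^ 2 := by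
    intro x
    filter_upwards [hmem x] with F hx
    rw [hgv F x x hx hx, real_inner_self_eq_norm_sq, ← mul_pow]
    have h1 := (hT F ⟨x, hx⟩).1
    have h2 := (hT F ⟨x, hx⟩).2
    rw [Submodule.coe_norm] at h1 h2
    have h3 : ‖T F ⟨x, hx⟩‖ ≤ (|C| + 1) * ‖x‖ := h2.trans
      (mul_le_mul_of_nonneg_right (by linarith [le_abs_self C]) (norm_nonneg x))
    exact ⟨pow_le_pow_left₀ (norm_nonneg _) h1 2, pow_le_pow_left₀ (norm_nonneg _) h3 2⟩
  have hlow : ∀ x, ‖x‖ ^ 2 ≤ f x x := fun x =>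
    ge_of_tendsto (hf x x) ((hdiag x).mono fun F h => h.1)
  refine ⟨f, ⟨fun x y => ?_, fun a x y => ?_, fun x y z => ?_, fun x hx => ?_⟩, 1, (|C| + 1) ^ 2,
    one_pos, by positivity, fun x => ⟨by simpa using hlow x,
      le_of_tendsto (hf x x) ((hdiag x).mono fun F h => h.2)⟩⟩
  · refine tendsto_nhds_unique_of_eventuallyEq (hf x y) (hf y x) ?_
    filter_upwards [hmem x, hmem y] with F hx hy
    rw [hgv F x y hx hy, hgv F y x hy hx, real_inner_comm]
  · refine tendsto_nhds_unique_of_eventuallyEq (hf (a • x) y) ((hf x y).const_mul a) ?_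
    filter_upwards [hmem x, hmem y] with F hx hy
    rw [hgv F x y hx hy, hgv F _ y (Submodule.smul_mem _ a hx) hy, ← real_inner_smul_left,
      ← map_smul]
    rfl
  · refine tendsto_nhds_unique_of_eventuallyEq (hf (x + y) z) ((hf x z).add (hf y z)) ?_
    filter_upwards [hmem x, hmem y, hmem z] with F hx hy hz
    rw [hgv F x z hx hz, hgv F y z hy hz, hgv F _ z (Submodule.add_mem _ hx hy) hz,
      ← inner_add_left, ← map_add]
    rfl
  · exact lt_of_lt_of_le (by positivity) (hlow x)

lemma isomorphicToHilbert_of_finiteDimensional_quotient {Y : Type*} [NormedAddCommGroup Y]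
    [NormedSpace ℝ Y] (W : Submodule ℝ Y) (hW : IsClosed (W : Set Y))
    [FiniteDimensional ℝ (Y ⧸ W)] (h : IsomorphicToHilbert W) : IsomorphicToHilbert Y := by
  obtain ⟨p, hp⟩ := Submodule.ClosedComplemented.of_finiteDimensional_quotient hW
  obtain ⟨f, ⟨f_symm, f_smul, f_add, f_pos⟩, a, b, ha, hb, hf⟩ := h
  let q : Y →L[ℝ] Y := ContinuousLinearMap.id ℝ Y - W.subtypeL ∘L p
  have hq : W ≤ LinearMap.ker (q : Y →ₗ[ℝ] Y) := fun w hw => by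
    simp [q, hp ⟨w, hw⟩]
  have : FiniteDimensional ℝ (LinearMap.range (q : Y →ₗ[ℝ] Y)) := by
    rw [← Submodule.range_liftQ W (q : Y →ₗ[ℝ] Y) hq]
    infer_instance
  obtain ⟨C, hC, k, T, hT⟩ := exists_euclideanBound (LinearMap.range (q : Y →ₗ[ℝ] Y))
  let S : Y →ₗ[ℝ] EuclideanSpace ℝ (Fin k) := T ∘ₗ (q : Y →ₗ[ℝ] Y).rangeRestrict
  have hS1 : ∀ x, ‖q x‖ ≤ ‖S x‖ := fun x => (hT ((q : Y →ₗ[ℝ] Y).rangeRestrict x)).1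
  have hS2 : ∀ x, ‖S x‖ ≤ C * ‖q x‖ := fun x => (hT ((q : Y →ₗ[ℝ] Y).rangeRestrict x)).2
  have hpq : ∀ x, x = p x + q x := fun x => by simp [q]
  have hlow : ∀ x, min a 1 / 2 * ‖x‖ ^ 2 ≤ f (p x) (p x) + inner ℝ (S x) (S x) := by
    intro x
    rw [real_inner_self_eq_norm_sq]
    have h1 : ‖x‖ ≤ ‖p x‖ + ‖S x‖ := by
      conv_lhs => rw [hpq x]
      exact (norm_add_le _ _).trans (add_le_add le_rfl (hS1 x))
    have h2 : ‖x‖ ^ 2 ≤ 2 * (‖p x‖ ^ 2 + ‖S x‖ ^ 2) :=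
      (pow_le_pow_left₀ (norm_nonneg x) h1 2).trans (by nlinarith [sq_nonneg (‖p x‖ - ‖S x‖)])
    have h3 : 0 < min a 1 := lt_min ha one_pos
    have h4 := (hf (p x)).1
    have h5 : min a 1 * ‖p x‖ ^ 2 ≤ a * ‖p x‖ ^ 2 := by gcongr; exact min_le_left _ _
    have h6 : min a 1 * ‖S x‖ ^ 2 ≤ 1 * ‖S x‖ ^ 2 := by gcongr; exact min_le_right _ _
    nlinarith
  refine ⟨fun x y => f (p x) (p y) + inner ℝ (S x) (S y), ⟨fun x y => ?_, fun r x y => ?_,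
    fun x y z => ?_, fun x hx => ?_⟩, min a 1 / 2, b * ‖p‖ ^ 2 + (C * ‖q‖) ^ 2 + 1, by positivity,
    by positivity, fun x => ⟨hlow x, ?_⟩⟩
  · dsimp only
    rw [f_symm, real_inner_comm]
  · dsimp only
    rw [map_smul, map_smul, f_smul, real_inner_smul_left, mul_add]
  · dsimp only
    rw [map_add, map_add, f_add, inner_add_left]
    ring
  · exact lt_of_lt_of_le (by positivity) (hlow x)
  · dsimp only
    rw [real_inner_self_eq_norm_sq]
    have h1 : f (p x) (p x) ≤ b * (‖p‖ * ‖x‖) ^ 2 :=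
      (hf _).2.trans (by gcongr; exact p.le_opNorm x)
    have h2 : ‖S x‖ ^ 2 ≤ (C * (‖q‖ * ‖x‖)) ^ 2 := by
      gcongr
      exact (hS2 x).trans (by gcongr; exact q.le_opNorm x)
    nlinarith [sq_nonneg ‖x‖]

end Localization

section Construction

lemma EuclideanBound.mono {E : Type*} [NormedAddCommGroup E] [NormedSpace ℝ E] {C D : ℝ}
    (h : EuclideanBound E C) (hCD : C ≤ D) : EuclideanBound E D := by
  obtain ⟨k, T, hT⟩ := h
  exact ⟨k, T, fun x => ⟨(hT x).1, (hT x).2.trans (by gcongr)⟩⟩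

lemma EuclideanBound.of_linearIsometry {E F : Type*} [NormedAddCommGroup E] [NormedSpace ℝ E]
    [NormedAddCommGroup F] [NormedSpace ℝ F] {C : ℝ} (h : EuclideanBound F C) (e : E →ₗᵢ[ℝ] F) :
    EuclideanBound E C := by
  obtain ⟨k, T, hT⟩ := h
  exact ⟨k, T ∘ₗ e.toLinearMap, fun x => by simpa using hT (e x)⟩

variable {Y : Type*} [NormedAddCommGroup Y] [NormedSpace ℝ Y]

lemma isomorphicToHilbert_of_finiteDimensional [FiniteDimensional ℝ Y] :
    IsomorphicToHilbert Y := by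
  obtain ⟨C, -, hC⟩ := exists_euclideanBound Y
  exact isomorphicToHilbert_of_forall_euclideanBound Y C fun E _ =>
    hC.of_linearIsometry E.subtypeₗᵢ

/-- A space which is not Hilbertian contains, within each closed subspace of finite codimension,
finite-dimensional subspaces arbitrarily far from Euclidean. -/
lemma exists_far_from_euclidean (hY : ¬ IsomorphicToHilbert Y) (W : Submodule ℝ Y)
    (hW : IsClosed (W : Set Y)) (hWc : W.CoFG) (n : ℕ) :
    ∃ E : Submodule ℝ Y, FiniteDimensional ℝ E ∧ E ≤ W ∧
      ∃ C : ℝ, (n : ℝ) < C ∧ EuclideanBound E C ∧ ¬ EuclideanBound E (C / 2) := by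
  obtain ⟨E₀, hE₀, hbad⟩ : ∃ E : Submodule ℝ W, FiniteDimensional ℝ E ∧
      ¬ EuclideanBound E (n : ℝ) := by
    by_contra! h
    exact hY (isomorphicToHilbert_of_finiteDimensional_quotient W hW
      (isomorphicToHilbert_of_forall_euclideanBound W n h))
  let E := E₀.map W.subtype
  have hE : ¬ EuclideanBound E (n : ℝ) := fun h =>
    hbad (h.of_linearIsometry ⟨(W.equivSubtypeMap E₀).toLinearMap, fun _ => rfl⟩)
  obtain ⟨C₀, -, hC₀⟩ := exists_euclideanBound E
  have hex : ∃ j : ℕ, ¬ EuclideanBound E (C₀ / 2 ^ j) := by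
    have hlim : Filter.Tendsto (fun j : ℕ => C₀ / 2 ^ j) Filter.atTop (nhds 0) :=
      tendsto_const_nhds.div_atTop (tendsto_pow_atTop_atTop_of_one_lt one_lt_two)
    rcases n.eq_zero_or_pos with rfl | hn
    · by_contra! h
      obtain ⟨k, T, hT⟩ := hC₀
      refine hE ⟨k, T, fun x => ⟨(hT x).1, ?_⟩⟩
      have hx : ‖x‖ ≤ 0 := by
        refine ge_of_tendsto' (f := fun j : ℕ => C₀ / 2 ^ j * ‖x‖) (x := Filter.atTop) ?_ fun j => ?_
        · simpa using hlim.mul_const ‖x‖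
        · obtain ⟨l, S, hS⟩ := h j
          exact (hS x).1.trans (hS x).2
      rw [norm_le_zero_iff.1 hx]
      simp
    · obtain ⟨j, hj⟩ := (hlim.eventually (gt_mem_nhds (show (0 : ℝ) < n by exact_mod_cast hn))).exists
      exact ⟨j, fun h => hE (h.mono hj.le)⟩
  classical
  obtain ⟨i, hi⟩ : ∃ i, Nat.find hex = i + 1 := Nat.exists_eq_succ_of_ne_zero fun h => by
    have := Nat.find_spec hex
    rw [h] at this
    simp only [pow_zero, div_one] at this
    exact this hC₀
  have h1 : EuclideanBound E (C₀ / 2 ^ i) := not_not.1 (Nat.find_min hex (by omega))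
  have h2 : ¬ EuclideanBound E (C₀ / 2 ^ i / 2) := by
    have := Nat.find_spec hex
    rwa [hi, pow_succ, ← div_div] at this
  refine ⟨E, inferInstance, Submodule.map_subtype_le W E₀, C₀ / 2 ^ i, ?_, h1, h2⟩
  by_contra! h
  exact hE (h1.mono h)

/-- Mazur's lemma: a finite-dimensional subspace is complemented, with uniform bounds, in its sum
with a suitable closed subspace of finite codimension. -/
lemma exists_almost_orthogonal (V : Submodule ℝ Y) [FiniteDimensional ℝ V] :
    ∃ W : Submodule ℝ Y, IsClosed (W : Set Y) ∧ W.CoFG ∧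
      ∀ v ∈ V, ∀ w ∈ W, ‖v‖ ≤ 2 * ‖v + w‖ := by
  have : ProperSpace V := FiniteDimensional.proper_real V
  obtain ⟨S, hS, hSf, hSc⟩ := (isCompact_sphere (0 : V) 1).finite_cover_balls
    (e := 1 / 2) (by norm_num)
  have : Finite S := hSf
  choose φ hφ1 hφ2 using fun s : S => exists_dual_vector'' ℝ ((s : V) : Y)
  let Φ : Y →L[ℝ] (S → ℝ) := ContinuousLinearMap.pi φ
  refine ⟨LinearMap.ker (Φ : Y →ₗ[ℝ] (S → ℝ)), Φ.isClosed_ker, Submodule.CoFG.ker _,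
    fun v hv w hw => ?_⟩
  rcases eq_or_ne v 0 with rfl | hv0
  · simp
  let v' : V := ⟨v, hv⟩
  have hv' : ‖(‖v'‖⁻¹ • v')‖ = 1 := norm_smul_inv_norm (fun h => hv0 (congrArg Subtype.val h))
  obtain ⟨s, hs, hvs⟩ := Set.mem_iUnion₂.1
    (hSc (show ‖v'‖⁻¹ • v' ∈ Metric.sphere (0 : V) 1 by simpa using hv'))
  have hs1 : ‖s‖ = 1 := by simpa using hS hs
  have hpos : 0 < ‖v‖ := norm_pos_iff.2 hv0
  let ψ := φ ⟨s, hs⟩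
  have hψ : ∀ y, ψ y ≤ ‖y‖ := fun y => (le_abs_self _).trans
    ((ψ.le_opNorm y).trans (mul_le_of_le_one_left (norm_nonneg y) (hφ1 _)))
  have hψs : ψ (s : Y) = 1 := (hφ2 ⟨s, hs⟩).trans hs1
  have hψw : ψ w = 0 := congrFun (LinearMap.mem_ker.1 hw) ⟨s, hs⟩
  have h1 : ψ ((s : Y) - ‖v‖⁻¹ • v) ≤ 1 / 2 := by
    refine (hψ _).trans ?_
    have := Metric.mem_ball'.1 hvs
    rw [dist_eq_norm] at this
    exact this.le
  rw [map_sub, hψs, map_smul, smul_eq_mul, inv_mul_eq_div] at h1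
  have h2 : 1 / 2 * ‖v‖ ≤ ψ v := by
    rw [← le_div_iff₀ hpos]
    linarith
  have h3 := hψ (v + w)
  rw [map_add, hψw] at h3
  linarith

variable (Y) in
/-- A finite-dimensional subspace `E` whose distance to a Euclidean space is about `C`, together
with a nearly optimal map to a Euclidean space, and a Euclidean subspace of the same
ambient space. -/
structure EuclideanBlock where
  E : Submodule ℝ Y
  finiteDimensional : FiniteDimensional ℝ E
  C : ℝ
  k : ℕ
  T : E →ₗ[ℝ] EuclideanSpace ℝ (Fin k)
  U : EuclideanSpace ℝ (Fin k) →ₗ[ℝ] Y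
  T_bounds : ∀ e, ‖e‖ ≤ ‖T e‖ ∧ ‖T e‖ ≤ C * ‖e‖
  U_bounds : ∀ t, ‖t‖ ≤ ‖U t‖ ∧ ‖U t‖ ≤ 10 * ‖t‖
  far : ¬ EuclideanBound E (C / 2)

lemma norm_bounds_of_almost_orthogonal {Z : Type*} [NormedAddCommGroup Z] {v e u w : Z}
    (h1 : ‖v + e + u‖ ≤ 2 * ‖v + e + u + w‖)
    (h2 : ‖v + e‖ ≤ 2 * ‖v + e + u‖) (h3 : ‖v‖ ≤ 2 * ‖v + e‖) :
    ‖e‖ ≤ 12 * ‖v + e + u + w‖ ∧ ‖u‖ ≤ 12 * ‖v + e + u + w‖ := by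
  have h4 : ‖e‖ ≤ ‖v + e‖ + ‖v‖ := by simpa using norm_sub_le (v + e) v
  have h5 : ‖u‖ ≤ ‖v + e + u‖ + ‖v + e‖ := by simpa using norm_sub_le (v + e + u) (v + e)
  constructor <;> linarith [norm_nonneg (v + e + u + w)]

lemma exists_euclideanBlock (hY : ¬ IsomorphicToHilbert Y) (n : ℕ) (V W : Submodule ℝ Y)
    (hV : FiniteDimensional ℝ V) (hW : IsClosed (W : Set Y)) (hWc : W.CoFG) :
    ∃ (B : EuclideanBlock Y) (V' W' : Submodule ℝ Y), FiniteDimensional ℝ V' ∧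
      IsClosed (W' : Set Y) ∧ W'.CoFG ∧ (n : ℝ) < B.C ∧ V ≤ V' ∧ W' ≤ W ∧
      B.E ≤ V' ⊓ W ∧ LinearMap.range B.U ≤ V' ⊓ W ∧
      ∀ v ∈ V, ∀ e : B.E, ∀ t, ∀ w ∈ W', ‖e‖ ≤ 12 * ‖v + e + B.U t + w‖ ∧
        ‖t‖ ≤ 12 * ‖v + e + B.U t + w‖ := by
  obtain ⟨A₁, hA₁, hA₁c, hVA⟩ := exists_almost_orthogonal V
  obtain ⟨E, hE, hEW, C, hnC, ⟨k, T, hT⟩, hfar⟩ := exists_far_from_euclidean hY (W ⊓ A₁)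
    (hW.inter hA₁) (hWc.inf hA₁c) n
  obtain ⟨A₂, hA₂, hA₂c, hEA⟩ := exists_almost_orthogonal (V ⊔ E)
  have hZ : ¬ FiniteDimensional ℝ ↥(W ⊓ A₁ ⊓ A₂) := fun h => hY <| by
    have : Module.Finite ℝ (Y ⧸ (W ⊓ A₁ ⊓ A₂)) := (hWc.inf hA₁c).inf hA₂c
    have : FiniteDimensional ℝ Y := Module.Finite.of_submodule_quotient (W ⊓ A₁ ⊓ A₂)
    exact isomorphicToHilbert_of_finiteDimensional
  obtain ⟨U₀, hU₀⟩ := weak_dvoretzky hZ k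
  let U : EuclideanSpace ℝ (Fin k) →ₗ[ℝ] Y := (W ⊓ A₁ ⊓ A₂).subtype ∘ₗ U₀
  have hU : ∀ t, U t ∈ W ⊓ A₁ ⊓ A₂ := fun t => (U₀ t).2
  obtain ⟨A₃, hA₃, hA₃c, hUA⟩ := exists_almost_orthogonal (V ⊔ E ⊔ LinearMap.range U)
  refine ⟨⟨E, hE, C, k, T, U, hT, hU₀, hfar⟩, V ⊔ E ⊔ LinearMap.range U, W ⊓ A₁ ⊓ A₂ ⊓ A₃,
    inferInstance, ((hW.inter hA₁).inter hA₂).inter hA₃, ((hWc.inf hA₁c).inf hA₂c).inf hA₃c, hnC,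
    le_sup_left.trans le_sup_left, inf_le_left.trans (inf_le_left.trans inf_le_left),
    le_inf (le_sup_right.trans le_sup_left) (hEW.trans inf_le_left), le_inf le_sup_right ?_, ?_⟩
  · rintro _ ⟨t, rfl⟩
    exact (hU t).1.1
  · intro v hv e t w hw
    have he : v + (e : Y) ∈ V ⊔ E := Submodule.add_mem_sup hv e.2
    obtain ⟨h1, h2⟩ := norm_bounds_of_almost_orthogonal
      (hUA _ (Submodule.add_mem_sup he ⟨t, rfl⟩) w hw.2) (hEA _ he _ (hU t).2)
      (hVA v hv e (hEW e.2).2)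
    exact ⟨h1, (hU₀ t).1.trans h2⟩

lemma exists_euclideanBlock_sequence (hY : ¬ IsomorphicToHilbert Y) :
    ∃ (B : ℕ → EuclideanBlock Y) (V W : ℕ → Submodule ℝ Y), Monotone V ∧ Antitone W ∧
      ∀ n : ℕ, (n : ℝ) < (B n).C ∧ (B n).E ≤ V (n + 1) ⊓ W n ∧
        LinearMap.range (B n).U ≤ V (n + 1) ⊓ W n ∧
        ∀ v ∈ V n, ∀ e : (B n).E, ∀ t, ∀ w ∈ W (n + 1),
          ‖e‖ ≤ 12 * ‖v + e + (B n).U t + w‖ ∧ ‖t‖ ≤ 12 * ‖v + e + (B n).U t + w‖ := by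
  let S := {p : Submodule ℝ Y × Submodule ℝ Y //
    FiniteDimensional ℝ p.1 ∧ IsClosed (p.2 : Set Y) ∧ p.2.CoFG}
  have hstep : ∀ (n : ℕ) (s : S), ∃ (B : EuclideanBlock Y) (s' : S), (n : ℝ) < B.C ∧
      s.1.1 ≤ s'.1.1 ∧ s'.1.2 ≤ s.1.2 ∧ B.E ≤ s'.1.1 ⊓ s.1.2 ∧
      LinearMap.range B.U ≤ s'.1.1 ⊓ s.1.2 ∧
      ∀ v ∈ s.1.1, ∀ e : B.E, ∀ t, ∀ w ∈ s'.1.2, ‖e‖ ≤ 12 * ‖v + e + B.U t + w‖ ∧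
        ‖t‖ ≤ 12 * ‖v + e + B.U t + w‖ := by
    rintro n ⟨⟨V, W⟩, hV, hW, hWc⟩
    obtain ⟨B, V', W', hV', hW', hWc', h⟩ := exists_euclideanBlock hY n V W hV hW hWc
    exact ⟨B, ⟨⟨V', W'⟩, hV', hW', hWc'⟩, h⟩
  choose B next h using hstep
  let s : ℕ → S := fun n => Nat.rec
    ⟨(⊥, ⊤), inferInstance, isClosed_univ, Submodule.CoFG.top⟩ next n
  exact ⟨fun n => B n (s n), fun n => (s n).1.1, fun n => (s n).1.2,
    monotone_nat_of_le_succ fun n => (h n (s n)).2.1,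
    antitone_nat_of_succ_le fun n => (h n (s n)).2.2.1,
    fun n => ⟨(h n (s n)).1, (h n (s n)).2.2.2⟩⟩

end Construction

section Linearization

open Filter Topology in
lemma norm_fderiv_le_of_le {E F Z : Type*} [NormedAddCommGroup E] [NormedSpace ℝ E]
    [NormedAddCommGroup F] [NormedSpace ℝ F] [NormedAddCommGroup Z] [NormedSpace ℝ Z]
    {f : E → F} {f' : E →L[ℝ] F} {x : E} (hf : HasFDerivAt f f' x) (Q : E →ₗ[ℝ] Z) {c : ℝ}
    (h : ∀ y, ‖f y - f x‖ ≤ c * ‖Q (y - x)‖) (v : E) : ‖f' v‖ ≤ c * ‖Q v‖ := by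
  have hlim := (hf.lim v (c := fun n : ℕ => (n : ℝ)) (l := atTop) (by
    simpa using tendsto_natCast_atTop_atTop)).norm
  refine le_of_tendsto hlim ?_
  filter_upwards [eventually_gt_atTop 0] with n hn
  have hn' : (0 : ℝ) < n := by exact_mod_cast hn
  have h1 := h (x + (n : ℝ)⁻¹ • v)
  rw [add_sub_cancel_left, map_smul, norm_smul, Real.norm_of_nonneg (by positivity)] at h1
  rw [norm_smul, Real.norm_of_nonneg hn'.le]
  calc (n : ℝ) * _ ≤ n * (c * ((n : ℝ)⁻¹ * ‖Q v‖)) := by gcongr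
    _ = c * ‖Q v‖ := by field_simp

/-- A map which satisfies Lipschitz-type estimates relative to linear maps can be replaced by its
derivative at some point, by Rademacher's theorem. -/
lemma exists_linear_of_lipschitz {E F Z : Type*} [NormedAddCommGroup E] [NormedSpace ℝ E]
    [FiniteDimensional ℝ E] [NormedAddCommGroup F] [NormedSpace ℝ F] [FiniteDimensional ℝ F]
    [NormedAddCommGroup Z] [NormedSpace ℝ Z] (S : E →ₗ[ℝ] F) (Q : E × F →ₗ[ℝ] Z) {c : ℝ}
    (hc : 0 ≤ c) (a : E × F → E)
    (h1 : ∀ x y, ‖(x - y).1 - (a x - a y)‖ ≤ c * ‖Q (x - y)‖)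
    (h2 : ∀ x y, ‖(x - y).2 - S (a x - a y)‖ ≤ c * ‖Q (x - y)‖) :
    ∃ α : E × F →ₗ[ℝ] E, ∀ x, ‖x.1 - α x‖ ≤ c * ‖Q x‖ ∧ ‖x.2 - S (α x)‖ ≤ c * ‖Q x‖ := by
  let Q' := LinearMap.toContinuousLinearMap Q
  let S' := LinearMap.toContinuousLinearMap S
  have hlip : LipschitzWith (1 + c * ‖Q'‖).toNNReal a := by
    refine LipschitzWith.of_dist_le_mul fun x y => ?_
    rw [dist_eq_norm, dist_eq_norm, Real.coe_toNNReal _ (by positivity)]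
    have h3 : ‖a x - a y‖ ≤ ‖(x - y).1‖ + ‖(x - y).1 - (a x - a y)‖ := by
      simpa using norm_sub_le (x - y).1 ((x - y).1 - (a x - a y))
    have h4 : c * ‖Q (x - y)‖ ≤ c * (‖Q'‖ * ‖x - y‖) := by
      gcongr
      exact Q'.le_opNorm _
    linarith [h1 x y, norm_fst_le (x - y)]
  borelize (E × F)
  obtain ⟨x, hx⟩ := (hlip.ae_differentiableAt (μ := MeasureTheory.Measure.addHaar)).exists
  have hα := hx.hasFDerivAt
  refine ⟨fderiv ℝ a x, fun v => ⟨?_, ?_⟩⟩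
  · refine norm_fderiv_le_of_le (f := fun y => y.1 - a y)
      (hasFDerivAt_fst.sub hα) Q (fun y => ?_) v
    have := h1 y x
    rwa [Prod.fst_sub, sub_sub_sub_comm] at this
  · refine norm_fderiv_le_of_le (f := fun y => y.2 - S' (a y))
      (hasFDerivAt_snd.sub (S'.hasFDerivAt.comp x hα)) Q (fun y => ?_) v
    have := h2 y x
    rwa [Prod.snd_sub, map_sub, sub_sub_sub_comm] at this

lemma EuclideanBound.of_innerProductSpace {E H : Type*} [NormedAddCommGroup E] [NormedSpace ℝ E]
    [NormedAddCommGroup H] [InnerProductSpace ℝ H] [FiniteDimensional ℝ H] {C : ℝ} (T : E →ₗ[ℝ] H)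
    (hT : ∀ x, ‖x‖ ≤ ‖T x‖ ∧ ‖T x‖ ≤ C * ‖x‖) : EuclideanBound E C :=
  ⟨_, (stdOrthonormalBasis ℝ H).repr.toLinearEquiv.toLinearMap ∘ₗ T, fun x => by simpa using hT x⟩

/-- A projection-like map `α` onto the graph of `√C⁻¹ • T` improves the distance of `E` to a
Euclidean space from `C` to a multiple of `√C`. -/
lemma EuclideanBound.of_graph_map {E F Z : Type*} [NormedAddCommGroup E] [NormedSpace ℝ E]
    [NormedAddCommGroup F] [InnerProductSpace ℝ F] [FiniteDimensional ℝ F]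
    [NormedAddCommGroup Z] [NormedSpace ℝ Z] {C c : ℝ} (hC : 0 < C) (hc : 0 ≤ c)
    (T : E →ₗ[ℝ] F) (hT : ∀ e, ‖e‖ ≤ ‖T e‖ ∧ ‖T e‖ ≤ C * ‖e‖)
    (Q : E × F →ₗ[ℝ] Z) (hQ1 : ∀ e, ‖Q (e, 0)‖ ≤ ‖e‖) (hQ2 : ∀ t, ‖Q (0, t)‖ ≤ 10 * ‖t‖)
    (hQ : ∀ e, Q (e, (√C)⁻¹ • T e) = 0) (α : E × F →ₗ[ℝ] E)
    (hα : ∀ x, ‖x.1 - α x‖ ≤ c * ‖Q x‖ ∧ ‖x.2 - (√C)⁻¹ • T (α x)‖ ≤ c * ‖Q x‖) :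
    EuclideanBound E (15 * c * √C) := by
  have hs : 0 < √C := Real.sqrt_pos.2 hC
  have hss : √C * √C = C := Real.mul_self_sqrt hC.le
  let B : E →ₗ[ℝ] E := α ∘ₗ LinearMap.inl ℝ E F
  have hB : ∀ e, ‖T (B e)‖ ≤ c * √C * ‖e‖ := by
    intro e
    have h1 := (hα (e, 0)).2
    rw [zero_sub, norm_neg, norm_smul, Real.norm_of_nonneg (by positivity), inv_mul_le_iff₀ hs]
      at h1
    refine h1.trans ?_
    calc √C * (c * ‖Q (e, 0)‖) ≤ √C * (c * ‖e‖) := by gcongr; exact hQ1 e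
      _ = _ := by ring
  have hD : ∀ t, ‖α (0, t)‖ ≤ 10 * c * ‖t‖ := by
    intro t
    have h1 := (hα (0, t)).1
    rw [zero_sub, norm_neg] at h1
    refine h1.trans ?_
    calc c * ‖Q (0, t)‖ ≤ c * (10 * ‖t‖) := by gcongr; exact hQ2 t
      _ = _ := by ring
  have hsum : ∀ e, e = B e + α (0, (√C)⁻¹ • T e) := by
    intro e
    have h1 := (hα (e, (√C)⁻¹ • T e)).1
    rw [hQ, norm_zero, mul_zero, norm_le_zero_iff, sub_eq_zero] at h1
    refine h1.trans ?_
    rw [LinearMap.comp_apply, LinearMap.inl_apply, ← map_add, Prod.mk_add_mk, add_zero, zero_add]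
  let R : E →ₗ[ℝ] WithLp 2 (F × F) := (WithLp.linearEquiv 2 ℝ (F × F)).symm.toLinearMap ∘ₗ
    ((√2) • (T ∘ₗ B).prod ((10 * c * (√C)⁻¹) • T))
  have hR : ∀ e, ‖R e‖ ^ 2 = 2 * (‖T (B e)‖ ^ 2 + (10 * c * (√C)⁻¹ * ‖T e‖) ^ 2) := by
    intro e
    rw [WithLp.prod_norm_sq_eq_of_L2]
    change ‖√2 • T (B e)‖ ^ 2 + ‖√2 • (10 * c * (√C)⁻¹) • T e‖ ^ 2 = _
    rw [norm_smul, norm_smul, norm_smul, Real.norm_of_nonneg (by positivity : 0 ≤ √(2 : ℝ)),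
      Real.norm_of_nonneg (by positivity : 0 ≤ 10 * c * (√C)⁻¹), mul_pow, mul_pow,
      Real.sq_sqrt zero_le_two, mul_add]
  refine EuclideanBound.of_innerProductSpace R fun e => ⟨?_, ?_⟩
  · refine le_of_sq_le_sq ?_ (norm_nonneg _)
    have h1 : ‖e‖ ≤ ‖T (B e)‖ + 10 * c * (√C)⁻¹ * ‖T e‖ := by
      conv_lhs => rw [hsum e]
      refine (norm_add_le _ _).trans (add_le_add (hT _).1 ((hD _).trans_eq ?_))
      rw [norm_smul, Real.norm_of_nonneg (by positivity)]
      ring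
    rw [hR]
    nlinarith [pow_le_pow_left₀ (norm_nonneg e) h1 2,
      sq_nonneg (‖T (B e)‖ - 10 * c * (√C)⁻¹ * ‖T e‖)]
  · refine le_of_sq_le_sq ?_ (by positivity)
    have h1 : 10 * c * (√C)⁻¹ * ‖T e‖ ≤ 10 * (c * √C * ‖e‖) :=
      calc 10 * c * (√C)⁻¹ * ‖T e‖ ≤ 10 * c * (√C)⁻¹ * (√C * √C * ‖e‖) := by
            gcongr
            rw [hss]
            exact (hT e).2
        _ = _ := by field_simp
    rw [hR]
    nlinarith [pow_le_pow_left₀ (norm_nonneg _) (hB e) 2, pow_le_pow_left₀ (by positivity) h1 2,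
      sq_nonneg (c * √C * ‖e‖)]

end Linearization

section Assembly

variable {Y : Type*} [NormedAddCommGroup Y] [NormedSpace ℝ Y]

/-- The graph, inside the ambient space, of a multiple of the map from the far-from-Euclidean
subspace to the Euclidean one. -/
noncomputable def EuclideanBlock.graph (B : EuclideanBlock Y) : Submodule ℝ Y :=
  LinearMap.range (B.E.subtype + (√B.C)⁻¹ • B.U ∘ₗ B.T)

lemma EuclideanBlock.finiteDimensional_graph (B : EuclideanBlock Y) :
    FiniteDimensional ℝ B.graph := by
  have := B.finiteDimensional
  unfold graph
  infer_instance

lemma EuclideanBlock.graph_le {B : EuclideanBlock Y} {V : Submodule ℝ Y} (hE : B.E ≤ V)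
    (hU : LinearMap.range B.U ≤ V) : B.graph ≤ V := by
  rintro _ ⟨e, rfl⟩
  exact V.add_mem (hE e.2) (V.smul_mem _ (hU ⟨_, rfl⟩))

lemma EuclideanBlock.euclideanBound_of_lipschitz (B : EuclideanBlock Y) (hC : 0 < B.C)
    (M N : Submodule ℝ Y) [IsClosed (M : Set Y)] (hGM : B.graph ≤ M) (hM : M ≤ B.graph ⊔ N)
    (hN : ∀ (e : B.E) (t : EuclideanSpace ℝ (Fin B.k)), ∀ z ∈ N,
      ‖e‖ ≤ 12 * ‖(e : Y) + B.U t + z‖ ∧ ‖t‖ ≤ 12 * ‖(e : Y) + B.U t + z‖)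
    {K : ℝ≥0} {ψ : Y ⧸ M → Y} (hψ : LipschitzWith K ψ)
    (hψM : ∀ u : Y ⧸ M, Submodule.Quotient.mk (ψ u) = u) :
    EuclideanBound B.E (15 * (12 * K) * √B.C) := by
  have := B.finiteDimensional
  let P : B.E × EuclideanSpace ℝ (Fin B.k) →ₗ[ℝ] Y := B.E.subtype.coprod B.U
  let Q : B.E × EuclideanSpace ℝ (Fin B.k) →ₗ[ℝ] Y ⧸ M := M.mkQ ∘ₗ P
  have hQP : ∀ x, ‖Q x‖ ≤ ‖P x‖ := fun x => Submodule.Quotient.norm_mk_le M (P x)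
  have hQ0 : ∀ e, Q (e, (√B.C)⁻¹ • B.T e) = 0 := fun e => by
    refine (Submodule.Quotient.mk_eq_zero M).2 (hGM ⟨e, ?_⟩)
    simp [P]
  have hdec : ∀ x, ∃ (a : B.E) (z : Y), z ∈ N ∧
      ψ (Q x) = P (x.1 - a, x.2 - ((√B.C)⁻¹ • B.T) a) + z := by
    intro x
    have hx : ψ (Q x) - P x ∈ M := (Submodule.Quotient.eq M).1 (hψM (Q x))
    obtain ⟨_, ⟨a, rfl⟩, z, hz, h⟩ := Submodule.mem_sup.1 (hM hx)
    refine ⟨-a, z, hz, ?_⟩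
    rw [sub_eq_iff_eq_add.1 h.symm]
    simp only [P, LinearMap.coprod_apply, LinearMap.add_apply, LinearMap.smul_apply,
      LinearMap.comp_apply, Submodule.subtype_apply, map_neg, map_add, map_smul, sub_neg_eq_add]
    abel
  choose a z hzN ha using hdec
  have hmain : ∀ x y, ‖(x - y).1 - (a x - a y)‖ ≤ 12 * K * ‖Q (x - y)‖ ∧
      ‖(x - y).2 - ((√B.C)⁻¹ • B.T) (a x - a y)‖ ≤ 12 * K * ‖Q (x - y)‖ := by
    intro x y
    have h1 : ‖ψ (Q x) - ψ (Q y)‖ ≤ K * ‖Q (x - y)‖ := by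
      rw [map_sub, ← dist_eq_norm, ← dist_eq_norm]
      exact hψ.dist_le_mul _ _
    have h2 : ψ (Q x) - ψ (Q y) = (((x - y).1 - (a x - a y) : B.E) : Y) +
        B.U ((x - y).2 - ((√B.C)⁻¹ • B.T) (a x - a y)) + (z x - z y) := by
      rw [ha x, ha y]
      simp only [P, LinearMap.coprod_apply, Submodule.subtype_apply, Prod.fst_sub, Prod.snd_sub,
        map_sub, Submodule.coe_sub]
      abel
    rw [h2] at h1
    have h3 := hN ((x - y).1 - (a x - a y)) ((x - y).2 - ((√B.C)⁻¹ • B.T) (a x - a y)) _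
      (N.sub_mem (hzN x) (hzN y))
    exact ⟨h3.1.trans (by linarith), h3.2.trans (by linarith)⟩
  obtain ⟨α, hα⟩ := exists_linear_of_lipschitz ((√B.C)⁻¹ • B.T) Q (c := 12 * K) (by positivity) a
    (fun x y => (hmain x y).1) (fun x y => (hmain x y).2)
  refine EuclideanBound.of_graph_map hC (by positivity) B.T B.T_bounds Q (fun e => ?_)
    (fun t => ?_) hQ0 α hα
  · exact (hQP _).trans_eq (by simp [P])
  · refine (hQP _).trans ?_
    simpa [P] using (B.U_bounds t).2

end Assembly

/-- Theorem 3.B.6: if for every closed subspace `M` of the real Banach space `X` the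
quotient map `X → X/M` admits a Lipschitz right inverse, then `X` is isomorphic to a
Hilbert space. -/
theorem lipschitz_right_inverse_of_quotient_map_implies_hilbert [CompleteSpace X]
    (h : ∀ (M : Submodule ℝ X) [IsClosed (M : Set X)],
      ∃ (K : ℝ≥0) (ψ : X ⧸ M → X), LipschitzWith K ψ ∧
        ∀ u : X ⧸ M, Submodule.Quotient.mk (ψ u) = u) :
    IsomorphicToHilbert X := by
  by_contra hX
  obtain ⟨B, V, W, hV, hW, hB⟩ := exists_euclideanBlock_sequence hX
  let M : Submodule ℝ X := (⨆ j, (B j).graph).topologicalClosure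
  have hMc : IsClosed (M : Set X) := Submodule.isClosed_topologicalClosure _
  obtain ⟨K, ψ, hψ, hψM⟩ := h M
  have hV' : ∀ j, (B j).graph ≤ V (j + 1) := fun j => EuclideanBlock.graph_le
    ((hB j).2.1.trans inf_le_left) ((hB j).2.2.1.trans inf_le_left)
  have hW' : ∀ j, (B j).graph ≤ W j := fun j => EuclideanBlock.graph_le
    ((hB j).2.1.trans inf_le_right) ((hB j).2.2.1.trans inf_le_right)
  obtain ⟨n, hn⟩ := exists_nat_gt ((30 * (12 * (K : ℝ))) ^ 2)
  obtain ⟨hnC, -, -, hsep⟩ := hB n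
  have hC : (30 * (12 * (K : ℝ))) ^ 2 < (B n).C := hn.trans hnC
  have hC0 : 0 < (B n).C := (sq_nonneg _).trans_lt hC
  let N₀ : Submodule ℝ X := ⨆ j, ⨆ _ : j ≠ n, (B j).graph
  have hN₀ : N₀ ≤ V n ⊔ W (n + 1) := iSup₂_le fun j hj => by
    rcases hj.lt_or_gt with hlt | hgt
    · exact (hV' j).trans ((hV hlt).trans le_sup_left)
    · exact (hW' j).trans ((hW hgt).trans le_sup_right)
  have hfin := (B n).finiteDimensional_graph
  have hM : M ≤ (B n).graph ⊔ N₀.topologicalClosure := by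
    refine Submodule.topologicalClosure_minimal _ (iSup_le fun j => ?_) ?_
    · rcases eq_or_ne j n with rfl | hj
      · exact le_sup_left
      · exact (le_iSup₂_of_le j hj le_rfl).trans
          (N₀.le_topologicalClosure.trans le_sup_right)
    · rw [sup_comm]
      exact Submodule.isClosed_sup_finiteDimensional _ _ N₀.isClosed_topologicalClosure
  have hbound := (B n).euclideanBound_of_lipschitz hC0 M N₀.topologicalClosure
    ((le_iSup (fun j => (B j).graph) n).trans (Submodule.le_topologicalClosure _)) hM
    (fun e t z hz => by
      let S : Set X := {z | ‖e‖ ≤ 12 * ‖(e : X) + (B n).U t + z‖ ∧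
        ‖t‖ ≤ 12 * ‖(e : X) + (B n).U t + z‖}
      have hcont : Continuous fun z => 12 * ‖(e : X) + (B n).U t + z‖ := by fun_prop
      have hS : IsClosed S :=
        (isClosed_le continuous_const hcont).inter (isClosed_le continuous_const hcont)
      refine hS.closure_subset_iff.2 (fun y hy => ?_) hz
      obtain ⟨v, hv, w, hw, rfl⟩ := Submodule.mem_sup.1 (hN₀ hy)
      have := hsep v hv e t w hw
      rwa [show v + (e : X) + (B n).U t + w = (e : X) + (B n).U t + (v + w) by abel] at this)
    hψ hψM
  refine (B n).far (hbound.mono ?_)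
  have h1 : 30 * (12 * (K : ℝ)) ≤ √(B n).C := Real.le_sqrt_of_sq_le hC.le
  have h2 : √(B n).C * √(B n).C = (B n).C := Real.mul_self_sqrt hC0.le
  nlinarith [Real.sqrt_nonneg (B n).C]
end
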